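/- Let d ≥ 2 and ν > 0, and let u_0 : ℝ^d → ℝ^d be a vector field whose components are Schwartz functions and which satisfies div u_0 = 0. Then there exist T > 0 and smooth functions u : [0,T] × ℝ^d → ℝ^d and 𝔭 : [0,T] × ℝ^d → ℝ with u(0,·) = u_0 and div u(t,·) = 0 for all t, solving the Navier–Stokes equations ∂_t u + (u·∇)u = νΔu − ∇𝔭 pointwise, such that for every integer N ≥ d+1 there exist functions a_k : [0,T] × S^{d-1} → ℝ^d for each integer k with d+1 ≤ k ≤ N, continuous in (t,θ) and continuously differentiable in t, with the following properties: (i) for every t ∈ [0,T] and every k, each of the d components of θ ↦ a_k(t,θ) is the restriction to the unit sphere S^{d-1} of a homogeneous harmonic polynomial on ℝ^d of degree k − d + 2; (ii) for every multi-index α there exists C > 0 such that for all t ∈ [0,T] and all x with |x| ≥ 2, |∂_x^α ( u(t,x) − Σ_{k=d+1}^{N} a_k(t, x/|x|) |x|^{-k} )| ≤ C |x|^{-(N+1)-|α|}. In particular |∂_x^α u(t,x)| ≤ C |x|^{-(d+1)-|α|} for |x| ≥ 2. -/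

import Mathlib

open MeasureTheory

/-- Partial derivative in direction `j`. -/
noncomputable def pd {d : ℕ} (j : Fin d) (f : (Fin d → ℝ) → ℝ) : (Fin d → ℝ) → ℝ :=
  fun x => fderiv ℝ f x (Pi.single j 1)

/-- Iterated partial derivative `∂^α`. -/
noncomputable def pdm {d : ℕ} (α : Fin d → ℕ) (f : (Fin d → ℝ) → ℝ) : (Fin d → ℝ) → ℝ :=
  (List.finRange d).foldr (fun j g => (pd j)^[α j] g) f

/-- The Euclidean norm `|x|` on `ℝ^d`. -/
noncomputable def eucNorm {d : ℕ} (x : Fin d → ℝ) : ℝ := Real.sqrt (∑ i, x i ^ 2)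

namespace NS

abbrev E (d : ℕ) := Fin d → ℝ
abbrev Fn (d : ℕ) := ℝ → (Fin d → ℝ) → ℂ

variable {d : ℕ}

noncomputable abbrev pj (k : Fin d) : E d →L[ℝ] ℝ := ContinuousLinearMap.proj k

noncomputable def gr (c : Fin d → ℂ) : E d →L[ℝ] ℂ :=
  ∑ k, (pj k).smulRight (c k)

lemma gr_apply (c : Fin d → ℂ) (w : E d) : gr c w = ∑ k, (w k : ℂ) * c k := by
  simp [gr, ContinuousLinearMap.sum_apply]

lemma gr_single (c : Fin d → ℂ) (j : Fin d) : gr c (Pi.single j 1) = c j := by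
  rw [gr_apply, Finset.sum_eq_single j]
  · simp
  · intro b _ hb; simp [Pi.single_eq_of_ne hb]
  · simp

lemma norm_gr_le (c : Fin d → ℂ) : ‖gr c‖ ≤ ∑ k, ‖c k‖ := by
  refine ContinuousLinearMap.opNorm_le_bound _ (Finset.sum_nonneg fun _ _ => norm_nonneg _) ?_
  intro w
  rw [gr_apply, Finset.sum_mul]
  refine (norm_sum_le _ _).trans (Finset.sum_le_sum fun k _ => ?_)
  rw [norm_mul, mul_comm]
  gcongr
  simpa using norm_le_pi_norm w k

lemma gr_eq (L : E d →L[ℝ] ℂ) : L = gr (fun k => L (Pi.single k 1)) := by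
  ext w
  rw [gr_apply]
  conv_lhs => rw [← Finset.univ_sum_single w]
  rw [map_sum]
  refine Finset.sum_congr rfl fun k _ => ?_
  have : (Pi.single k (w k) : E d) = (w k) • Pi.single k (1:ℝ) := by
    rw [← Pi.single_smul]; simp
  rw [this, map_smul]; simp

lemma gr_add (c e : Fin d → ℂ) : gr (fun k => c k + e k) = gr c + gr e := by
  ext w; simp [gr_apply, mul_add, Finset.sum_add_distrib]

lemma gr_mul (a : ℂ) (c : Fin d → ℂ) : gr (fun k => a * c k) = a • gr c := by
  ext w; simp [gr_apply, Finset.mul_sum, mul_left_comm]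

lemma gr_sub (c e : Fin d → ℂ) : gr (fun k => c k - e k) = gr c - gr e := by
  ext w; simp [gr_apply, mul_sub, Finset.sum_sub_distrib]

/-- joint continuity -/
def JC (f : Fn d) : Prop := Continuous (fun z : ℝ × E d => f z.1 z.2)

def RD (f : Fn d) : Prop :=
  JC f ∧ ∀ M : ℕ, ∃ C, ∀ t ξ, ‖f t ξ‖ * (1 + ‖ξ‖) ^ M ≤ C
def PB (f : Fn d) : Prop :=
  JC f ∧ ∃ (a : ℕ) (C : ℝ), ∀ t ξ, ‖f t ξ‖ ≤ C * (1 + ‖ξ‖) ^ a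
def KB (f : Fn d) : Prop :=
  JC f ∧ ∃ a : ℕ, ∀ b : ℕ, ∃ C, ∀ t ξ, ‖f t ξ‖ * (1 + |t|) ^ b ≤ C * (1 + ‖ξ‖) ^ a

def HT (f ft : Fn d) : Prop := ∀ t ξ, HasDerivAt (fun s => f s ξ) (ft t ξ) t
def HX (f : Fn d) (fx : Fin d → Fn d) : Prop :=
  ∀ t ξ, HasFDerivAt (f t) (gr (fun k => fx k t ξ)) ξ

def Cl (B : Fn d → Prop) : ℕ → Fn d → Prop
  | 0, f => B f
  | r + 1, f => B f ∧ (∃ ft, HT f ft ∧ Cl B r ft) ∧ ∃ fx, HX f fx ∧ ∀ k, Cl B r (fx k)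

lemma Cl.base {B : Fn d → Prop} {r f} (h : Cl B r f) : B f := by
  cases r with
  | zero => exact h
  | succ r => exact h.1

lemma Cl.pred {B : Fn d → Prop} : ∀ {r f}, Cl B (r+1) f → Cl B r f
  | 0, _, h => h.1
  | r+1, _, ⟨h0, ⟨ft, h1, h2⟩, fx, h3, h4⟩ =>
    ⟨h0, ⟨ft, h1, Cl.pred h2⟩, fx, h3, fun k => Cl.pred (h4 k)⟩

lemma Cl.mono {B B' : Fn d → Prop} (hB : ∀ f, B f → B' f) : ∀ {r f}, Cl B r f → Cl B' r f
  | 0, _, h => hB _ h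
  | r+1, _, ⟨h0, ⟨ft, h1, h2⟩, fx, h3, h4⟩ =>
    ⟨hB _ h0, ⟨ft, h1, Cl.mono hB h2⟩, fx, h3, fun k => Cl.mono hB (h4 k)⟩

lemma Cl.add {B : Fn d → Prop} (hB : ∀ f g, B f → B g → B (fun t ξ => f t ξ + g t ξ)) :
    ∀ {r f g}, Cl B r f → Cl B r g → Cl B r (fun t ξ => f t ξ + g t ξ)
  | 0, _, _, hf, hg => hB _ _ hf hg
  | r+1, _, _, ⟨h0, ⟨ft, h1, h2⟩, fx, h3, h4⟩, ⟨k0, ⟨gt, k1, k2⟩, gx, k3, k4⟩ =>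
    ⟨hB _ _ h0 k0, ⟨_, fun t ξ => (h1 t ξ).add (k1 t ξ), Cl.add hB h2 k2⟩,
      fun k t ξ => fx k t ξ + gx k t ξ, fun t ξ => by
        have := (h3 t ξ).add (k3 t ξ)
        rw [← gr_add] at this; exact this, fun k => Cl.add hB (h4 k) (k4 k)⟩

lemma Cl.mul {B₁ B₂ B₃ : Fn d → Prop}
    (hB : ∀ f g, B₃ f → B₃ g → B₃ (fun t ξ => f t ξ + g t ξ))
    (hM : ∀ f g, B₁ f → B₂ g → B₃ (fun t ξ => f t ξ * g t ξ)) :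
    ∀ {r f g}, Cl B₁ r f → Cl B₂ r g → Cl B₃ r (fun t ξ => f t ξ * g t ξ)
  | 0, _, _, hf, hg => hM _ _ hf hg
  | r+1, f, g, ⟨h0, ⟨ft, h1, h2⟩, fx, h3, h4⟩, ⟨k0, ⟨gt, k1, k2⟩, gx, k3, k4⟩ => by
    have cf : Cl B₁ r f := Cl.pred ⟨h0, ⟨ft, h1, h2⟩, fx, h3, h4⟩
    have cg : Cl B₂ r g := Cl.pred ⟨k0, ⟨gt, k1, k2⟩, gx, k3, k4⟩
    refine ⟨hM _ _ h0 k0, ⟨_, fun t ξ => (h1 t ξ).mul (k1 t ξ),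
      Cl.add hB (Cl.mul hB hM h2 cg) (Cl.mul hB hM cf k2)⟩,
      fun k t ξ => fx k t ξ * g t ξ + f t ξ * gx k t ξ, fun t ξ => ?_,
      fun k => Cl.add hB (Cl.mul hB hM (h4 k) cg) (Cl.mul hB hM cf (k4 k))⟩
    have := (h3 t ξ).mul (k3 t ξ)
    refine this.congr_fderiv ?_
    ext w
    simp only [ContinuousLinearMap.add_apply, ContinuousLinearMap.smul_apply, gr_apply,
      smul_eq_mul, Finset.mul_sum,
      Finset.sum_mul, ← Finset.sum_add_distrib]
    refine Finset.sum_congr rfl fun k _ => ?_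
    ring

lemma one_le_jb (ξ : E d) : 1 ≤ 1 + ‖ξ‖ := by linarith [norm_nonneg ξ]
lemma jb_pos (ξ : E d) : 0 < 1 + ‖ξ‖ := by linarith [norm_nonneg ξ]

lemma PB.add {f g : Fn d} (hf : PB f) (hg : PB g) : PB (fun t ξ => f t ξ + g t ξ) := by
  obtain ⟨cf, a, A, hA⟩ := hf
  obtain ⟨cg, b, B, hB⟩ := hg
  refine ⟨Continuous.add cf cg, a + b, |A| + |B|, fun t ξ => ?_⟩
  have h1 := one_le_jb ξ
  have e1 : (1 + ‖ξ‖) ^ a ≤ (1 + ‖ξ‖) ^ (a + b) := pow_le_pow_right₀ h1 (by omega)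
  have e2 : (1 + ‖ξ‖) ^ b ≤ (1 + ‖ξ‖) ^ (a + b) := pow_le_pow_right₀ h1 (by omega)
  calc ‖f t ξ + g t ξ‖ ≤ A * (1 + ‖ξ‖) ^ a + B * (1 + ‖ξ‖) ^ b :=
        (norm_add_le _ _).trans (add_le_add (hA t ξ) (hB t ξ))
    _ ≤ |A| * (1 + ‖ξ‖) ^ (a + b) + |B| * (1 + ‖ξ‖) ^ (a + b) := by
        gcongr <;> exact le_abs_self _
    _ = _ := by ring

lemma PB.mul {f g : Fn d} (hf : PB f) (hg : PB g) : PB (fun t ξ => f t ξ * g t ξ) := by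
  obtain ⟨cf, a, A, hA⟩ := hf
  obtain ⟨cg, b, B, hB⟩ := hg
  refine ⟨Continuous.mul cf cg, a + b, |A| * |B|, fun t ξ => ?_⟩
  have h1 := jb_pos ξ
  calc ‖f t ξ * g t ξ‖ = ‖f t ξ‖ * ‖g t ξ‖ := norm_mul _ _
    _ ≤ (|A| * (1 + ‖ξ‖) ^ a) * (|B| * (1 + ‖ξ‖) ^ b) := by
        gcongr
        · exact (hA t ξ).trans (by gcongr; exact le_abs_self _)
        · exact (hB t ξ).trans (by gcongr; exact le_abs_self _)
    _ = _ := by rw [pow_add]; ring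

lemma KB.add {f g : Fn d} (hf : KB f) (hg : KB g) : KB (fun t ξ => f t ξ + g t ξ) := by
  obtain ⟨cf, a, hA⟩ := hf
  obtain ⟨cg, b, hB⟩ := hg
  refine ⟨Continuous.add cf cg, a + b, fun n => ?_⟩
  obtain ⟨A, hA⟩ := hA n
  obtain ⟨B, hB⟩ := hB n
  refine ⟨|A| + |B|, fun t ξ => ?_⟩
  have h1 := one_le_jb ξ
  have e1 : (1 + ‖ξ‖) ^ a ≤ (1 + ‖ξ‖) ^ (a + b) := pow_le_pow_right₀ h1 (by omega)
  have e2 : (1 + ‖ξ‖) ^ b ≤ (1 + ‖ξ‖) ^ (a + b) := pow_le_pow_right₀ h1 (by omega)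
  calc ‖f t ξ + g t ξ‖ * (1 + |t|) ^ n ≤ (‖f t ξ‖ + ‖g t ξ‖) * (1 + |t|) ^ n := by
        gcongr; exact norm_add_le _ _
    _ ≤ A * (1 + ‖ξ‖) ^ a + B * (1 + ‖ξ‖) ^ b := by
        rw [add_mul]; exact (add_le_add (hA t ξ) (hB t ξ))
    _ ≤ |A| * (1 + ‖ξ‖) ^ (a + b) + |B| * (1 + ‖ξ‖) ^ (a + b) := by
        gcongr <;> exact le_abs_self _
    _ = _ := by ring

lemma PB.mulKB {f g : Fn d} (hf : PB f) (hg : KB g) : KB (fun t ξ => f t ξ * g t ξ) := by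
  obtain ⟨cf, a, A, hA⟩ := hf
  obtain ⟨cg, b, hB⟩ := hg
  refine ⟨Continuous.mul cf cg, a + b, fun n => ?_⟩
  obtain ⟨B, hB⟩ := hB n
  refine ⟨|A| * |B|, fun t ξ => ?_⟩
  have h1 := jb_pos ξ
  calc ‖f t ξ * g t ξ‖ * (1 + |t|) ^ n = ‖f t ξ‖ * (‖g t ξ‖ * (1 + |t|) ^ n) := by
        rw [norm_mul]; ring
    _ ≤ (|A| * (1 + ‖ξ‖) ^ a) * (|B| * (1 + ‖ξ‖) ^ b) := by
        exact mul_le_mul ((hA t ξ).trans (by gcongr; exact le_abs_self _))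
          ((hB t ξ).trans (by gcongr; exact le_abs_self _)) (by positivity) (by positivity)
    _ = _ := by rw [pow_add]; ring

lemma KB.PB {f : Fn d} (hf : KB f) : PB f := by
  obtain ⟨cf, a, hA⟩ := hf
  obtain ⟨A, hA⟩ := hA 0
  exact ⟨cf, a, A, fun t ξ => by simpa using hA t ξ⟩

lemma RD.PB {f : Fn d} (hf : RD f) : PB f := by
  obtain ⟨cf, hA⟩ := hf
  obtain ⟨A, hA⟩ := hA 0
  exact ⟨cf, 0, A, fun t ξ => by simpa using hA t ξ⟩

lemma RD.add {f g : Fn d} (hf : RD f) (hg : RD g) : RD (fun t ξ => f t ξ + g t ξ) := by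
  obtain ⟨cf, hA⟩ := hf
  obtain ⟨cg, hB⟩ := hg
  refine ⟨Continuous.add cf cg, fun n => ?_⟩
  obtain ⟨A, hA⟩ := hA n
  obtain ⟨B, hB⟩ := hB n
  refine ⟨A + B, fun t ξ => ?_⟩
  have h1 := jb_pos ξ
  calc ‖f t ξ + g t ξ‖ * (1 + ‖ξ‖) ^ n ≤ (‖f t ξ‖ + ‖g t ξ‖) * (1 + ‖ξ‖) ^ n := by
        gcongr; exact norm_add_le _ _
    _ ≤ A + B := by rw [add_mul]; exact (add_le_add (hA t ξ) (hB t ξ))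

lemma PB.mulRD {f g : Fn d} (hf : PB f) (hg : RD g) : RD (fun t ξ => f t ξ * g t ξ) := by
  obtain ⟨cf, a, A, hA⟩ := hf
  obtain ⟨cg, hB⟩ := hg
  refine ⟨Continuous.mul cf cg, fun n => ?_⟩
  obtain ⟨B, hB⟩ := hB (a + n)
  refine ⟨|A| * B, fun t ξ => ?_⟩
  have h1 := jb_pos ξ
  calc ‖f t ξ * g t ξ‖ * (1 + ‖ξ‖) ^ n = ‖f t ξ‖ * (‖g t ξ‖ * (1 + ‖ξ‖) ^ n) := by
        rw [norm_mul]; ring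
    _ ≤ (|A| * (1 + ‖ξ‖) ^ a) * (‖g t ξ‖ * (1 + ‖ξ‖) ^ n) := by
        gcongr
        exact (hA t ξ).trans (by gcongr; exact le_abs_self _)
    _ = |A| * (‖g t ξ‖ * (1 + ‖ξ‖) ^ (a + n)) := by rw [pow_add]; ring
    _ ≤ _ := by gcongr; exact hB t ξ

lemma ClPB_add {r} {f g : Fn d} (hf : Cl PB r f) (hg : Cl PB r g) :
    Cl PB r (fun t ξ => f t ξ + g t ξ) := Cl.add (fun _ _ => PB.add) hf hg
lemma ClKB_add {r} {f g : Fn d} (hf : Cl KB r f) (hg : Cl KB r g) :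
    Cl KB r (fun t ξ => f t ξ + g t ξ) := Cl.add (fun _ _ => KB.add) hf hg
lemma ClRD_add {r} {f g : Fn d} (hf : Cl RD r f) (hg : Cl RD r g) :
    Cl RD r (fun t ξ => f t ξ + g t ξ) := Cl.add (fun _ _ => RD.add) hf hg
lemma ClPB_mul {r} {f g : Fn d} (hf : Cl PB r f) (hg : Cl PB r g) :
    Cl PB r (fun t ξ => f t ξ * g t ξ) := Cl.mul (fun _ _ => PB.add) (fun _ _ => PB.mul) hf hg
lemma ClPB_mulKB {r} {f g : Fn d} (hf : Cl PB r f) (hg : Cl KB r g) :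
    Cl KB r (fun t ξ => f t ξ * g t ξ) := Cl.mul (fun _ _ => KB.add) (fun _ _ => PB.mulKB) hf hg
lemma ClPB_mulRD {r} {f g : Fn d} (hf : Cl PB r f) (hg : Cl RD r g) :
    Cl RD r (fun t ξ => f t ξ * g t ξ) := Cl.mul (fun _ _ => RD.add) (fun _ _ => PB.mulRD) hf hg
lemma ClKB_PB {r} {f : Fn d} (hf : Cl KB r f) : Cl PB r f := hf.mono (fun _ => KB.PB)
lemma ClRD_PB {r} {f : Fn d} (hf : Cl RD r f) : Cl PB r f := hf.mono (fun _ => RD.PB)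

lemma PB_const (c : ℂ) : PB (fun _ _ => c : Fn d) :=
  ⟨continuous_const, 0, ‖c‖, fun t ξ => by simp⟩

lemma ClPB_const : ∀ (r : ℕ) (c : ℂ), Cl PB r (fun _ _ => c : Fn d)
  | 0, c => PB_const c
  | r+1, c => ⟨PB_const c, ⟨fun _ _ => 0, fun t ξ => hasDerivAt_const _ _, ClPB_const r 0⟩,
      fun _ _ _ => 0, fun t ξ => by
        refine (hasFDerivAt_const c ξ).congr_fderiv ?_
        ext w; simp [gr_apply], fun k => ClPB_const r 0⟩

lemma ClPB_coord (r : ℕ) (j : Fin d) : Cl PB r (fun _ ξ => (ξ j : ℂ) : Fn d) := by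
  have h0 : PB (fun _ ξ => (ξ j : ℂ) : Fn d) := by
    refine ⟨?_, 1, 1, fun t ξ => ?_⟩
    · unfold JC; fun_prop
    · have := norm_le_pi_norm ξ j
      simp only [Complex.norm_real, pow_one, one_mul]; linarith
  cases r with
  | zero => exact h0
  | succ r =>
    refine ⟨h0, ⟨fun _ _ => 0, fun t ξ => hasDerivAt_const _ _, ClPB_const r 0⟩,
      fun k _ _ => if k = j then 1 else 0, fun t ξ => ?_, fun k => ClPB_const r _⟩
    have : HasFDerivAt (fun ξ : E d => (ξ j : ℂ))
      (Complex.ofRealCLM.comp (pj j)) ξ :=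
      (Complex.ofRealCLM.comp (pj j)).hasFDerivAt
    refine this.congr_fderiv ?_
    ext w; simp [gr_apply]

lemma ClRD_cmul {r} (c : ℂ) {f : Fn d} (hf : Cl RD r f) : Cl RD r (fun t ξ => c * f t ξ) :=
  ClPB_mulRD (ClPB_const r c) hf
lemma ClRD_neg {r} {f : Fn d} (hf : Cl RD r f) : Cl RD r (fun t ξ => - f t ξ) := by
  simpa using ClRD_cmul (-1) hf
lemma ClRD_sub {r} {f g : Fn d} (hf : Cl RD r f) (hg : Cl RD r g) :
    Cl RD r (fun t ξ => f t ξ - g t ξ) := by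
  simpa [sub_eq_add_neg] using ClRD_add hf (ClRD_neg hg)
lemma ClRD_coord {r} (j : Fin d) {f : Fn d} (hf : Cl RD r f) :
    Cl RD r (fun t ξ => (ξ j : ℂ) * f t ξ) := ClPB_mulRD (ClPB_coord r j) hf

lemma RD_zero : RD (fun _ _ => 0 : Fn d) := ⟨continuous_const, fun M => ⟨0, fun t ξ => by simp⟩⟩

lemma ClRD_zero (r) : Cl RD r (fun _ _ => 0 : Fn d) := by
  have h : Cl RD r (fun _ _ => 0 : Fn d) := by
    induction r with
    | zero => exact RD_zero
    | succ r ih => exact ⟨RD_zero, ⟨fun _ _ => 0, fun t ξ => hasDerivAt_const _ _, ih⟩,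
      fun _ _ _ => 0, fun t ξ => by
        refine (hasFDerivAt_const 0 ξ).congr_fderiv ?_
        ext w; simp [gr_apply], fun k => ih⟩
  exact h

lemma ClRD_sum {r} {ι : Type*} (s : Finset ι) {f : ι → Fn d} (hf : ∀ i ∈ s, Cl RD r (f i)) :
    Cl RD r (fun t ξ => ∑ i ∈ s, f i t ξ) := by
  classical
  induction s using Finset.induction_on with
  | empty => simpa using ClRD_zero r
  | insert a s ha ih =>
    simp only [Finset.sum_insert ha]
    exact ClRD_add (hf a (by simp)) (ih fun i hi => hf i (by simp [hi]))

lemma ClPB_sum {r} {ι : Type*} (s : Finset ι) {f : ι → Fn d} (hf : ∀ i ∈ s, Cl PB r (f i)) :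
    Cl PB r (fun t ξ => ∑ i ∈ s, f i t ξ) := by
  classical
  induction s using Finset.induction_on with
  | empty => simpa using ClPB_const r 0
  | insert a s ha ih =>
    simp only [Finset.sum_insert ha]
    exact ClPB_add (hf a (by simp)) (ih fun i hi => hf i (by simp [hi]))

def sq (ξ : E d) : ℝ := ∑ i, ξ i ^ 2

lemma ClPB_sq (r : ℕ) : Cl PB r (fun _ ξ => (sq ξ : ℂ) : Fn d) := by
  have : (fun _ ξ => (sq ξ : ℂ) : Fn d) = fun t ξ => ∑ i, (ξ i : ℂ) * (ξ i : ℂ) := by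
    funext t ξ; simp [sq, pow_two]
  rw [this]
  exact ClPB_sum _ fun i _ => ClPB_mul (ClPB_coord r i) (ClPB_coord r i)

lemma intJ {M : ℕ} (hM : d + 1 ≤ M) : Integrable (fun η : E d => ((1 + ‖η‖) ^ M)⁻¹) := by
  have h := integrable_one_add_norm (E := E d) (μ := volume) (r := (M : ℝ))
    (by simp; exact_mod_cast hM)
  refine h.congr (.of_forall fun η => ?_)
  simp only
  rw [Real.rpow_neg (jb_pos η).le, Real.rpow_natCast]

noncomputable def JI (d : ℕ) : ℝ := ∫ η : E d, ((1 + ‖η‖) ^ (d + 1))⁻¹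
lemma JI_nonneg : 0 ≤ JI d := integral_nonneg fun η => by positivity

def WB (M : ℕ) (A : ℝ) (f : Fn d) : Prop := JC f ∧ ∀ t ξ, ‖f t ξ‖ * (1 + ‖ξ‖) ^ M ≤ A

lemma WB.nonneg {M A} {f : Fn d} (h : WB M A f) : 0 ≤ A :=
  le_trans (by positivity) (h.2 0 0)
lemma WB.mono {M A} {f : Fn d} (h : WB M A f) {M'} (hM : M' ≤ M) : WB M' A f :=
  ⟨h.1, fun t ξ => le_trans (by have := one_le_jb ξ; gcongr) (h.2 t ξ)⟩
lemma WB.le {M A} {f : Fn d} (h : WB M A f) (t ξ) : ‖f t ξ‖ ≤ A * ((1 + ‖ξ‖) ^ M)⁻¹ := by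
  have := jb_pos ξ
  rw [← div_eq_mul_inv, le_div_iff₀ (by positivity)]; exact h.2 t ξ
lemma WB.le' {M A} {f : Fn d} (h : WB M A f) (t ξ) : ‖f t ξ‖ ≤ A := by
  simpa using (h.mono (Nat.zero_le M)).2 t ξ
lemma RD.WB {f : Fn d} (h : RD f) (M : ℕ) : ∃ A, WB M A f := by
  obtain ⟨A, hA⟩ := h.2 M; exact ⟨A, h.1, hA⟩
lemma JC.t {f : Fn d} (h : JC f) (t : ℝ) : Continuous (f t) :=
  h.comp (continuous_const.prodMk continuous_id : Continuous fun ξ : E d => (t, ξ))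
lemma JC.x {f : Fn d} (h : JC f) (ξ : E d) : Continuous (fun t => f t ξ) :=
  h.comp (continuous_id.prodMk continuous_const : Continuous fun t : ℝ => (t, ξ))

def MB (m : E d → ℂ) : Prop := Measurable m ∧ ∀ η, ‖m η‖ ≤ 2

noncomputable def Q (m : E d → ℂ) (f g : Fn d) : Fn d :=
  fun t ξ => ∫ η, m η * (f t η * g t (ξ - η))

lemma Q_meas {m : E d → ℂ} (hm : MB m) {f g : Fn d} (hf : JC f) (hg : JC g) (t ξ) :
    AEStronglyMeasurable (fun η => m η * (f t η * g t (ξ - η))) volume := by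
  refine hm.1.aestronglyMeasurable.mul (Continuous.aestronglyMeasurable ?_)
  exact (hf.t t).mul ((hg.t t).comp (by fun_prop))

lemma Q_le {m : E d → ℂ} (hm : MB m) {f g : Fn d} {A B} {M : ℕ} (hf : WB M A f)
    (hg : WB 0 B g) (t ξ η) :
    ‖m η * (f t η * g t (ξ - η))‖ ≤ 2 * A * B * ((1 + ‖η‖) ^ M)⁻¹ := by
  rw [norm_mul, norm_mul]
  have h1 := hf.le t η
  have h2 := hg.le' t (ξ - η)
  have h3 := hm.2 η
  have := hf.nonneg
  have := jb_pos η
  calc _ ≤ 2 * (A * ((1 + ‖η‖) ^ M)⁻¹ * B) := by gcongr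
    _ = _ := by ring

lemma Q_int {m : E d → ℂ} (hm : MB m) {f g : Fn d} {A B} (hf : WB (d+1) A f)
    (hg : WB 0 B g) (t ξ) : Integrable (fun η => m η * (f t η * g t (ξ - η))) :=
  Integrable.mono' ((intJ le_rfl).const_mul _) (Q_meas hm hf.1 hg.1 t ξ)
    (.of_forall fun η => Q_le hm hf hg t ξ η)

lemma Q_JC {m : E d → ℂ} (hm : MB m) {f g : Fn d} {A B} (hf : WB (d+1) A f)
    (hg : WB 0 B g) : JC (Q m f g) := by
  refine continuous_of_dominated (F := fun (z : ℝ × E d) η => m η * (f z.1 η * g z.1 (z.2 - η)))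
    (fun z => Q_meas hm hf.1 hg.1 z.1 z.2)
    (fun z => Filter.Eventually.of_forall fun η => Q_le hm hf hg z.1 z.2 η)
    ((intJ le_rfl).const_mul _) (.of_forall fun η => ?_)
  refine continuous_const.mul (Continuous.mul ?_ ?_)
  · exact hf.1.comp (by fun_prop : Continuous fun z : ℝ × E d => (z.1, η))
  · exact hg.1.comp (by fun_prop : Continuous fun z : ℝ × E d => (z.1, z.2 - η))

lemma jb_split (ξ η : E d) (M : ℕ) :
    (1 + ‖ξ‖) ^ M ≤ 2 ^ M * ((1 + ‖η‖) ^ M + (1 + ‖ξ - η‖) ^ M) := by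
  have h : ‖ξ‖ ≤ ‖η‖ + ‖ξ - η‖ := by
    have := norm_add_le η (ξ - η); simpa using this
  have h1 := jb_pos η
  have h2 := jb_pos (ξ - η)
  have h3 := norm_nonneg ξ
  rcases le_total ‖η‖ ‖ξ - η‖ with h0 | h0
  · calc (1 + ‖ξ‖) ^ M ≤ (2 * (1 + ‖ξ - η‖)) ^ M := by gcongr; linarith
      _ = 2 ^ M * (1 + ‖ξ - η‖) ^ M := by rw [mul_pow]
      _ ≤ _ := by gcongr; have := pow_pos h1 M; linarith
  · calc (1 + ‖ξ‖) ^ M ≤ (2 * (1 + ‖η‖)) ^ M := by gcongr; linarith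
      _ = 2 ^ M * (1 + ‖η‖) ^ M := by rw [mul_pow]
      _ ≤ _ := by gcongr; have := pow_pos h2 M; linarith

lemma Q_WB {m : E d → ℂ} (hm : MB m) {f g : Fn d} {A B} {M : ℕ} (hM : d + 1 ≤ M)
    (hf : WB M A f) (hg : WB M B g) :
    WB M (2 ^ (M + 2) * JI d * A * B) (Q m f g) := by
  refine ⟨Q_JC hm (hf.mono hM) (hg.mono (Nat.zero_le _)), fun t ξ => ?_⟩
  have hA := hf.nonneg
  have hB := hg.nonneg
  have key : ∀ η, ‖m η * (f t η * g t (ξ - η))‖ * (1 + ‖ξ‖) ^ M ≤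
      2 ^ (M+1) * A * B * (((1 + ‖η‖) ^ (d+1))⁻¹ + ((1 + ‖ξ - η‖) ^ (d+1))⁻¹) := by
    intro η
    have h1 := jb_pos η
    have h2 := jb_pos (ξ - η)
    have e1 : ((1 + ‖η‖) ^ M)⁻¹ ≤ ((1 + ‖η‖) ^ (d+1))⁻¹ := by
      gcongr; exact one_le_jb η
    have e2 : ((1 + ‖ξ - η‖) ^ M)⁻¹ ≤ ((1 + ‖ξ - η‖) ^ (d+1))⁻¹ := by
      gcongr; exact one_le_jb _
    calc _ ≤ (2 * ((A * ((1 + ‖η‖) ^ M)⁻¹) * (B * ((1 + ‖ξ - η‖) ^ M)⁻¹))) *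
          (2 ^ M * ((1 + ‖η‖) ^ M + (1 + ‖ξ - η‖) ^ M)) := by
          rw [norm_mul, norm_mul]
          have := hm.2 η
          have := hf.le t η
          have := hg.le t (ξ - η)
          have := jb_split ξ η M
          gcongr
      _ = 2 ^ (M+1) * A * B * (((1 + ‖ξ - η‖) ^ M)⁻¹ + ((1 + ‖η‖) ^ M)⁻¹) := by
          field_simp; ring
      _ ≤ _ := by rw [add_comm (((1 + ‖η‖) ^ (d+1))⁻¹)]; gcongr
  have i1 : Integrable (fun η : E d => ((1 + ‖η‖) ^ (d+1))⁻¹) := intJ le_rfl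
  have i2 : Integrable (fun η : E d => ((1 + ‖ξ - η‖) ^ (d+1))⁻¹) := i1.comp_sub_left ξ
  calc ‖Q m f g t ξ‖ * (1 + ‖ξ‖) ^ M
      ≤ (∫ η, ‖m η * (f t η * g t (ξ - η))‖) * (1 + ‖ξ‖) ^ M := by
        gcongr; exact norm_integral_le_integral_norm _
    _ = ∫ η, ‖m η * (f t η * g t (ξ - η))‖ * (1 + ‖ξ‖) ^ M := by rw [integral_mul_const]
    _ ≤ ∫ η, 2 ^ (M+1) * A * B * (((1 + ‖η‖) ^ (d+1))⁻¹ + ((1 + ‖ξ - η‖) ^ (d+1))⁻¹) := by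
        refine integral_mono ?_ ((i1.add i2).const_mul _) key
        exact ((Q_int hm (hf.mono hM) (hg.mono (Nat.zero_le _)) t ξ).norm).mul_const _
    _ = _ := by
        rw [integral_const_mul, integral_add i1 i2]
        rw [integral_sub_left_eq_self (fun η : E d => ((1 + ‖η‖) ^ (d+1))⁻¹) volume ξ]
        unfold JI; ring

lemma Q_RD {m : E d → ℂ} (hm : MB m) {f g : Fn d} (hf : RD f) (hg : RD g) : RD (Q m f g) := by
  obtain ⟨A, hA⟩ := hf.WB (d+1)
  obtain ⟨B, hB⟩ := hg.WB 0
  refine ⟨Q_JC hm hA hB, fun M => ?_⟩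
  obtain ⟨A, hA⟩ := hf.WB (M + d+1)
  obtain ⟨B, hB⟩ := hg.WB (M + d+1)
  exact ⟨_, ((Q_WB hm (by omega) hA hB).mono (by omega : M ≤ M + d + 1)).2⟩

lemma Q_add_right {m : E d → ℂ} (hm : MB m) {f g g' : Fn d} {A B B'} (hf : WB (d+1) A f)
    (hg : WB 0 B g) (hg' : WB 0 B' g') (t ξ) :
    Q m f (fun t ξ => g t ξ + g' t ξ) t ξ = Q m f g t ξ + Q m f g' t ξ := by
  unfold Q
  rw [← integral_add (Q_int hm hf hg t ξ) (Q_int hm hf hg' t ξ)]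
  congr 1; ext η; ring

lemma Q_HT {m : E d → ℂ} (hm : MB m) {f g ft gt : Fn d} {A B A' B'} (hf : WB (d+1) A f)
    (hg : WB 0 B g) (hft : WB (d+1) A' ft) (hgt : WB 0 B' gt) (h1 : HT f ft) (h2 : HT g gt) :
    HT (Q m f g) (fun t ξ => Q m ft g t ξ + Q m f gt t ξ) := by
  intro t ξ
  have i1 := Q_int hm hft hg t ξ
  have i2 := Q_int hm hf hgt t ξ
  have := (hasDerivAt_integral_of_dominated_loc_of_deriv_le (μ := volume)
    (F := fun s η => m η * (f s η * g s (ξ - η)))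
    (F' := fun s η => m η * (ft s η * g s (ξ - η)) + m η * (f s η * gt s (ξ - η)))
    (x₀ := t) (s := Set.univ) (bound := fun η => 2 * A' * B * ((1 + ‖η‖) ^ (d+1))⁻¹ +
      2 * A * B' * ((1 + ‖η‖) ^ (d+1))⁻¹) Filter.univ_mem
    (.of_forall fun s => Q_meas hm hf.1 hg.1 s ξ)
    (Q_int hm hf hg t ξ) (i1.add i2).1
    (.of_forall fun η s _ => (norm_add_le _ _).trans
      (add_le_add (Q_le hm hft hg s ξ η) (Q_le hm hf hgt s ξ η)))
    (((intJ le_rfl).const_mul _).add ((intJ le_rfl).const_mul _))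
    (.of_forall fun η s _ => by
      have := ((h1 s η).mul (h2 s (ξ - η))).const_mul (m η)
      rw [mul_add] at this; exact this)).2
  rw [integral_add i1 i2] at this
  exact this

lemma gr_meas {F : Fin d → E d → ℂ} (hF : ∀ k, AEStronglyMeasurable (F k) volume) :
    AEStronglyMeasurable (fun η => gr (fun k => F k η)) volume := by
  unfold gr
  refine Finset.aestronglyMeasurable_fun_sum _ fun k _ => ?_
  have : Continuous fun c : ℂ =>
    (pj k).smulRight c :=
    (ContinuousLinearMap.smulRightL ℝ (E d) ℂ
      (pj k)).continuous
  exact this.comp_aestronglyMeasurable (hF k)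

lemma gr_integral {α : Type*} [MeasurableSpace α] {μ : Measure α} {F : Fin d → α → ℂ} (hF : ∀ k, Integrable (F k) μ) :
    ∫ η, gr (fun k => F k η) ∂μ = gr (fun k => ∫ η, F k η ∂μ) := by
  have hi : ∀ k ∈ Finset.univ, Integrable (fun η => (pj k).smulRight (F k η)) μ := by
    intro k _
    exact (ContinuousLinearMap.smulRightL ℝ (E d) ℂ
      (pj k)).integrable_comp (hF k)
  unfold gr
  rw [integral_finset_sum _ hi]
  refine Finset.sum_congr rfl fun k _ => ?_
  exact (ContinuousLinearMap.smulRightL ℝ (E d) ℂ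
      (pj k)).integral_comp_comm (hF k)

lemma Q_HX {m : E d → ℂ} (hm : MB m) {f g : Fn d} {gx : Fin d → Fn d} {A B} {B' : Fin d → ℝ}
    (hf : WB (d+1) A f) (hg : WB 0 B g) (hgx : ∀ k, WB 0 (B' k) (gx k)) (h2 : HX g gx) :
    HX (Q m f g) (fun k => Q m f (gx k)) := by
  intro t ξ
  have ii := fun k => Q_int hm hf (hgx k) t ξ
  have := hasFDerivAt_integral_of_dominated_of_fderiv_le (μ := volume) (𝕜 := ℝ)
    (F := fun ξ η => m η * (f t η * g t (ξ - η)))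
    (F' := fun ξ η => gr (fun k => m η * (f t η * gx k t (ξ - η))))
    (x₀ := ξ) (s := Set.univ) (bound := fun η => ∑ k, 2 * A * B' k * ((1 + ‖η‖) ^ (d+1))⁻¹)
    Filter.univ_mem
    (.of_forall fun ξ => Q_meas hm hf.1 hg.1 t ξ)
    (Q_int hm hf hg t ξ) (gr_meas fun k => (ii k).1)
    (.of_forall fun η s _ => (norm_gr_le _).trans
      (Finset.sum_le_sum fun k _ => Q_le hm hf (hgx k) t s η))
    (integrable_finset_sum _ fun k _ => (intJ le_rfl).const_mul _)
    (.of_forall fun η s _ => by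
      have h := (h2 t (s - η)).comp s ((hasFDerivAt_id s).sub_const η)
      have h' := (h.const_mul (f t η)).const_mul (m η)
      refine h'.congr_fderiv ?_
      rw [gr_mul, gr_mul]; rfl)
  rw [gr_integral ii] at this
  exact this

lemma Q_Cl {m : E d → ℂ} (hm : MB m) : ∀ {r} {f g : Fn d}, Cl RD r f → Cl RD r g →
    Cl RD r (Q m f g)
  | 0, _, _, hf, hg => Q_RD hm hf hg
  | r+1, f, g, ⟨h0, ⟨ft, h1, h2⟩, fx, h3, h4⟩, ⟨k0, ⟨gt, k1, k2⟩, gx, k3, k4⟩ => by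
    have cf : Cl RD r f := Cl.pred ⟨h0, ⟨ft, h1, h2⟩, fx, h3, h4⟩
    have cg : Cl RD r g := Cl.pred ⟨k0, ⟨gt, k1, k2⟩, gx, k3, k4⟩
    obtain ⟨A, hA⟩ := h0.WB (d+1)
    obtain ⟨B, hB⟩ := k0.WB 0
    obtain ⟨A', hA'⟩ := h2.base.WB (d+1)
    obtain ⟨B', hB'⟩ := k2.base.WB 0
    choose B'' hB'' using fun k => (k4 k).base.WB 0
    exact ⟨Q_RD hm h0 k0, ⟨_, Q_HT hm hA hB hA' hB' h1 k1,
      ClRD_add (Q_Cl hm h2 cg) (Q_Cl hm cf k2)⟩, _, Q_HX hm hA hB hB'' k3,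
      fun k => Q_Cl hm cf (k4 k)⟩

lemma leib {G Gt : ℝ → ℝ → ℂ} (hG : Continuous (Function.uncurry G))
    (hGt : Continuous (Function.uncurry Gt)) (C : ℝ) (hC : ∀ b s, ‖Gt b s‖ ≤ C)
    (hd : ∀ b s, HasDerivAt (fun b => G b s) (Gt b s) b) (t : ℝ) :
    HasDerivAt (fun t => ∫ s in (0:ℝ)..t, G t s) (G t t + ∫ s in (0:ℝ)..t, Gt t s) t := by
  have hGc : ∀ b, Continuous (G b) := fun b => hG.comp (by fun_prop : Continuous fun s => (b, s))
  have hGtc : ∀ b, Continuous (Gt b) := fun b => hGt.comp (by fun_prop : Continuous fun s => (b, s))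
  have h1 : ∀ v : ℝ × ℝ, HasDerivAt (fun b => ∫ s in (0:ℝ)..v.2, G b s)
      (∫ s in (0:ℝ)..v.2, Gt v.1 s) v.1 := by
    intro v
    refine (intervalIntegral.hasDerivAt_integral_of_dominated_loc_of_deriv_le (s := Set.univ)
      (bound := fun _ => C) (F := G) (F' := Gt) Filter.univ_mem
      (.of_forall fun b => (hGc b).aestronglyMeasurable)
      ((hGc _).intervalIntegrable _ _) (hGtc _).aestronglyMeasurable
      (.of_forall fun s _ b _ => hC b s) (by simp)
      (.of_forall fun s _ b _ => hd b s)).2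
  have h2 : ∀ v : ℝ × ℝ, HasDerivAt (fun a => ∫ s in (0:ℝ)..a, G v.1 s) (G v.1 v.2) v.2 := by
    intro v
    exact intervalIntegral.integral_hasDerivAt_right ((hGc _).intervalIntegrable _ _)
      (hGc v.1).aestronglyMeasurable.stronglyMeasurableAtFilter (hGc v.1).continuousAt
  have c1 : Continuous fun v : ℝ × ℝ => ∫ s in (0:ℝ)..v.2, Gt v.1 s := by
    refine intervalIntegral.continuous_parametric_intervalIntegral_of_continuous
      (f := fun v : ℝ × ℝ => Gt v.1) ?_ continuous_snd
    exact hGt.comp (by fun_prop : Continuous fun p : (ℝ × ℝ) × ℝ => (p.1.1, p.2))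
  have key := hasStrictFDerivAt_uncurry_coprod (𝕜 := ℝ) (u := (t, t))
    (f := fun b a => ∫ s in (0:ℝ)..a, G b s)
    (f₁ := fun b a => ContinuousLinearMap.toSpanSingleton ℝ (∫ s in (0:ℝ)..a, Gt b s))
    (f₂ := fun b a => ContinuousLinearMap.toSpanSingleton ℝ (G b a))
    (.of_forall fun v => (h1 v).hasFDerivAt)
    (.of_forall fun v => (h2 v).hasFDerivAt)
    (((ContinuousLinearMap.toSpanSingletonCLE (𝕜 := ℝ) (E := ℂ)).continuous.comp c1).continuousAt)
    (((ContinuousLinearMap.toSpanSingletonCLE (𝕜 := ℝ) (E := ℂ)).continuous.comp hG).continuousAt)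
  have h3 : HasDerivAt (fun t : ℝ => (t, t)) ((1:ℝ), (1:ℝ)) t :=
    (hasDerivAt_id t).prodMk (hasDerivAt_id t)
  have := HasFDerivAt.comp_hasDerivAt (f := fun t : ℝ => (t, t)) t key.hasFDerivAt h3
  refine this.congr_deriv ?_
  simp [Function.HasUncurry.uncurry, ContinuousLinearMap.toSpanSingleton_apply]
  ring

noncomputable def Dk (k F : Fn d) : Fn d := fun t ξ => ∫ s in (0:ℝ)..t, k (t - s) ξ * F s ξ

lemma Dk_cont {k F : Fn d} (hk : JC k) (hF : JC F) :
    Continuous (fun p : (ℝ × E d) × ℝ => k (p.1.1 - p.2) p.1.2 * F p.2 p.1.2) :=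
  (hk.comp (by fun_prop : Continuous fun p : (ℝ × E d) × ℝ => (p.1.1 - p.2, p.1.2))).mul
    (hF.comp (by fun_prop : Continuous fun p : (ℝ × E d) × ℝ => (p.2, p.1.2)))

lemma Dk_JC {k F : Fn d} (hk : JC k) (hF : JC F) : JC (Dk k F) :=
  intervalIntegral.continuous_parametric_intervalIntegral_of_continuous
      (f := fun (z : ℝ × E d) s => k (z.1 - s) z.2 * F s z.2) (Dk_cont hk hF) continuous_fst

lemma Dk_c1 {k F : Fn d} (hk : JC k) (hF : JC F) (t ξ) :
    Continuous (fun s => k (t - s) ξ * F s ξ) :=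
  (Dk_cont hk hF).comp (by fun_prop : Continuous fun s : ℝ => ((t, ξ), s))

lemma Dk_ii {k F : Fn d} (hk : JC k) (hF : JC F) (t ξ) (a b : ℝ) :
    IntervalIntegrable (fun s => k (t - s) ξ * F s ξ) volume a b :=
  (Dk_c1 hk hF t ξ).intervalIntegrable _ _

def KI (p : ℕ) (c : ℝ) (k : Fn d) : Prop :=
  JC k ∧ ∀ t ξ, |∫ s in (0:ℝ)..t, ‖k (t - s) ξ‖| * (1 + ‖ξ‖) ^ p ≤ c

lemma KI.nonneg {p c} {k : Fn d} (h : KI p c k) : 0 ≤ c := le_trans (by positivity) (h.2 0 0)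

lemma JC.sub {k : Fn d} (hk : JC k) (t ξ) : Continuous (fun s => k (t - s) ξ) :=
  hk.comp (by fun_prop : Continuous fun s : ℝ => (t - s, ξ))

lemma Dk_le {k F : Fn d} (hk : JC k) {B : ℝ} (ξ) (hB : ∀ s, ‖F s ξ‖ ≤ B) (t) :
    ‖Dk k F t ξ‖ ≤ |∫ s in (0:ℝ)..t, ‖k (t - s) ξ‖| * B := by
  have hB0 : 0 ≤ B := (norm_nonneg _).trans (hB 0)
  have := intervalIntegral.norm_integral_le_abs_of_norm_le (μ := volume) (a := 0) (b := t)
    (f := fun s => k (t - s) ξ * F s ξ) (g := fun s => ‖k (t - s) ξ‖ * B)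
    (.of_forall fun s => by rw [norm_mul]; gcongr; exact hB s)
    (((hk.sub t ξ).norm.mul continuous_const).intervalIntegrable _ _)
  rw [intervalIntegral.integral_mul_const, abs_mul, abs_of_nonneg hB0] at this
  exact this

lemma Dk_WB {k F : Fn d} {p c M B} (hk : KI p c k) (hF : WB M B F) :
    WB (M + p) (c * B) (Dk k F) := by
  refine ⟨Dk_JC hk.1 hF.1, fun t ξ => ?_⟩
  have h1 := jb_pos ξ
  have h2 := Dk_le hk.1 ξ (fun s => hF.le s ξ) t
  have h3 := hF.nonneg
  calc _ ≤ |∫ s in (0:ℝ)..t, ‖k (t - s) ξ‖| * (B * ((1 + ‖ξ‖) ^ M)⁻¹) * (1 + ‖ξ‖) ^ (M + p) := by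
        gcongr
    _ = (|∫ s in (0:ℝ)..t, ‖k (t - s) ξ‖| * (1 + ‖ξ‖) ^ p) * B := by
        rw [pow_add]; field_simp
    _ ≤ _ := by gcongr; exact hk.2 t ξ

noncomputable def LI : ℝ := ∫ s : ℝ, ((1 + |s|) ^ 2)⁻¹
lemma LI_int : Integrable (fun s : ℝ => ((1 + |s|) ^ 2)⁻¹) := by
  have h := integrable_one_add_norm (E := ℝ) (μ := volume) (r := 2) (by simp)
  refine h.congr (.of_forall fun s => ?_)
  simp only [Real.norm_eq_abs]
  rw [Real.rpow_neg (by positivity)]; norm_cast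

lemma LI_le {k : ℝ → ℂ} (hk : Continuous k) {C : ℝ} (h : ∀ s, ‖k s‖ * (1 + |s|) ^ 2 ≤ C) (t : ℝ) :
    |∫ s in (0:ℝ)..t, ‖k (t - s)‖| ≤ C * LI := by
  have hC : 0 ≤ C := le_trans (by positivity) (h 0)
  have i1 : Integrable (fun s : ℝ => C * ((1 + |t - s|) ^ 2)⁻¹) := (LI_int.comp_sub_left t).const_mul C
  rw [intervalIntegral.abs_intervalIntegral_eq]
  rw [abs_of_nonneg (integral_nonneg fun s => norm_nonneg _)]
  have hk2 : ∀ s, ‖k (t - s)‖ ≤ C * ((1 + |t - s|) ^ 2)⁻¹ := fun s => by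
    rw [← div_eq_mul_inv, le_div_iff₀ (by positivity)]; exact h _
  have i2 : Integrable (fun s => ‖k (t - s)‖) := by
    refine Integrable.mono' i1 (by fun_prop) (.of_forall fun s => ?_)
    rw [norm_norm]; exact hk2 s
  calc _ ≤ ∫ s, ‖k (t - s)‖ := setIntegral_le_integral i2 (.of_forall fun s => norm_nonneg _)
    _ ≤ ∫ s, C * ((1 + |t - s|) ^ 2)⁻¹ := integral_mono i2 i1 hk2
    _ = _ := by
      rw [integral_const_mul, integral_sub_left_eq_self (fun s : ℝ => ((1 + |s|) ^ 2)⁻¹) volume t]; rfl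

lemma Dk_RD {k F : Fn d} (hk : KB k) (hF : RD F) : RD (Dk k F) := by
  refine ⟨Dk_JC hk.1 hF.1, fun M => ?_⟩
  obtain ⟨cf, a, ha⟩ := hk
  obtain ⟨C, hC⟩ := ha 2
  obtain ⟨B, hB⟩ := hF.WB (a + M)
  refine ⟨C * LI * B, fun t ξ => ?_⟩
  have h1 := jb_pos ξ
  have h2 := Dk_le cf ξ (fun s => hB.le s ξ) t
  have h3 := LI_le (hk := cf.x ξ) (fun s => hC s ξ) t
  have h4 := hB.nonneg
  calc _ ≤ (C * (1 + ‖ξ‖) ^ a * LI) * (B * ((1 + ‖ξ‖) ^ (a + M))⁻¹) * (1 + ‖ξ‖) ^ M := by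
        gcongr
        exact h2.trans (by gcongr)
    _ = _ := by rw [pow_add]; field_simp

lemma PBRD_bd {k F : Fn d} (hk : PB k) (hF : RD F) : ∃ C, ∀ t s ξ, ‖k t ξ * F s ξ‖ ≤ C := by
  obtain ⟨cf, a, A, hA⟩ := hk
  obtain ⟨B, hB⟩ := hF.2 a
  have hB0 : 0 ≤ B := le_trans (by positivity) (hB 0 0)
  refine ⟨|A| * B, fun t s ξ => ?_⟩
  have := jb_pos ξ
  calc ‖k t ξ * F s ξ‖ = ‖k t ξ‖ * ‖F s ξ‖ := norm_mul _ _
    _ ≤ (|A| * (1 + ‖ξ‖) ^ a) * ‖F s ξ‖ := by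
        gcongr
        exact (hA t ξ).trans (by gcongr; exact le_abs_self _)
    _ = |A| * (‖F s ξ‖ * (1 + ‖ξ‖) ^ a) := by ring
    _ ≤ _ := by gcongr; exact hB s ξ

lemma Dk_HT {k kt F : Fn d} (hk : PB k) (hkt : PB kt) (h : HT k kt) (hF : RD F) :
    HT (Dk k F) (fun t ξ => k 0 ξ * F t ξ + Dk kt F t ξ) := by
  intro t ξ
  obtain ⟨C, hC⟩ := PBRD_bd hkt hF
  have hc : ∀ k : Fn d, JC k → Continuous (Function.uncurry fun b s => k (b - s) ξ * F s ξ) :=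
    fun k hk => (Dk_cont hk hF.1).comp (by fun_prop : Continuous fun p : ℝ × ℝ => ((p.1, ξ), p.2))
  have := leib (G := fun b s => k (b - s) ξ * F s ξ) (Gt := fun b s => kt (b - s) ξ * F s ξ)
    (hc k hk.1) (hc kt hkt.1) C (fun b s => hC _ _ _) (fun b s => by
      have h1 := (h (b - s) ξ).scomp b ((hasDerivAt_id b).sub_const s)
      have h2 := h1.mul_const (F s ξ)
      simpa using h2) t
  simpa [Dk] using this

lemma gr_real_smul (a : ℝ) (c : Fin d → ℂ) : gr (fun k => a • c k) = a • gr c := by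
  ext w; simp [gr_apply, Finset.mul_sum, mul_left_comm]

lemma ClPB_at0 : ∀ {r} {k : Fn d}, Cl PB r k → Cl PB r (fun _ ξ => k 0 ξ)
  | 0, k, ⟨h, a, C, hC⟩ =>
    ⟨h.comp (by fun_prop : Continuous fun z : ℝ × E d => ((0:ℝ), z.2)), a, C, fun _ ξ => hC 0 ξ⟩
  | r+1, k, ⟨h0, _, fx, h3, h4⟩ =>
    ⟨ClPB_at0 (r := 0) h0, ⟨fun _ _ => 0, fun t ξ => hasDerivAt_const _ _, ClPB_const r 0⟩,
      fun j _ ξ => fx j 0 ξ, fun _ ξ => h3 0 ξ, fun j => ClPB_at0 (h4 j)⟩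

lemma Dk_HX {k F : Fn d} {kx Fx : Fin d → Fn d} (hk : PB k) (hkx : ∀ j, PB (kx j)) (h : HX k kx)
    (hF : RD F) (hFx : ∀ j, RD (Fx j)) (h' : HX F Fx) :
    HX (Dk k F) (fun j t ξ => Dk (kx j) F t ξ + Dk k (Fx j) t ξ) := by
  intro t ξ
  choose C hC using fun j => PBRD_bd (hkx j) hF
  choose C' hC' using fun j => PBRD_bd hk (hFx j)
  have hi : ∀ j, Continuous (fun s => kx j (t - s) ξ * F s ξ + k (t - s) ξ * Fx j s ξ) := fun j =>
    (Dk_c1 (hkx j).1 hF.1 t ξ).add (Dk_c1 hk.1 (hFx j).1 t ξ)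
  have := (intervalIntegral.hasFDerivAt_integral_of_dominated_of_fderiv_le (𝕜 := ℝ) (s := Set.univ)
    (μ := volume) (a := 0) (b := t) (x₀ := ξ)
    (F := fun ξ s => k (t - s) ξ * F s ξ)
    (F' := fun ξ s => gr (fun j => kx j (t - s) ξ * F s ξ + k (t - s) ξ * Fx j s ξ))
    (bound := fun _ => ∑ j, (C j + C' j)) Filter.univ_mem
    (.of_forall fun ξ => (Dk_c1 hk.1 hF.1 t ξ).aestronglyMeasurable)
    (Dk_ii hk.1 hF.1 t ξ _ _)
    (by
      refine Continuous.aestronglyMeasurable ?_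
      unfold gr
      refine continuous_finset_sum _ fun j _ => ?_
      exact (ContinuousLinearMap.smulRightL ℝ (E d) ℂ
        (pj j)).continuous.comp (hi j))
    (.of_forall fun s _ ξ _ => (norm_gr_le _).trans
      (Finset.sum_le_sum fun j _ => (norm_add_le _ _).trans
        (add_le_add (hC j _ _ _) (hC' j _ _ _)))) (by simp)
    (.of_forall fun s _ ξ _ => by
      refine ((h (t - s) ξ).mul (h' s ξ)).congr_fderiv ?_
      rw [gr_add, gr_mul]
      have : (fun j => kx j (t - s) ξ * F s ξ) = fun j => F s ξ * kx j (t - s) ξ := by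
        funext j; ring
      rw [this, gr_mul, add_comm]))
  refine this.congr_fderiv ?_
  rw [intervalIntegral.intervalIntegral_eq_integral_uIoc, gr_integral]
  · rw [← gr_real_smul]
    congr 1; funext j
    rw [← intervalIntegral.intervalIntegral_eq_integral_uIoc,
      intervalIntegral.integral_add (Dk_ii (hkx j).1 hF.1 t ξ _ _) (Dk_ii hk.1 (hFx j).1 t ξ _ _)]
    rfl
  · intro j
    exact intervalIntegrable_iff.1 ((hi j).intervalIntegrable _ _)

lemma Dk_Cl : ∀ {r} {k F : Fn d}, Cl KB r k → Cl RD r F → Cl RD r (Dk k F)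
  | 0, _, _, hf, hg => Dk_RD hf hg
  | r+1, k, F, ⟨h0, ⟨ft, h1, h2⟩, fx, h3, h4⟩, ⟨k0, ⟨gt, k1, k2⟩, gx, k3, k4⟩ => by
    have cf : Cl KB r k := Cl.pred ⟨h0, ⟨ft, h1, h2⟩, fx, h3, h4⟩
    have cg : Cl RD r F := Cl.pred ⟨k0, ⟨gt, k1, k2⟩, gx, k3, k4⟩
    refine ⟨Dk_RD h0 k0, ⟨_, Dk_HT h0.PB h2.base.PB h1 k0, ?_⟩, _,
      Dk_HX h0.PB (fun j => (h4 j).base.PB) h3 k0 (fun j => (k4 j).base) k3,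
      fun j => ClRD_add (Dk_Cl (h4 j) cg) (Dk_Cl cf (k4 j))⟩
    exact ClRD_add (ClPB_mulRD (ClPB_at0 (ClKB_PB cf)) cg) (Dk_Cl h2 cg)

lemma sq_ge (ξ : E d) : ‖ξ‖ ^ 2 ≤ sq ξ := by
  have h0 : 0 ≤ sq ξ := Finset.sum_nonneg fun i _ => sq_nonneg _
  have : ‖ξ‖ ≤ Real.sqrt (sq ξ) := by
    rw [pi_norm_le_iff_of_nonneg (Real.sqrt_nonneg _)]
    intro i
    rw [Real.norm_eq_abs]
    refine Real.abs_le_sqrt ?_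
    exact Finset.single_le_sum (f := fun i => ξ i ^ 2) (fun i _ => sq_nonneg _) (Finset.mem_univ i)
  calc ‖ξ‖ ^ 2 ≤ Real.sqrt (sq ξ) ^ 2 := by gcongr
    _ = sq ξ := Real.sq_sqrt h0
lemma sq_nn (ξ : E d) : 0 ≤ sq ξ := Finset.sum_nonneg fun i _ => sq_nonneg _

def Edec (e : ℝ → ℝ) : Prop := ContDiff ℝ (⊤ : ℕ∞) e ∧
  ∀ n : ℕ, ∃ C, ∀ y, |iteratedDeriv n e y| ≤ C * Real.exp (-|y|)
def Ccs (ψ : ℝ → ℝ) : Prop := ContDiff ℝ (⊤ : ℕ∞) ψ ∧ HasCompactSupport ψ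

lemma Edec.deriv {e} (h : Edec e) : Edec (deriv e) :=
  ⟨(contDiff_infty_iff_deriv.1 h.1).2, fun n => by
    obtain ⟨C, hC⟩ := h.2 (n+1); rw [iteratedDeriv_succ'] at hC; exact ⟨C, hC⟩⟩
lemma Edec.b {e} (h : Edec e) : ∃ C, 0 ≤ C ∧ ∀ y, |e y| ≤ C * Real.exp (-|y|) := by
  obtain ⟨C, hC⟩ := h.2 0; rw [iteratedDeriv_zero] at hC
  refine ⟨C, ?_, hC⟩
  have := (abs_nonneg _).trans (hC 0)
  simpa using this
lemma Edec.hd {e} (h : Edec e) (y) : HasDerivAt e (_root_.deriv e y) y :=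
  ((contDiff_infty_iff_deriv.1 h.1).1 y).hasDerivAt
lemma Ccs.hd {e} (h : Ccs e) (y) : HasDerivAt e (_root_.deriv e y) y :=
  ((contDiff_infty_iff_deriv.1 h.1).1 y).hasDerivAt
lemma Ccs.deriv {e} (h : Ccs e) : Ccs (deriv e) := ⟨(contDiff_infty_iff_deriv.1 h.1).2, h.2.deriv⟩
lemma Ccs.idmul {e} (h : Ccs e) : Ccs (fun t => t * e t) := ⟨contDiff_id.mul h.1, h.2.mul_left⟩
lemma Ccs.b {e} (h : Ccs e) (b : ℕ) : ∃ C, 0 ≤ C ∧ ∀ y, |e y| * (1 + |y|) ^ b ≤ C := by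
  have hc : Continuous (fun y => e y * (1 + |y|) ^ b) := h.1.continuous.mul (by fun_prop)
  obtain ⟨C, hC⟩ := hc.bounded_above_of_compact_support (h.2.mul_right)
  refine ⟨C, (norm_nonneg _).trans (hC 0), fun y => ?_⟩
  have := hC y
  rwa [norm_mul, Real.norm_eq_abs, Real.norm_eq_abs, abs_of_nonneg (by positivity : 0 ≤ (1 + |y|) ^ b)] at this

noncomputable def kern (ν : ℝ) (ψ e : ℝ → ℝ) : Fn d := fun τ ξ => ((ψ τ * e (ν * sq ξ * τ) : ℝ) : ℂ)

lemma sq_cont : Continuous (sq : E d → ℝ) := by unfold sq; fun_prop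

lemma kern_JC (ν : ℝ) {ψ e : ℝ → ℝ} (h : Continuous ψ) (h' : Continuous e) :
    JC (kern ν ψ e : Fn d) := by
  unfold JC kern
  have := sq_cont (d := d)
  fun_prop

lemma kern_KB (ν : ℝ) {ψ e : ℝ → ℝ} (h : Ccs ψ) (h' : Edec e) : KB (kern ν ψ e : Fn d) := by
  refine ⟨kern_JC ν h.1.continuous h'.1.continuous, 0, fun b => ?_⟩
  obtain ⟨C, hC0, hC⟩ := h.b b
  obtain ⟨C', hC0', hC'⟩ := h'.b
  refine ⟨C * C', fun t ξ => ?_⟩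
  have h1 : |e (ν * sq ξ * t)| ≤ C' := (hC' _).trans (mul_le_of_le_one_right hC0' (Real.exp_le_one_iff.2 (by simp only [Left.neg_nonpos_iff]; positivity)))
  rw [kern, Complex.norm_real, Real.norm_eq_abs, abs_mul]
  calc _ = (|ψ t| * (1 + |t|) ^ b) * |e (ν * sq ξ * t)| := by ring
    _ ≤ C * C' := mul_le_mul (hC t) h1 (abs_nonneg _) hC0
    _ = _ := by ring

lemma kern_HT (ν : ℝ) {ψ e : ℝ → ℝ} (h : Ccs ψ) (h' : Edec e) :
    HT (kern ν ψ e : Fn d) (fun t ξ => kern ν (deriv ψ) e t ξ +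
      (ν : ℂ) * ((sq ξ : ℂ) * kern ν ψ (deriv e) t ξ)) := by
  intro t ξ
  have h2 : HasDerivAt (fun s => e (ν * sq ξ * s)) (deriv e (ν * sq ξ * t) * (ν * sq ξ)) t := by
    have := (h'.hd (ν * sq ξ * t)).comp t ((hasDerivAt_id t).const_mul (ν * sq ξ))
    rw [mul_one] at this; exact this
  have := ((h.hd t).mul h2).ofReal_comp
  refine this.congr_deriv ?_
  simp [kern]; ring

lemma sq_hfd (ξ : E d) : HasFDerivAt (sq : E d → ℝ)
    (∑ i, (2 * ξ i) • (pj i)) ξ := by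
  unfold sq
  refine HasFDerivAt.fun_sum fun i _ => ?_
  have := ((pj i).hasFDerivAt (x := ξ)).pow 2
  simpa using this

lemma kern_HX (ν : ℝ) {ψ e : ℝ → ℝ} (h' : Edec e) :
    HX (kern ν ψ e : Fn d) (fun j t ξ => ((2 * ν : ℝ) : ℂ) * ((ξ j : ℂ) *
      kern ν (fun t => t * ψ t) (deriv e) t ξ)) := by
  intro t ξ
  have h2 : HasFDerivAt (fun ξ : E d => ν * sq ξ * t) _ ξ :=
    ((sq_hfd ξ).const_mul ν).mul_const t
  have h3 := (((h'.hd (ν * sq ξ * t)).comp_hasFDerivAt ξ h2).const_mul (ψ t))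
  have h4 := Complex.ofRealCLM.hasFDerivAt.comp ξ h3
  refine h4.congr_fderiv ?_
  ext w
  simp only [gr_apply, kern]
  simp [Finset.mul_sum, Finset.sum_mul]
  refine Finset.sum_congr rfl fun i _ => ?_
  ring

lemma kern_Cl (ν : ℝ) : ∀ (r : ℕ) {ψ e : ℝ → ℝ} (_ : Ccs ψ) (_ : Edec e),
    Cl KB r (kern ν ψ e : Fn d)
  | 0, _, _, h, h' => kern_KB ν h h'
  | r+1, ψ, e, h, h' => ⟨kern_KB ν h h', ⟨_, kern_HT ν h h',
      ClKB_add (kern_Cl ν r h.deriv h') (ClPB_mulKB (ClPB_const r _)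
        (ClPB_mulKB (ClPB_sq r) (kern_Cl ν r h h'.deriv)))⟩, _, kern_HX ν h',
      fun j => ClPB_mulKB (ClPB_const r _) (ClPB_mulKB (ClPB_coord r j)
        (kern_Cl ν r h.idmul h'.deriv))⟩

lemma LI_le' {k : ℝ → ℂ} (hk : Continuous k) {C μ : ℝ} (hμ : 0 < μ)
    (h : ∀ s, ‖k s‖ * (1 + μ * |s|) ^ 2 ≤ C) (t : ℝ) :
    |∫ s in (0:ℝ)..t, ‖k (t - s)‖| ≤ C * (μ⁻¹ * LI) := by
  have e : ∀ s, ((1 + |μ * s|) ^ 2)⁻¹ = ((1 + μ * |s|) ^ 2)⁻¹ := fun s => by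
    rw [abs_mul, abs_of_pos hμ]
  have L : Integrable (fun s : ℝ => ((1 + μ * |s|) ^ 2)⁻¹) := by
    simpa only [e] using LI_int.comp_mul_left' hμ.ne'
  have L2 : ∫ s : ℝ, ((1 + μ * |s|) ^ 2)⁻¹ = μ⁻¹ * LI := by
    have := Measure.integral_comp_mul_left (fun s : ℝ => ((1 + |s|) ^ 2)⁻¹) μ
    simp only [e] at this
    rw [this, abs_of_pos (by positivity)]; rfl
  have hC : 0 ≤ C := le_trans (by positivity) (h 0)
  have i1 : Integrable (fun s : ℝ => C * ((1 + μ * |t - s|) ^ 2)⁻¹) := (L.comp_sub_left t).const_mul C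
  rw [intervalIntegral.abs_intervalIntegral_eq]
  rw [abs_of_nonneg (integral_nonneg fun s => norm_nonneg _)]
  have hk2 : ∀ s, ‖k (t - s)‖ ≤ C * ((1 + μ * |t - s|) ^ 2)⁻¹ := fun s => by
    rw [← div_eq_mul_inv, le_div_iff₀ (by positivity)]; exact h _
  have i2 : Integrable (fun s => ‖k (t - s)‖) := by
    refine Integrable.mono' i1 (by fun_prop) (.of_forall fun s => ?_)
    rw [norm_norm]; exact hk2 s
  calc _ ≤ ∫ s, ‖k (t - s)‖ := setIntegral_le_integral i2 (.of_forall fun s => norm_nonneg _)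
    _ ≤ ∫ s, C * ((1 + μ * |t - s|) ^ 2)⁻¹ := integral_mono i2 i1 hk2
    _ = _ := by
      rw [integral_const_mul, integral_sub_left_eq_self (fun s : ℝ => ((1 + μ * |s|) ^ 2)⁻¹) volume t, L2]

lemma LI_nonneg : 0 ≤ LI := integral_nonneg fun _ => by positivity

lemma kern_comm (ν : ℝ) (hν : 0 < ν) {ψ e : ℝ → ℝ} (h : Ccs ψ) (h' : Edec e) (c0 : ℂ) (j : Fin d) :
    ∃ c, KI 1 c (fun t ξ => c0 * ((ξ j : ℂ) * kern ν (fun t => t * ψ t) e t ξ)) := by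
  obtain ⟨C, hC0, hC⟩ := h.b 3
  obtain ⟨C', hC0', hC'⟩ := h'.b
  have hJ := kern_JC (d := d) ν h.idmul.1.continuous h'.1.continuous
  have hJ2 : JC (fun t ξ => c0 * ((ξ j : ℂ) * kern ν (fun t => t * ψ t) e t ξ) : Fn d) :=
    continuous_const.mul (Continuous.mul (by fun_prop) hJ)
  refine ⟨‖c0‖ * C * C' * (1 + 2 / ν) * LI, hJ2, fun t ξ => ?_⟩
  have hx := norm_nonneg ξ
  have := LI_le (hJ2.x ξ) (C := ‖c0‖ * C * C' * (1 + 2 / ν) / (1 + ‖ξ‖)) (fun s => ?_) t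
  · rw [pow_one]
    calc _ ≤ (‖c0‖ * C * C' * (1 + 2 / ν) / (1 + ‖ξ‖) * LI) * (1 + ‖ξ‖) := by gcongr
      _ = _ := by have := jb_pos ξ; field_simp
  · rw [le_div_iff₀ (jb_pos ξ), norm_mul, norm_mul, kern, Complex.norm_real, Complex.norm_real,
      Real.norm_eq_abs, Real.norm_eq_abs, abs_mul, abs_mul]
    have h1 : |ξ j| ≤ ‖ξ‖ := by simpa using norm_le_pi_norm ξ j
    have h2 : |e (ν * sq ξ * s)| ≤ C' * Real.exp (-(ν * ‖ξ‖ ^ 2 * |s|)) := by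
      refine (hC' _).trans ?_
      gcongr
      rw [abs_mul, abs_mul, abs_of_pos hν, abs_of_nonneg (sq_nn ξ)]
      gcongr; exact sq_ge ξ
    set y := ν * ‖ξ‖ ^ 2 * |s| with hy
    have hy0 : 0 ≤ y := by positivity
    have h3 : ‖ξ‖ * (1 + ‖ξ‖) * |s| * Real.exp (-y) ≤ (1 + 2 / ν) * (1 + |s|) := by
      have e1 : Real.exp (-y) ≤ 1 := by simpa using hy0
      have e2 : y * Real.exp (-y) ≤ 1 := by
        rw [Real.exp_neg, mul_inv_le_iff₀ (Real.exp_pos _)]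
        linarith [Real.add_one_le_exp y]
      have e3 : ‖ξ‖ * (1 + ‖ξ‖) ≤ 1 + 2 * ‖ξ‖ ^ 2 := by nlinarith [sq_nonneg (‖ξ‖ - 1)]
      calc _ ≤ (1 + 2 * ‖ξ‖ ^ 2) * |s| * Real.exp (-y) := by gcongr
        _ = |s| * Real.exp (-y) + (2 / ν) * (y * Real.exp (-y)) := by rw [hy]; field_simp
        _ ≤ |s| * 1 + (2 / ν) * 1 := by gcongr
        _ ≤ _ := by
          have : 0 < 2 / ν := by positivity
          nlinarith [abs_nonneg s]
    have hpos : 0 ≤ 1 + |s| := by positivity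
    calc _ ≤ ‖c0‖ * (‖ξ‖ * (|s| * |ψ s| * (C' * Real.exp (-y)))) * (1 + |s|) ^ 2 * (1 + ‖ξ‖) := by
          gcongr
      _ = ‖c0‖ * C' * |ψ s| * (1 + |s|) ^ 2 * (‖ξ‖ * (1 + ‖ξ‖) * |s| * Real.exp (-y)) := by ring
      _ ≤ ‖c0‖ * C' * |ψ s| * (1 + |s|) ^ 2 * ((1 + 2 / ν) * (1 + |s|)) := by gcongr
      _ = ‖c0‖ * C' * (1 + 2 / ν) * (|ψ s| * (1 + |s|) ^ 3) := by ring
      _ ≤ ‖c0‖ * C' * (1 + 2 / ν) * C := by gcongr; exact hC s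
      _ = _ := by ring

lemma kern_KI (ν : ℝ) (hν : 0 < ν) {e : ℝ → ℝ} (h' : Edec e) :
    ∃ K, 0 ≤ K ∧ ∀ T > 0, ∀ ψ : ℝ → ℝ, Ccs ψ → (∀ t, |ψ t| ≤ 1) → (∀ t, 3 * T < |t| → ψ t = 0) →
      KI 1 (K * (T + Real.sqrt T)) (kern ν ψ e : Fn d) ∧ KI 2 (K * (T + 1)) (kern ν ψ e : Fn d) := by
  obtain ⟨C', hC0', hC'⟩ := h'.b
  have hL := LI_nonneg
  refine ⟨C' * Real.exp 3 * LI * 4 * (1 + (Real.sqrt ν)⁻¹ + 1 / ν), by positivity, fun T hT ψ hψ h1 h3 => ?_⟩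
  have hJ := kern_JC (d := d) ν hψ.1.continuous h'.1.continuous
  have key : ∀ t (ξ : E d), |∫ s in (0:ℝ)..t, ‖kern ν ψ e (t - s) ξ‖| ≤
      C' * Real.exp 3 * (((1 / T + ν * ‖ξ‖ ^ 2) / 2)⁻¹ * LI) := by
    intro t ξ
    refine LI_le' (k := fun s => kern ν ψ e s ξ) (hJ.x ξ) (by positivity) (fun s => ?_) t
    rw [kern, Complex.norm_real, Real.norm_eq_abs, abs_mul]
    by_cases hs : 3 * T < |s|
    · rw [h3 s hs]; simp; positivity
    · push Not at hs
      set lam := 1 / T + ν * ‖ξ‖ ^ 2 with hl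
      have hlp : 0 < lam := by positivity
      have h2 : |e (ν * sq ξ * s)| ≤ C' * Real.exp (-(ν * ‖ξ‖ ^ 2 * |s|)) := by
        refine (hC' _).trans ?_
        gcongr
        rw [abs_mul, abs_mul, abs_of_pos hν, abs_of_nonneg (sq_nn ξ)]
        gcongr; exact sq_ge ξ
      have h4 : (1 + lam / 2 * |s|) ^ 2 ≤ Real.exp (lam * |s|) := by
        calc (1 + lam / 2 * |s|) ^ 2 ≤ (Real.exp (lam / 2 * |s|)) ^ 2 := by
              gcongr; linarith [Real.add_one_le_exp (lam / 2 * |s|)]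
          _ = _ := by rw [← Real.exp_nat_mul]; congr 1; push_cast; ring
      calc _ ≤ 1 * (C' * Real.exp (-(ν * ‖ξ‖ ^ 2 * |s|))) * Real.exp (lam * |s|) := by
            gcongr; exact h1 s
        _ = C' * Real.exp (|s| / T) := by
            rw [one_mul, mul_assoc, ← Real.exp_add]; congr 2; rw [hl]; ring
        _ ≤ _ := by gcongr; rw [div_le_iff₀ hT]; exact hs
  have hsν := Real.sqrt_pos.2 hν
  have hsT := Real.sqrt_pos.2 hT
  have eν := Real.sq_sqrt hν.le
  have eT := Real.sq_sqrt hT.le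
  constructor
  · refine ⟨hJ, fun t ξ => ?_⟩
    have hx := norm_nonneg ξ
    rw [pow_one]
    have h5 : (1 + ‖ξ‖) / (1 / T + ν * ‖ξ‖ ^ 2) ≤ (1 + (Real.sqrt ν)⁻¹) * (T + Real.sqrt T) := by
      rw [div_le_iff₀ (by positivity)]
      have e1 : 1 ≤ T * (1 / T + ν * ‖ξ‖ ^ 2) := by
        rw [mul_add, mul_one_div_cancel hT.ne']; have : 0 ≤ T * (ν * ‖ξ‖ ^ 2) := by positivity
        linarith
      have e2 : ‖ξ‖ ≤ (Real.sqrt ν)⁻¹ * Real.sqrt T * (1 / T + ν * ‖ξ‖ ^ 2) := by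
        have : (Real.sqrt ν)⁻¹ * Real.sqrt T * (1 / T + ν * ‖ξ‖ ^ 2) =
          (Real.sqrt ν)⁻¹ * (Real.sqrt T)⁻¹ * (1 + (Real.sqrt T * Real.sqrt ν * ‖ξ‖) ^ 2) := by
          rw [mul_pow, mul_pow, eν, eT]; field_simp; rw [eT]
        rw [this, ← mul_inv, ← div_eq_inv_mul, le_div_iff₀ (by positivity)]
        nlinarith [sq_nonneg (Real.sqrt T * Real.sqrt ν * ‖ξ‖ - 1)]
      have : 0 ≤ (Real.sqrt ν)⁻¹ * T * (1 / T + ν * ‖ξ‖ ^ 2) := by positivity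
      have : 0 ≤ Real.sqrt T * (1 / T + ν * ‖ξ‖ ^ 2) := by positivity
      nlinarith
    have h6 : (0:ℝ) ≤ 1 / ν := by positivity
    calc _ ≤ C' * Real.exp 3 * (((1 / T + ν * ‖ξ‖ ^ 2) / 2)⁻¹ * LI) * (1 + ‖ξ‖) := by
          gcongr; exact key t ξ
      _ = C' * Real.exp 3 * LI * 2 * ((1 + ‖ξ‖) / (1 / T + ν * ‖ξ‖ ^ 2)) := by
          rw [inv_div]; ring
      _ ≤ C' * Real.exp 3 * LI * 4 * ((1 + (Real.sqrt ν)⁻¹ + 1/ν) * (T + Real.sqrt T)) := by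
          refine mul_le_mul (by gcongr; norm_num) (h5.trans (mul_le_mul_of_nonneg_right (by linarith) (by positivity))) (by positivity) (by positivity)
      _ = _ := by ring
  · refine ⟨hJ, fun t ξ => ?_⟩
    have hx := norm_nonneg ξ
    have h5 : (1 + ‖ξ‖) ^ 2 / (1 / T + ν * ‖ξ‖ ^ 2) ≤ 2 * ((1 + 1 / ν) * (T + 1)) := by
      rw [div_le_iff₀ (by positivity)]
      have e0 : (1 + ‖ξ‖) ^ 2 ≤ 2 * (1 + ‖ξ‖ ^ 2) := by nlinarith [sq_nonneg (‖ξ‖ - 1)]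
      have e1 : 1 ≤ T * (1 / T + ν * ‖ξ‖ ^ 2) := by
        rw [mul_add, mul_one_div_cancel hT.ne']; have : 0 ≤ T * (ν * ‖ξ‖ ^ 2) := by positivity
        linarith
      have e2 : ‖ξ‖ ^ 2 ≤ 1 / ν * (1 / T + ν * ‖ξ‖ ^ 2) := by
        rw [mul_add, ← mul_assoc, one_div_mul_cancel hν.ne']
        have : 0 ≤ 1 / ν * (1 / T) := by positivity
        linarith
      have : 0 ≤ (1 / ν) * T * (1 / T + ν * ‖ξ‖ ^ 2) := by positivity
      have : 0 ≤ (1 / T + ν * ‖ξ‖ ^ 2) := by positivity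
      nlinarith
    have h6 : (0:ℝ) ≤ (Real.sqrt ν)⁻¹ := by positivity
    calc _ ≤ C' * Real.exp 3 * (((1 / T + ν * ‖ξ‖ ^ 2) / 2)⁻¹ * LI) * (1 + ‖ξ‖) ^ 2 := by
          gcongr; exact key t ξ
      _ = C' * Real.exp 3 * LI * 2 * ((1 + ‖ξ‖) ^ 2 / (1 / T + ν * ‖ξ‖ ^ 2)) := by
          rw [inv_div]; ring
      _ ≤ C' * Real.exp 3 * LI * 2 * (2 * ((1 + (Real.sqrt ν)⁻¹ + 1/ν) * (T + 1))) := by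
          refine mul_le_mul le_rfl (h5.trans (mul_le_mul_of_nonneg_left (mul_le_mul_of_nonneg_right (by linarith) (by positivity)) (by norm_num))) (by positivity) (by positivity)
      _ = _ := by ring

noncomputable def e0 (y : ℝ) : ℝ := Real.exp (-y) * Real.smoothTransition (y + 2)

lemma e0_smooth : ContDiff ℝ (⊤ : ℕ∞) e0 := by
  unfold e0
  exact (Real.contDiff_exp.comp contDiff_neg).mul
    (Real.smoothTransition.contDiff.comp (contDiff_id.add contDiff_const))

lemma e0_eq {y : ℝ} (hy : -1 ≤ y) : e0 y = Real.exp (-y) := by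
  rw [e0, Real.smoothTransition.one_of_one_le (by linarith), mul_one]

lemma e0_Edec : Edec e0 := by
  refine ⟨e0_smooth, fun n => ?_⟩
  have hc : Continuous (iteratedDeriv n e0) := e0_smooth.continuous_iteratedDeriv n (by exact_mod_cast le_top)
  obtain ⟨C, hC⟩ := (isCompact_Icc (a := (-2:ℝ)) (b := 0)).exists_bound_of_continuousOn hc.continuousOn
  have hC0 : 0 ≤ C := (norm_nonneg _).trans (hC 0 (by norm_num))
  refine ⟨1 + C * Real.exp 2, fun y => ?_⟩
  rcases lt_or_ge 0 y with hy | hy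
  · have h1 : iteratedDeriv n e0 y = iteratedDeriv n (fun y => Real.exp (-y)) y := by
      refine Filter.EventuallyEq.iteratedDeriv_eq n ?_
      filter_upwards [lt_mem_nhds hy] with z hz
      exact e0_eq (by linarith)
    rw [h1, iteratedDeriv_comp_neg n Real.exp]
    simp only [iteratedDeriv_eq_iterate, Real.iter_deriv_exp, smul_eq_mul]
    rw [abs_mul, abs_pow, abs_neg, abs_one, one_pow, one_mul, Real.abs_exp, abs_of_pos hy]
    have := Real.exp_pos (-y)
    have := Real.exp_pos 2
    nlinarith [mul_nonneg (mul_nonneg hC0 (Real.exp_pos 2).le) (Real.exp_pos (-y)).le]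
  · rcases lt_or_ge y (-2) with hy2 | hy2
    · have h1 : iteratedDeriv n e0 y = iteratedDeriv n (fun _ => (0:ℝ)) y := by
        refine Filter.EventuallyEq.iteratedDeriv_eq n ?_
        filter_upwards [gt_mem_nhds hy2] with z hz
        rw [e0, Real.smoothTransition.zero_of_nonpos (by linarith), mul_zero]
      rw [h1]; simp; positivity
    · have h2 := hC y ⟨hy2, hy⟩
      rw [Real.norm_eq_abs] at h2
      have h3 : 1 ≤ Real.exp 2 * Real.exp (-|y|) := by
        rw [← Real.exp_add, abs_of_nonpos hy]; exact Real.one_le_exp (by linarith)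
      have := Real.exp_pos (-|y|)
      nlinarith

lemma exists_psi (T : ℝ) (hT : 0 < T) : ∃ ψ : ℝ → ℝ, Ccs ψ ∧ (∀ t, |ψ t| ≤ 1) ∧
    (∀ t, 3 * T < |t| → ψ t = 0) ∧ (∀ t, |t| ≤ 2 * T → ψ t = 1) := by
  let b : ContDiffBump (0:ℝ) := ⟨2 * T, 3 * T, by linarith, by linarith⟩
  refine ⟨b, ⟨b.contDiff, b.hasCompactSupport⟩, fun t => ?_, fun t ht => ?_, fun t ht => ?_⟩
  · rw [abs_of_nonneg b.nonneg]; exact b.le_one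
  · exact b.zero_of_le_dist (by simp [b]; exact ht.le)
  · exact b.one_of_mem_closedBall (by simp [b]; exact ht)

section abs
variable {Y : Type*} [NormedAddCommGroup Y] [CompleteSpace Y]

omit [CompleteSpace Y] in
lemma abs_uniq {B : Y → Y → Y} {κ A : ℝ} (hκ : 0 ≤ κ) (hA : 8 * κ * A ≤ 1)
    (bd : ∀ v z, ‖B v z‖ ≤ κ * ‖v‖ * ‖z‖) (sl : ∀ v v' z, B (v - v') z = B v z - B v' z)
    (sr : ∀ v z z', B v (z - z') = B v z - B v z') {v w : Y} (hv : ‖v‖ ≤ 2 * A) (hw : ‖w‖ ≤ 2 * A) :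
    ‖B v v - B w w‖ ≤ 1 / 2 * ‖v - w‖ := by
  have : B v v - B w w = B (v - w) v + B w (v - w) := by rw [sl, sr]; abel
  rw [this]
  have h1 := bd (v - w) v
  have h2 := bd w (v - w)
  have h3 := norm_nonneg (v - w)
  have h4 : κ * ‖v‖ ≤ κ * (2 * A) := by gcongr
  have h5 : κ * ‖w‖ ≤ κ * (2 * A) := by gcongr
  calc _ ≤ κ * ‖v - w‖ * ‖v‖ + κ * ‖w‖ * ‖v - w‖ := (norm_add_le _ _).trans (add_le_add h1 h2)
    _ = (κ * ‖v‖ + κ * ‖w‖) * ‖v - w‖ := by ring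
    _ ≤ _ := by gcongr; linarith

lemma abs_fix {B : Y → Y → Y} {κ A : ℝ} (hκ : 0 ≤ κ) (hA0 : 0 ≤ A) (hA : 8 * κ * A ≤ 1)
    (bd : ∀ v z, ‖B v z‖ ≤ κ * ‖v‖ * ‖z‖) (sl : ∀ v v' z, B (v - v') z = B v z - B v' z)
    (sr : ∀ v z z', B v (z - z') = B v z - B v z') {a : Y} (ha : ‖a‖ ≤ A) :
    ∃ v, ‖v‖ ≤ 2 * A ∧ v = a + B v v := by
  let s : Set Y := Metric.closedBall 0 (2 * A)
  have hs : IsComplete s := Metric.isClosed_closedBall.isComplete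
  have hm : Set.MapsTo (fun v => a + B v v) s s := by
    intro v hv
    simp only [s, mem_closedBall_zero_iff] at hv ⊢
    calc ‖a + B v v‖ ≤ A + κ * ‖v‖ * ‖v‖ := (norm_add_le _ _).trans (add_le_add ha (bd v v))
      _ ≤ A + κ * (2 * A) * (2 * A) := by gcongr
      _ ≤ 2 * A := by nlinarith
  have hc : ContractingWith (1/2) (hm.restrict (fun v => a + B v v) s s) := by
    refine ⟨by rw [← NNReal.coe_lt_coe]; norm_num, LipschitzWith.of_dist_le_mul fun v w => ?_⟩
    rw [Subtype.dist_eq, Subtype.dist_eq, dist_eq_norm, dist_eq_norm]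
    have hv := v.2; have hw := w.2
    simp only [s, mem_closedBall_zero_iff] at hv hw
    have := abs_uniq hκ hA bd sl sr hv hw
    simpa [Set.MapsTo.val_restrict_apply] using this
  obtain ⟨v, hv, h2, _⟩ := hc.exists_fixedPoint' hs hm (x := 0) (by simp [s, hA0]) (edist_ne_top _ _)
  exact ⟨v, by simpa [s] using hv, h2.eq.symm⟩

lemma abs_lin {L : Y → Y} (bd : ∀ z, ‖L z‖ ≤ 1 / 2 * ‖z‖) (sr : ∀ z z', L (z - z') = L z - L z')
    (a : Y) : ∃ z, z = a + L z := by
  have hc : ContractingWith (1/2) (fun z => a + L z) := by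
    refine ⟨by rw [← NNReal.coe_lt_coe]; norm_num, LipschitzWith.of_dist_le_mul fun v w => ?_⟩
    rw [dist_eq_norm, dist_eq_norm, add_sub_add_left_eq_sub, ← sr]
    simpa using bd (v - w)
  obtain ⟨v, h, _⟩ := hc.exists_fixedPoint 0 (edist_ne_top _ _)
  exact ⟨v, h.eq.symm⟩

omit [CompleteSpace Y] in
lemma abs_it {L : Y → Y} (bd : ∀ z, ‖L z‖ ≤ 1 / 2 * ‖z‖) (sr : ∀ z z', L (z - z') = L z - L z')
    {f z : Y} {fn zn : ℕ → Y} (hz : z = f + L z) (hzn : ∀ n, zn (n+1) = fn n + L (zn n))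
    {K : ℝ} (hK : ∀ n, ‖fn n - f‖ ≤ K * (3/4)^n) : ∃ K', ∀ n, ‖zn n - z‖ ≤ K' * (3/4)^n := by
  have hK0 : 0 ≤ K := by simpa using (norm_nonneg _).trans (hK 0)
  refine ⟨4 * K + ‖zn 0 - z‖, fun n => ?_⟩
  induction n with
  | zero => simp; linarith
  | succ n ih =>
    have e : zn (n+1) - z = (fn n - f) + L (zn n - z) := by
      rw [sr, hzn]; nth_rewrite 1 [hz]; abel
    rw [e]
    have h1 := bd (zn n - z)
    have h2 : 0 ≤ ‖zn 0 - z‖ * (3/4)^n := by positivity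
    calc _ ≤ K * (3/4)^n + 1/2 * ((4 * K + ‖zn 0 - z‖) * (3/4)^n) :=
          (norm_add_le _ _).trans (add_le_add (hK n) (h1.trans (by gcongr)))
      _ ≤ _ := by rw [pow_succ]; nlinarith
end abs

def PL (p : E d → ℂ) : Prop := Continuous p ∧ ∀ ξ, ‖p ξ‖ ≤ 1 + ‖ξ‖

noncomputable def TT (k : Fn d) (m p : E d → ℂ) (f g : Fn d) : Fn d :=
  Dk k (Q m f (fun t ξ => p ξ * g t ξ))

lemma PL_WB {p : E d → ℂ} (hp : PL p) {M B} {g : Fn d} (hg : WB (M+1) B g) :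
    WB M B (fun t ξ => p ξ * g t ξ) := by
  refine ⟨Continuous.mul (hp.1.comp continuous_snd) hg.1, fun t ξ => le_trans ?_ (hg.2 t ξ)⟩
  rw [norm_mul, pow_succ]
  have := hp.2 ξ
  have h1 := jb_pos ξ
  calc _ ≤ (1 + ‖ξ‖) * ‖g t ξ‖ * (1 + ‖ξ‖) ^ M := by gcongr
    _ = _ := by ring

noncomputable def cst (d M : ℕ) : ℝ := 2 ^ (M + 2) * JI d
lemma cst_nonneg (M) : 0 ≤ cst d M := mul_nonneg (by positivity) JI_nonneg

lemma TT_WB {k : Fn d} {q c} (hk : KI q c k) {m p : E d → ℂ} (hm : MB m) (hp : PL p) {M A B}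
    {f g : Fn d} (hM : d + 1 ≤ M) (hf : WB (M+1) A f) (hg : WB (M+1) B g) :
    WB (M + q) (c * (cst d M * A * B)) (TT k m p f g) :=
  Dk_WB hk (Q_WB hm hM (hf.mono (by omega)) (PL_WB hp hg))

lemma WB.sub {M A B} {f g : Fn d} (hf : WB M A f) (hg : WB M B g) :
    WB M (A + B) (fun t ξ => f t ξ - g t ξ) := by
  refine ⟨Continuous.sub hf.1 hg.1, fun t ξ => ?_⟩
  calc _ ≤ (‖f t ξ‖ + ‖g t ξ‖) * (1 + ‖ξ‖) ^ M := by gcongr; exact norm_sub_le _ _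
    _ ≤ _ := by rw [add_mul]; exact add_le_add (hf.2 t ξ) (hg.2 t ξ)
lemma WB.add {M A B} {f g : Fn d} (hf : WB M A f) (hg : WB M B g) :
    WB M (A + B) (fun t ξ => f t ξ + g t ξ) := by
  refine ⟨Continuous.add hf.1 hg.1, fun t ξ => ?_⟩
  calc _ ≤ (‖f t ξ‖ + ‖g t ξ‖) * (1 + ‖ξ‖) ^ M := by gcongr; exact norm_add_le _ _
    _ ≤ _ := by rw [add_mul]; exact add_le_add (hf.2 t ξ) (hg.2 t ξ)

lemma Dk_sub {k F G : Fn d} (hk : JC k) (hF : JC F) (hG : JC G) (t ξ) :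
    Dk k (fun t ξ => F t ξ - G t ξ) t ξ = Dk k F t ξ - Dk k G t ξ := by
  unfold Dk
  rw [← intervalIntegral.integral_sub (Dk_ii hk hF t ξ _ _) (Dk_ii hk hG t ξ _ _)]
  congr 1; ext s; ring

lemma TT_sub_right {k : Fn d} (hk : JC k) {m p : E d → ℂ} (hm : MB m) (hp : PL p) {A B B'}
    {f g g' : Fn d} (hf : WB (d+1) A f) (hg : WB (d+1) B g) (hg' : WB (d+1) B' g') (t ξ) :
    TT k m p f (fun t ξ => g t ξ - g' t ξ) t ξ = TT k m p f g t ξ - TT k m p f g' t ξ := by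
  have h1 : WB 0 B _ := (PL_WB hp hg).mono (Nat.zero_le _)
  have h2 : WB 0 B' _ := (PL_WB hp hg').mono (Nat.zero_le _)
  unfold TT
  rw [← Dk_sub hk (Q_JC hm hf h1) (Q_JC hm hf h2)]
  congr 1; funext t ξ
  unfold Q
  rw [← integral_sub (Q_int hm hf h1 t ξ) (Q_int hm hf h2 t ξ)]
  congr 1; ext η; ring

lemma TT_sub_left {k : Fn d} (hk : JC k) {m p : E d → ℂ} (hm : MB m) (hp : PL p) {A A' B}
    {f f' g : Fn d} (hf : WB (d+1) A f) (hf' : WB (d+1) A' f') (hg : WB (d+1) B g) (t ξ) :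
    TT k m p (fun t ξ => f t ξ - f' t ξ) g t ξ = TT k m p f g t ξ - TT k m p f' g t ξ := by
  have h1 : WB 0 B _ := (PL_WB hp hg).mono (Nat.zero_le _)
  unfold TT
  rw [← Dk_sub hk (Q_JC hm hf h1) (Q_JC hm hf' h1)]
  congr 1; funext t ξ
  unfold Q
  rw [← integral_sub (Q_int hm hf h1 t ξ) (Q_int hm hf' h1 t ξ)]
  congr 1; ext η; ring

noncomputable def mm (j k : Fin d) (η : E d) : ℂ :=
  (((if j = k then 1 else 0) - η j * η k / sq η : ℝ) : ℂ)

lemma abs_ratio_le (η : E d) (j k : Fin d) : |η j * η k / sq η| ≤ 1 := by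
  rw [abs_div, abs_of_nonneg (sq_nn η)]
  refine div_le_one_of_le₀ ?_ (sq_nn η)
  have h := sq_ge η
  have h1 : |η j| ≤ ‖η‖ := by simpa using norm_le_pi_norm η j
  have h2 : |η k| ≤ ‖η‖ := by simpa using norm_le_pi_norm η k
  rw [abs_mul]
  calc _ ≤ ‖η‖ * ‖η‖ := by gcongr
    _ ≤ _ := by rw [← pow_two]; exact h

lemma sq_meas : Measurable (sq : E d → ℝ) := sq_cont.measurable

lemma mm_MB (j k : Fin d) : MB (mm j k) := by
  constructor
  · unfold mm
    have := sq_meas (d := d)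
    fun_prop
  · intro η
    rw [mm, Complex.norm_real, Real.norm_eq_abs]
    have := abs_le.1 (abs_ratio_le η j k)
    rw [abs_le]
    split_ifs <;> constructor <;> linarith

abbrev Vn (d : ℕ) := Fin d → Fn d

noncomputable def Bl (h : Fn d) (p : Fin d → E d → ℂ) (v z : Vn d) : Vn d := fun i t ξ =>
  ∑ j, ∑ k, (TT h (mm j k) (p j) (v k) (z i) t ξ - TT h (mm j k) (p i) (v k) (z j) t ξ)

def WBv (M : ℕ) (A : ℝ) (v : Vn d) : Prop := ∀ i, WB M A (v i)

lemma WB_sum {ι : Type*} (s : Finset ι) {M} {A : ι → ℝ} {f : ι → Fn d} (h : ∀ i ∈ s, WB M (A i) (f i)) :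
    WB M (∑ i ∈ s, A i) (fun t ξ => ∑ i ∈ s, f i t ξ) := by
  classical
  induction s using Finset.induction_on with
  | empty => exact ⟨by simpa [JC] using continuous_const, fun t ξ => by simp⟩
  | insert a s ha ih =>
    simp only [Finset.sum_insert ha]
    exact (h a (by simp)).add (ih fun i hi => h i (by simp [hi]))

noncomputable def cB (d M : ℕ) : ℝ := (d:ℝ) * d * 2 * cst d M
lemma cB_nonneg (M) : 0 ≤ cB d M := mul_nonneg (by positivity) (cst_nonneg M)

lemma Bl_WB {h : Fn d} {q c} (hk : KI q c h) {p : Fin d → E d → ℂ} (hp : ∀ j, PL (p j)) {M A B}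
    {v z : Vn d} (hM : d + 1 ≤ M) (hv : WBv (M+1) A v) (hz : WBv (M+1) B z) :
    WBv (M + q) (c * cB d M * A * B) (Bl h p v z) := by
  intro i
  have := WB_sum Finset.univ fun j _ => WB_sum Finset.univ fun k _ =>
    (TT_WB hk (mm_MB j k) (hp j) hM (hv k) (hz i)).sub (TT_WB hk (mm_MB j k) (hp i) hM (hv k) (hz j))
  simp only [Finset.sum_const, Finset.card_univ, Fintype.card_fin, nsmul_eq_mul] at this
  have e : c * cB d M * A * B = (d:ℝ) * ((d:ℝ) * (c * (cst d M * A * B) + c * (cst d M * A * B))) := by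
    unfold cB; ring
  rw [e]; exact this

lemma Bl_sub_right {h : Fn d} (hk : JC h) {p : Fin d → E d → ℂ} (hp : ∀ j, PL (p j)) {A B B'}
    {v z z' : Vn d} (hv : WBv (d+1) A v) (hz : WBv (d+1) B z) (hz' : WBv (d+1) B' z') (i t ξ) :
    Bl h p v (fun i t ξ => z i t ξ - z' i t ξ) i t ξ = Bl h p v z i t ξ - Bl h p v z' i t ξ := by
  unfold Bl
  simp only [TT_sub_right hk (mm_MB _ _) (hp _) (hv _) (hz _) (hz' _), ← Finset.sum_sub_distrib]
  refine Finset.sum_congr rfl fun j _ => Finset.sum_congr rfl fun k _ => by ring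

lemma Bl_sub_left {h : Fn d} (hk : JC h) {p : Fin d → E d → ℂ} (hp : ∀ j, PL (p j)) {A A' B}
    {v v' z : Vn d} (hv : WBv (d+1) A v) (hv' : WBv (d+1) A' v') (hz : WBv (d+1) B z) (i t ξ) :
    Bl h p (fun i t ξ => v i t ξ - v' i t ξ) z i t ξ = Bl h p v z i t ξ - Bl h p v' z i t ξ := by
  unfold Bl
  simp only [TT_sub_left hk (mm_MB _ _) (hp _) (hv _) (hv' _) (hz _), ← Finset.sum_sub_distrib]
  refine Finset.sum_congr rfl fun j _ => Finset.sum_congr rfl fun k _ => by ring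

abbrev XX (d : ℕ) := BoundedContinuousFunction (ℝ × E d) ℂ

noncomputable def toFn (b : XX d) : Fn d := fun t ξ => b (t, ξ) * ((((1 + ‖ξ‖) ^ (d+2))⁻¹ : ℝ) : ℂ)

lemma toFn_WB (b : XX d) : WB (d+2) ‖b‖ (toFn b) := by
  have hc : Continuous fun z : ℝ × E d => ((1 + ‖z.2‖) ^ (d+2))⁻¹ :=
    Continuous.inv₀ (by fun_prop) fun z => by have := jb_pos z.2; positivity
  refine ⟨?_, fun t ξ => ?_⟩
  · exact b.continuous.mul (Complex.continuous_ofReal.comp hc)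
  · have := jb_pos ξ
    rw [toFn, norm_mul, Complex.norm_real, Real.norm_eq_abs, abs_of_pos (by positivity), mul_assoc,
      inv_mul_cancel₀ (by positivity), mul_one]
    exact b.norm_coe_le_norm _

open Classical in
noncomputable def ofFn (f : Fn d) : XX d :=
  if h : ∃ A, WB (d+2) A f then BoundedContinuousFunction.ofNormedAddCommGroup
    (fun z : ℝ × E d => f z.1 z.2 * (((1 + ‖z.2‖) ^ (d+2) : ℝ) : ℂ))
    (Continuous.mul h.choose_spec.1 (Complex.continuous_ofReal.comp (by fun_prop))) h.choose
    (fun z => by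
      have := jb_pos z.2
      rw [norm_mul, Complex.norm_real, Real.norm_eq_abs, abs_of_pos (by positivity)]
      exact h.choose_spec.2 z.1 z.2)
  else 0

lemma ofFn_apply {A} {f : Fn d} (h : WB (d+2) A f) (z : ℝ × E d) :
    ofFn f z = f z.1 z.2 * (((1 + ‖z.2‖) ^ (d+2) : ℝ) : ℂ) := by
  rw [ofFn, dif_pos ⟨A, h⟩]; rfl

lemma ofFn_norm {A} {f : Fn d} (h : WB (d+2) A f) : ‖ofFn f‖ ≤ A := by
  refine (BoundedContinuousFunction.norm_le h.nonneg).2 fun z => ?_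
  have := jb_pos z.2
  rw [ofFn_apply h, norm_mul, Complex.norm_real, Real.norm_eq_abs, abs_of_pos (by positivity)]
  exact h.2 z.1 z.2

lemma toFn_ofFn {A} {f : Fn d} (h : WB (d+2) A f) : toFn (ofFn f) = f := by
  funext t ξ
  have := jb_pos ξ
  rw [toFn, ofFn_apply h, mul_assoc, ← Complex.ofReal_mul, mul_inv_cancel₀ (by positivity)]
  simp

lemma toFn_inj {b c : XX d} (h : toFn b = toFn c) : b = c := by
  ext z
  have h1 := congrFun (congrFun h z.1) z.2
  have := jb_pos z.2
  simp only [toFn] at h1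
  exact mul_right_cancel₀ (Complex.ofReal_ne_zero.2 (inv_pos.2 (pow_pos this _)).ne') h1

abbrev YY (d : ℕ) := Fin d → XX d
noncomputable def toV (y : YY d) : Vn d := fun i => toFn (y i)
noncomputable def ofV (v : Vn d) : YY d := fun i => ofFn (v i)

lemma toV_WB (y : YY d) : WBv (d+2) ‖y‖ (toV y) := fun i =>
  ⟨(toFn_WB (y i)).1, fun t ξ => ((toFn_WB (y i)).2 t ξ).trans (norm_le_pi_norm y i)⟩
lemma ofV_norm {A} {v : Vn d} (hA : 0 ≤ A) (h : WBv (d+2) A v) : ‖ofV v‖ ≤ A :=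
  (pi_norm_le_iff_of_nonneg hA).2 fun i => ofFn_norm (h i)
lemma toV_ofV {A} {v : Vn d} (h : WBv (d+2) A v) : toV (ofV v) = v := funext fun i => toFn_ofFn (h i)
lemma toV_inj {b c : YY d} (h : toV b = toV c) : b = c := funext fun i => toFn_inj (congrFun h i)
lemma toV_sub (b c : YY d) : toV (b - c) = fun i t ξ => toV b i t ξ - toV c i t ξ := by
  funext i t ξ; simp [toV, toFn, sub_mul]
lemma toV_add (b c : YY d) : toV (b + c) = fun i t ξ => toV b i t ξ + toV c i t ξ := by
  funext i t ξ; simp [toV, toFn, add_mul]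

noncomputable def BY (h : Fn d) (p : Fin d → E d → ℂ) (v z : YY d) : YY d := ofV (Bl h p (toV v) (toV z))

lemma WBv.mono {M A} {v : Vn d} (h : WBv M A v) {M'} (hM : M' ≤ M) : WBv M' A v :=
  fun i => (h i).mono hM

section BY
variable {h : Fn d} {c : ℝ} (hk : KI 1 c h) {p : Fin d → E d → ℂ} (hp : ∀ j, PL (p j))
include hk hp

lemma BY_WB (v z : YY d) : WBv (d+2) (c * cB d (d+1) * ‖v‖ * ‖z‖) (Bl h p (toV v) (toV z)) :=
  Bl_WB hk hp le_rfl (toV_WB v) (toV_WB z)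
lemma BY_toV (v z : YY d) : toV (BY h p v z) = Bl h p (toV v) (toV z) := toV_ofV (BY_WB hk hp v z)
lemma BY_norm (v z : YY d) : ‖BY h p v z‖ ≤ (c * cB d (d+1)) * ‖v‖ * ‖z‖ := by
  have := hk.nonneg
  have := cB_nonneg (d := d) (d+1)
  exact ofV_norm (by positivity) (BY_WB hk hp v z)
lemma BY_sl (v v' z : YY d) : BY h p (v - v') z = BY h p v z - BY h p v' z := by
  apply toV_inj
  rw [toV_sub, BY_toV hk hp, BY_toV hk hp, BY_toV hk hp, toV_sub]
  funext i t ξ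
  exact Bl_sub_left hk.1 hp ((toV_WB v).mono (by omega)) ((toV_WB v').mono (by omega)) ((toV_WB z).mono (by omega)) i t ξ
lemma BY_sr (v z z' : YY d) : BY h p v (z - z') = BY h p v z - BY h p v z' := by
  apply toV_inj
  rw [toV_sub, BY_toV hk hp, BY_toV hk hp, BY_toV hk hp, toV_sub]
  funext i t ξ
  exact Bl_sub_right hk.1 hp ((toV_WB v).mono (by omega)) ((toV_WB z).mono (by omega)) ((toV_WB z').mono (by omega)) i t ξ
end BY

noncomputable def pp (j : Fin d) (ξ : E d) : ℂ := -Complex.I * (ξ j : ℂ)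
noncomputable def dp (l j : Fin d) (_ : E d) : ℂ := -Complex.I * (if l = j then 1 else 0)

lemma pp_PL (j : Fin d) : PL (pp j) := by
  refine ⟨by unfold pp; fun_prop, fun ξ => ?_⟩
  have : |ξ j| ≤ ‖ξ‖ := by simpa using norm_le_pi_norm ξ j
  simp [pp]; linarith
lemma dp_PL (l j : Fin d) : PL (dp l j) := by
  refine ⟨by unfold dp; fun_prop, fun ξ => ?_⟩
  have := norm_nonneg ξ
  simp only [dp]
  split_ifs <;> simp <;> linarith
lemma pp_Cl (r) (j : Fin d) : Cl PB r (fun _ ξ => pp j ξ : Fn d) :=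
  ClPB_mul (ClPB_const r _) (ClPB_coord r j)
lemma dp_Cl (r) (l j : Fin d) : Cl PB r (fun _ ξ => dp l j ξ : Fn d) := ClPB_const r _
lemma pp_HX (j : Fin d) : HX (fun _ ξ => pp j ξ : Fn d) (fun l _ ξ => dp l j ξ) := by
  intro t ξ
  have : HasFDerivAt (fun ξ : E d => (ξ j : ℂ))
      (Complex.ofRealCLM.comp (pj j)) ξ :=
      (Complex.ofRealCLM.comp (pj j)).hasFDerivAt
  refine (this.const_mul (-Complex.I)).congr_fderiv ?_
  ext w; simp [gr_apply, dp, mul_comm]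

lemma HX.add {f g : Fn d} {fx gx} (hf : HX f fx) (hg : HX g gx) :
    HX (fun t ξ => f t ξ + g t ξ) (fun l t ξ => fx l t ξ + gx l t ξ) := fun t ξ => by
  rw [gr_add]; exact (hf t ξ).add (hg t ξ)
lemma HX.sub {f g : Fn d} {fx gx} (hf : HX f fx) (hg : HX g gx) :
    HX (fun t ξ => f t ξ - g t ξ) (fun l t ξ => fx l t ξ - gx l t ξ) := fun t ξ => by
  rw [gr_sub]; exact (hf t ξ).sub (hg t ξ)
lemma HX_zero : HX (fun _ _ => 0 : Fn d) (fun _ _ _ => 0) := fun t ξ => by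
  refine (hasFDerivAt_const 0 ξ).congr_fderiv ?_
  ext w; simp [gr_apply]
lemma HX_sum {ι : Type*} (s : Finset ι) {f : ι → Fn d} {fx : ι → Fin d → Fn d}
    (hf : ∀ i ∈ s, HX (f i) (fx i)) :
    HX (fun t ξ => ∑ i ∈ s, f i t ξ) (fun l t ξ => ∑ i ∈ s, fx i l t ξ) := by
  classical
  induction s using Finset.induction_on with
  | empty => simpa using HX_zero
  | insert a s ha ih =>
    simp only [Finset.sum_insert ha]
    exact (hf a (by simp)).add (ih fun i hi => hf i (by simp [hi]))
lemma HX.congr {f : Fn d} {fx gx} (hf : HX f fx) (e : ∀ l t ξ, fx l t ξ = gx l t ξ) : HX f gx := by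
  have : fx = gx := by funext l t ξ; exact e l t ξ
  exact this ▸ hf
lemma HX.mul {f g : Fn d} {fx gx} (hf : HX f fx) (hg : HX g gx) :
    HX (fun t ξ => f t ξ * g t ξ) (fun l t ξ => fx l t ξ * g t ξ + f t ξ * gx l t ξ) := fun t ξ => by
  refine ((hf t ξ).mul (hg t ξ)).congr_fderiv ?_
  ext w
  simp only [ContinuousLinearMap.add_apply, ContinuousLinearMap.smul_apply, gr_apply,
    smul_eq_mul, Finset.mul_sum,
    Finset.sum_mul, ← Finset.sum_add_distrib]
  refine Finset.sum_congr rfl fun k _ => ?_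
  ring

structure KK (h : Fn d) (ht : Fn d) (hx : Fin d → Fn d) : Prop where
  cl : ∀ r, Cl KB r h
  tcl : ∀ r, Cl KB r ht
  xcl : ∀ r l, Cl KB r (hx l)
  dt : HT h ht
  dx : HX h hx
  k2 : ∃ c, KI 2 c h
  kx : ∀ l, ∃ c, KI 1 c (hx l)

lemma TT_Cl {r} {k : Fn d} (hk : Cl KB r k) {m} (hm : MB m) {p : E d → ℂ} (hp : Cl PB r (fun _ ξ => p ξ : Fn d))
    {v z : Fn d} (hv : Cl RD r v) (hz : Cl RD r z) : Cl RD r (TT k m p v z) :=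
  Dk_Cl hk (Q_Cl hm hv (ClPB_mulRD hp hz))

lemma Bl_Cl {r} {k : Fn d} (hk : Cl KB r k) {p : Fin d → E d → ℂ} (hp : ∀ j, Cl PB r (fun _ ξ => p j ξ : Fn d))
    {v z : Vn d} (hv : ∀ i, Cl RD r (v i)) (hz : ∀ i, Cl RD r (z i)) (i) : Cl RD r (Bl k p v z i) :=
  ClRD_sum _ fun j _ => ClRD_sum _ fun l _ =>
    ClRD_sub (TT_Cl hk (mm_MB j l) (hp j) (hv l) (hz i)) (TT_Cl hk (mm_MB j l) (hp i) (hv l) (hz j))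

lemma TT_HT {h ht : Fn d} (hh : KB h) (hht : KB ht) (H : HT h ht) {m} (hm : MB m) {p : E d → ℂ}
    (hp : PB (fun _ ξ => p ξ : Fn d)) {v z : Fn d} (hv : RD v) (hz : RD z) :
    HT (TT h m p v z) (fun t ξ => h 0 ξ * Q m v (fun t ξ => p ξ * z t ξ) t ξ + TT ht m p v z t ξ) :=
  Dk_HT hh.PB hht.PB H (Q_RD hm hv (hp.mulRD hz))

lemma TT_HX {h : Fn d} {hx : Fin d → Fn d} (hh : KB h) (hhx : ∀ l, KB (hx l)) (H : HX h hx) {m} (hm : MB m)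
    (j : Fin d) {v z : Fn d} {zx : Fin d → Fn d}
    (hv : RD v) (hz : RD z) (hzx : ∀ l, RD (zx l)) (Hz : HX z zx) :
    HX (TT h m (pp j) v z) (fun l t ξ => TT (hx l) m (pp j) v z t ξ +
      (TT h m (dp l j) v z t ξ + TT h m (pp j) v (zx l) t ξ)) := by
  have h1 : ∀ l, RD (fun t ξ => dp l j ξ * z t ξ) := fun l => (dp_Cl 0 l j).base.mulRD hz
  have h2 : ∀ l, RD (fun t ξ => pp j ξ * zx l t ξ) := fun l => (pp_Cl 0 j).base.mulRD (hzx l)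
  have h0 : RD (fun t ξ => pp j ξ * z t ξ) := (pp_Cl 0 j).base.mulRD hz
  obtain ⟨A, hA⟩ := hv.WB (d+1)
  obtain ⟨B0, hB0⟩ := h0.WB 0
  choose B1 hB1 using fun l => (h1 l).WB 0
  choose B2 hB2 using fun l => (h2 l).WB 0
  choose B hB using fun l => ((h1 l).add (h2 l)).WB 0
  have hQ := Q_HX hm hA hB0 hB ((pp_HX j).mul Hz)
  have := Dk_HX hh.PB (fun l => (hhx l).PB) H (Q_RD hm hv h0) (fun l => Q_RD hm hv ((h1 l).add (h2 l))) hQ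
  refine this.congr fun l t ξ => ?_
  simp only [TT]
  congr 1
  unfold Dk
  rw [← intervalIntegral.integral_add (Dk_ii hh.1 (Q_JC hm hA (hB1 l)) _ _ _ _)
    (Dk_ii hh.1 (Q_JC hm hA (hB2 l)) _ _ _ _)]
  congr 1; ext s
  rw [Q_add_right hm hA (hB1 l) (hB2 l)]; ring

lemma Bl_HX {h : Fn d} {hx : Fin d → Fn d} (hh : KB h) (hhx : ∀ l, KB (hx l)) (H : HX h hx)
    {v z : Vn d} {zx : Fin d → Vn d}
    (hv : ∀ i, RD (v i)) (hz : ∀ i, RD (z i)) (hzx : ∀ l i, RD (zx l i)) (Hz : ∀ i, HX (z i) (fun l => zx l i)) (i) :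
    HX (Bl h pp v z i) (fun l t ξ => Bl (hx l) pp v z i t ξ + Bl h (dp l) v z i t ξ + Bl h pp v (zx l) i t ξ) := by
  have := HX_sum Finset.univ fun j _ => HX_sum Finset.univ fun k _ =>
    (TT_HX hh hhx H (mm_MB j k) j (hv k) (hz i) (fun l => hzx l i) (Hz i)).sub
    (TT_HX hh hhx H (mm_MB j k) i (hv k) (hz j) (fun l => hzx l j) (Hz j))
  refine this.congr fun l t ξ => ?_
  simp only [Bl, ← Finset.sum_add_distrib]
  refine Finset.sum_congr rfl fun j _ => Finset.sum_congr rfl fun k _ => by ring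

lemma boot {h : Fn d} (hk : ∃ c, KI 2 c h) {v z f : Vn d} {B} (hf : ∀ i, RD (f i)) (hz : WBv (d+2) B z)
    (hv : ∀ M, (∃ B, WBv M B z) → ∃ A, WBv M A v)
    (e : ∀ i t ξ, z i t ξ = f i t ξ + Bl h pp v z i t ξ) (i) : RD (z i) := by
  obtain ⟨c, hk⟩ := hk
  have key : ∀ n, ∃ B, WBv (d+2+n) B z := by
    intro n
    induction n with
    | zero => exact ⟨B, hz⟩
    | succ n ih =>
      obtain ⟨A, hA⟩ := hv _ ih
      obtain ⟨B, hB⟩ := ih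
      have h1 := Bl_WB (M := d + 1 + n) hk pp_PL (by omega) (by convert hA using 1; omega) (by convert hB using 1; omega)
      choose F hF using fun i => (hf i).WB (d+2+(n+1))
      have h2 : ∀ i, WB (d+2+(n+1)) (F i + c * cB d (d + 1 + n) * A * B) (z i) := fun i => by
        have := (hF i).add ((h1.mono (M' := d+2+(n+1)) (by omega)) i)
        have e' : z i = fun t ξ => f i t ξ + Bl h pp v z i t ξ := by funext t ξ; exact e i t ξ
        rw [e']; exact this
      refine ⟨∑ i, F i + c * cB d (d + 1 + n) * A * B, fun i => ⟨(h2 i).1, fun t ξ => ((h2 i).2 t ξ).trans ?_⟩⟩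
      gcongr
      exact Finset.single_le_sum (f := F) (fun j _ => (hF j).nonneg) (Finset.mem_univ i)
  refine ⟨(hz i).1, fun M => ?_⟩
  obtain ⟨B, hB⟩ := key M
  exact ⟨B, ((hB i).mono (by omega : M ≤ d+2+M)).2⟩

lemma RDv_WBv {v : Vn d} (hv : ∀ i, RD (v i)) (M) : ∃ A, 0 ≤ A ∧ WBv M A v := by
  choose F hF using fun i => (hv i).WB M
  refine ⟨∑ i, F i, Finset.sum_nonneg fun i _ => (hF i).nonneg, fun i => ⟨(hF i).1, fun t ξ => ((hF i).2 t ξ).trans ?_⟩⟩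
  exact Finset.single_le_sum (f := F) (fun j _ => (hF j).nonneg) (Finset.mem_univ i)

lemma Bl_RD {k : Fn d} (hk : KB k) {p : Fin d → E d → ℂ} (hp : ∀ j, PB (fun _ ξ => p j ξ : Fn d))
    {v z : Vn d} (hv : ∀ i, RD (v i)) (hz : ∀ i, RD (z i)) (i) : RD (Bl k p v z i) :=
  Bl_Cl (r := 0) hk hp hv hz i

lemma toV_ofV' {v : Vn d} (h : ∀ i, RD (v i)) : toV (ofV v) = v := by
  obtain ⟨A, _, hA⟩ := RDv_WBv h (d+2); exact toV_ofV hA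

lemma ofV_eq {h : Fn d} {c} (hk : KI 1 c h) {p : Fin d → E d → ℂ} (hp : ∀ j, PL (p j)) {v z f z' : Vn d}
    (hv : ∀ i, RD (v i)) (hz : ∀ i, RD (z i)) (hf : ∀ i, RD (f i)) (hz' : ∀ i, RD (z' i))
    (e : ∀ i t ξ, z' i t ξ = f i t ξ + Bl h p v z i t ξ) : ofV z' = ofV f + BY h p (ofV v) (ofV z) := by
  apply toV_inj
  rw [toV_add, BY_toV hk hp, toV_ofV' hz', toV_ofV' hv, toV_ofV' hz, toV_ofV' hf]
  funext i t ξ; exact e i t ξ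

lemma toV_le (a b : YY d) (i t ξ) : ‖toV a i t ξ - toV b i t ξ‖ ≤ ‖a - b‖ := by
  have := ((toV_WB (a - b)) i).le' t ξ
  rwa [toV_sub] at this

noncomputable def itV (L : Vn d → Vn d) (f : ℕ → Vn d) : ℕ → Vn d
  | 0 => fun _ _ _ => 0
  | n+1 => fun i t ξ => f n i t ξ + L (itV L f n) i t ξ

lemma itV_RD {L : Vn d → Vn d} {f : ℕ → Vn d} (hL : ∀ z, (∀ i, RD (z i)) → ∀ i, RD (L z i))
    (hf : ∀ n i, RD (f n i)) : ∀ n i, RD (itV L f n i)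
  | 0, _ => RD_zero
  | n+1, i => (hf n i).add (hL _ (itV_RD hL hf n) i)

lemma claimX {h ht : Fn d} {hx : Fin d → Fn d} (K : KK h ht hx) {c A} (hk : KI 1 c h) {v : Vn d}
    (hv : ∀ i, RD (v i)) (hA0 : 0 ≤ A) (hvA : WBv (d+2) A v) (hsm : c * cB d (d+1) * A ≤ 1/2)
    {z f : Vn d} {fx : Fin d → Vn d} (hz : ∀ i, RD (z i)) (hf : ∀ i, RD (f i)) (hfx : ∀ l i, RD (fx l i))
    (Hf : ∀ i, HX (f i) (fun l => fx l i)) (e : ∀ i t ξ, z i t ξ = f i t ξ + Bl h pp v z i t ξ) :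
    ∃ w : Fin d → Vn d, (∀ l i, RD (w l i)) ∧ (∀ i, HX (z i) (fun l => w l i)) ∧
      ∀ l i t ξ, w l i t ξ = (fx l i t ξ + (Bl (hx l) pp v z i t ξ + Bl h (dp l) v z i t ξ)) +
        Bl h pp v (w l) i t ξ := by
  have hKB : KB h := K.cl 0
  have hxKB : ∀ l, KB (hx l) := K.xcl 0
  have ppB : ∀ j : Fin d, PB (fun _ ξ => pp j ξ : Fn d) := pp_Cl 0
  have dpB : ∀ l j : Fin d, PB (fun _ ξ => dp l j ξ : Fn d) := dp_Cl 0
  have hc := hk.nonneg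
  have hcB := cB_nonneg (d := d) (d+1)
  set y := ofV v with hy
  have hyA : ‖y‖ ≤ A := ofV_norm hA0 hvA
  set L := BY h pp y with hL
  have bd : ∀ a, ‖L a‖ ≤ 1/2 * ‖a‖ := fun a => (BY_norm hk pp_PL y a).trans (by
    gcongr; exact le_trans (by gcongr) hsm)
  have sr : ∀ a b, L (a - b) = L a - L b := BY_sr hk pp_PL y
  have hLR : ∀ z, (∀ i, RD (z i)) → ∀ i, RD (Bl h pp v z i) := fun z hz => Bl_RD hKB ppB hv hz
  let zn := itV (Bl h pp v) (fun _ => f)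
  have hzn : ∀ n i, RD (zn n i) := itV_RD hLR fun _ => hf
  obtain ⟨K1, hK1⟩ := abs_it bd sr (f := ofV f) (z := ofV z) (fn := fun _ => ofV f)
    (zn := fun n => ofV (zn n)) (ofV_eq hk pp_PL hv hz hf hz e)
    (fun n => ofV_eq hk pp_PL hv (hzn n) hf (hzn (n+1)) fun _ _ _ => rfl) (K := 0) (fun n => by simp)
  let Co (l : Fin d) (z : Vn d) : Vn d := fun i t ξ => Bl (hx l) pp v z i t ξ + Bl h (dp l) v z i t ξ
  have hCo : ∀ l z, (∀ i, RD (z i)) → ∀ i, RD (Co l z i) := fun l z hz i =>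
    (Bl_RD (hxKB l) ppB hv hz i).add (Bl_RD hKB (dpB l) hv hz i)
  let G (l : Fin d) (z : Vn d) : Vn d := fun i t ξ => fx l i t ξ + Co l z i t ξ
  have hG : ∀ l z, (∀ i, RD (z i)) → ∀ i, RD (G l z i) := fun l z hz i => (hfx l i).add (hCo l z hz i)
  choose cx hcx using K.kx
  have eG : ∀ l z, (∀ i, RD (z i)) → ofV (G l z) = ofV (fx l) + (BY (hx l) pp y (ofV z) + BY h (dp l) y (ofV z)) := by
    intro l z hz
    apply toV_inj
    rw [toV_add, toV_add, BY_toV (hcx l) pp_PL, BY_toV hk (dp_PL l), toV_ofV' (hG l z hz), toV_ofV' hv, toV_ofV' hz, toV_ofV' (hfx l)]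
  have dG : ∀ l, ∃ K2, ∀ n, ‖ofV (G l (zn n)) - ofV (G l z)‖ ≤ K2 * (3/4)^n := by
    intro l
    have hcl := (hcx l).nonneg
    refine ⟨(cx l * cB d (d+1) * ‖y‖ + c * cB d (d+1) * ‖y‖) * K1, fun n => ?_⟩
    have e1 : ofV (G l (zn n)) - ofV (G l z) = BY (hx l) pp y (ofV (zn n) - ofV z) + BY h (dp l) y (ofV (zn n) - ofV z) := by
      rw [eG l _ (hzn n), eG l _ hz, BY_sr (hcx l) pp_PL, BY_sr hk (dp_PL l)]; abel
    rw [e1]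
    calc _ ≤ cx l * cB d (d+1) * ‖y‖ * ‖ofV (zn n) - ofV z‖ + c * cB d (d+1) * ‖y‖ * ‖ofV (zn n) - ofV z‖ :=
          (norm_add_le _ _).trans (add_le_add (BY_norm (hcx l) pp_PL _ _) (BY_norm hk (dp_PL l) _ _))
      _ = (cx l * cB d (d+1) * ‖y‖ + c * cB d (d+1) * ‖y‖) * ‖ofV (zn n) - ofV z‖ := by ring
      _ ≤ (cx l * cB d (d+1) * ‖y‖ + c * cB d (d+1) * ‖y‖) * (K1 * (3/4)^n) := by gcongr; exact hK1 n
      _ = _ := by ring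
  choose K2 hK2 using dG
  choose W hW using fun l => abs_lin bd sr (ofV (G l z))
  have ew : ∀ l i t ξ, toV (W l) i t ξ = G l z i t ξ + Bl h pp v (toV (W l)) i t ξ := by
    intro l i t ξ
    conv_lhs => rw [hW l]
    rw [toV_add, BY_toV hk pp_PL, toV_ofV' (hG l z hz), toV_ofV' hv]
  have hwR : ∀ l i, RD (toV (W l) i) := fun l => boot K.k2 (hG l z hz) (toV_WB (W l))
    (fun M _ => by obtain ⟨A, _, hA⟩ := RDv_WBv hv M; exact ⟨A, hA⟩) (ew l)
  let wn (l : Fin d) := itV (Bl h pp v) (fun n => G l (zn n))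
  have hwn : ∀ l n i, RD (wn l n i) := fun l => itV_RD hLR fun n => hG l _ (hzn n)
  choose K3 hK3 using fun l => abs_it bd sr (f := ofV (G l z)) (z := W l) (fn := fun n => ofV (G l (zn n)))
    (zn := fun n => ofV (wn l n)) (hW l)
    (fun n => ofV_eq hk pp_PL hv (hwn l n) (hG l _ (hzn n)) (hwn l (n+1)) fun _ _ _ => rfl) (hK2 l)
  have hHX : ∀ n i, HX (zn n i) (fun l => wn l n i) := by
    intro n
    induction n with
    | zero => exact fun i => HX_zero
    | succ n ih =>
      intro i
      refine HX.congr ((Hf i).add (Bl_HX hKB hxKB K.dx hv (hzn n) (fun l => hwn l n) ih i)) fun l t ξ => ?_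
      change _ = G l (zn n) i t ξ + Bl h pp v (wn l n) i t ξ
      simp only [G, Co]; ring
  refine ⟨fun l => toV (W l), hwR, fun i t ξ => ?_, fun l i t ξ => ew l i t ξ⟩
  have hgeo : ∀ C : ℝ, Filter.Tendsto (fun n : ℕ => C * (3/4 : ℝ)^n) Filter.atTop (nhds 0) := fun C => by
    simpa using (tendsto_pow_atTop_nhds_zero_of_lt_one (by norm_num : (0:ℝ) ≤ 3/4) (by norm_num)).const_mul C
  refine hasFDerivAt_of_tendstoUniformly (f := fun n => zn n i t) (l := Filter.atTop)
    (f' := fun n ξ => gr (fun l => wn l n i t ξ)) (g' := fun ξ => gr (fun l => toV (W l) i t ξ)) ?_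
    (fun n ξ => hHX n i t ξ) (fun ξ => ?_) ξ
  · rw [Metric.tendstoUniformly_iff]
    intro ε hε
    filter_upwards [(hgeo (∑ l, K3 l)).eventually (gt_mem_nhds hε)] with n hn ξ
    refine lt_of_le_of_lt ?_ hn
    rw [dist_eq_norm, ← gr_sub, Finset.sum_mul]
    refine (norm_gr_le _).trans (Finset.sum_le_sum fun l _ => ?_)
    refine le_trans ?_ (hK3 l n)
    have := toV_le (ofV (wn l n)) (W l) i t ξ
    rw [toV_ofV' (hwn l n)] at this
    rwa [norm_sub_rev]
  · rw [tendsto_iff_norm_sub_tendsto_zero]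
    refine squeeze_zero (fun _ => norm_nonneg _) (fun n => ?_) (hgeo K1)
    refine le_trans ?_ (hK1 n)
    have := toV_le (ofV (zn n)) (ofV z) i t ξ
    rwa [toV_ofV' (hzn n), toV_ofV' hz] at this

noncomputable def NN (v z : Vn d) : Vn d := fun i t ξ => ∑ j, ∑ k,
  (Q (mm j k) (v k) (fun t ξ => pp j ξ * z i t ξ) t ξ - Q (mm j k) (v k) (fun t ξ => pp i ξ * z j t ξ) t ξ)

lemma NN_Cl {r} {v z : Vn d} (hv : ∀ i, Cl RD r (v i)) (hz : ∀ i, Cl RD r (z i)) (i) : Cl RD r (NN v z i) :=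
  ClRD_sum _ fun j _ => ClRD_sum _ fun k _ => ClRD_sub
    (Q_Cl (mm_MB j k) (hv k) (ClPB_mulRD (pp_Cl r j) (hz i))) (Q_Cl (mm_MB j k) (hv k) (ClPB_mulRD (pp_Cl r i) (hz j)))

lemma Bl_HT {h ht : Fn d} (hh : KB h) (hht : KB ht) (H : HT h ht) {v z : Vn d}
    (hv : ∀ i, RD (v i)) (hz : ∀ i, RD (z i)) (i) :
    HT (Bl h pp v z i) (fun t ξ => h 0 ξ * NN v z i t ξ + Bl ht pp v z i t ξ) := by
  intro t ξ
  have := HasDerivAt.fun_sum (u := Finset.univ) fun j _ => HasDerivAt.fun_sum (u := Finset.univ) fun k _ =>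
    (TT_HT hh hht H (mm_MB j k) (pp_Cl 0 j) (hv k) (hz i) t ξ).sub
    (TT_HT hh hht H (mm_MB j k) (pp_Cl 0 i) (hv k) (hz j) t ξ)
  refine HasDerivAt.congr_deriv this ?_
  simp only [NN, Bl, Finset.mul_sum, ← Finset.sum_add_distrib]
  refine Finset.sum_congr rfl fun j _ => Finset.sum_congr rfl fun k _ => by ring

lemma claimR {h ht : Fn d} {hx : Fin d → Fn d} (K : KK h ht hx) {c A} (hk : KI 1 c h) {v : Vn d}
    (hv : ∀ i, RD (v i)) (hA0 : 0 ≤ A) (hvA : WBv (d+2) A v) (hsm : c * cB d (d+1) * A ≤ 1/2) :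
    ∀ (r : ℕ) {z f : Vn d}, (∀ s, s < r → ∀ i, Cl RD s (v i)) → (∀ i, RD (z i)) → (∀ i, Cl RD r (f i)) →
    (∀ i t ξ, z i t ξ = f i t ξ + Bl h pp v z i t ξ) → ∀ i, Cl RD r (z i)
  | 0, _, _, _, hz, _, _ => hz
  | r+1, z, f, hvr, hz, hf, e => by
    have vr := hvr r (by omega)
    have ih := claimR K hk hv hA0 hvA hsm r (fun s hs => hvr s (by omega)) hz (fun i => (hf i).pred) e
    have f0 := fun i => (hf i).1
    choose ft hft cft using fun i => (hf i).2.1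
    choose fx Hfx cfx using fun i => (hf i).2.2
    obtain ⟨w, wR, wX, we⟩ := claimX K hk hv hA0 hvA hsm (fx := fun l i => fx i l) hz f0
      (fun l i => (cfx i l).base) Hfx e
    have wr := fun l => claimR K hk hv hA0 hvA hsm r (fun s hs => hvr s (by omega)) (wR l)
      (fun i => ClRD_add (cfx i l) (ClRD_add (Bl_Cl (K.xcl r l) (pp_Cl r) vr ih i) (Bl_Cl (K.cl r) (dp_Cl r l) vr ih i))) (we l)
    intro i
    refine ⟨hz i, ⟨fun t ξ => ft i t ξ + (h 0 ξ * NN v z i t ξ + Bl ht pp v z i t ξ), fun t ξ => ?_,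
      ClRD_add (cft i) (ClRD_add (ClPB_mulRD (ClPB_at0 (ClKB_PB (K.cl r))) (NN_Cl vr ih i))
        (Bl_Cl (K.tcl r) (pp_Cl r) vr ih i))⟩, fun l => w l i, wX i, fun l => wr l i⟩
    refine ((hft i t ξ).add (Bl_HT (K.cl 0) (K.tcl 0) K.dt hv hz i t ξ)).congr_of_eventuallyEq ?_
    exact Filter.Eventually.of_forall fun s => e i s ξ

lemma kern_KK (ν : ℝ) (hν : 0 < ν) {T : ℝ} (hT : 0 < T) {ψ : ℝ → ℝ} (hψ : Ccs ψ) (h1 : ∀ t, |ψ t| ≤ 1)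
    (h3 : ∀ t, 3 * T < |t| → ψ t = 0) : KK (kern ν ψ e0 : Fn d)
    (fun t ξ => kern ν (deriv ψ) e0 t ξ + (ν : ℂ) * ((sq ξ : ℂ) * kern ν ψ (deriv e0) t ξ))
    (fun j t ξ => ((2 * ν : ℝ) : ℂ) * ((ξ j : ℂ) * kern ν (fun t => t * ψ t) (deriv e0) t ξ)) where
  cl r := kern_Cl ν r hψ e0_Edec
  tcl r := ClKB_add (kern_Cl ν r hψ.deriv e0_Edec) (ClPB_mulKB (ClPB_const r _)
        (ClPB_mulKB (ClPB_sq r) (kern_Cl ν r hψ e0_Edec.deriv)))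
  xcl r l := ClPB_mulKB (ClPB_const r _) (ClPB_mulKB (ClPB_coord r l) (kern_Cl ν r hψ.idmul e0_Edec.deriv))
  dt := kern_HT ν hψ e0_Edec
  dx := kern_HX ν e0_Edec
  k2 := by
    obtain ⟨K, _, hK⟩ := kern_KI (d := d) ν hν e0_Edec
    exact ⟨_, (hK T hT ψ hψ h1 h3).2⟩
  kx l := kern_comm ν hν hψ e0_Edec.deriv _ l

noncomputable def cr (f : Fn d) : Fn d := fun t ξ => (starRingEnd ℂ) (f t (-ξ))

lemma cr_WB {M A} {f : Fn d} (h : WB M A f) : WB M A (cr f) := by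
  refine ⟨Complex.continuous_conj.comp (h.1.comp (by fun_prop : Continuous fun z : ℝ × E d => (z.1, -z.2))), fun t ξ => ?_⟩
  have := h.2 t (-ξ)
  simpa [cr] using this

lemma mm_neg (j k : Fin d) (η : E d) : mm j k (-η) = mm j k η := by
  simp [mm, sq]
lemma mm_conj (j k : Fin d) (η : E d) : (starRingEnd ℂ) (mm j k η) = mm j k η := by
  rw [mm, Complex.conj_ofReal]

lemma Q_cr (j k : Fin d) (f g : Fn d) : Q (mm j k) (cr f) (cr g) = cr (Q (mm j k) f g) := by
  funext t ξ
  simp only [Q, cr]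
  rw [← integral_conj, ← integral_neg_eq_self]
  congr 1; ext η
  simp only [map_mul, mm_neg, mm_conj, neg_neg]
  congr 4; congr 1; abel

lemma Dk_cr {k : Fn d} (hk : ∀ t ξ, cr k t ξ = k t ξ) (F : Fn d) : Dk k (cr F) = cr (Dk k F) := by
  funext t ξ
  simp only [Dk, cr]
  rw [intervalIntegral.intervalIntegral_eq_integral_uIoc, intervalIntegral.intervalIntegral_eq_integral_uIoc, Complex.real_smul, Complex.real_smul, map_mul,
    Complex.conj_ofReal, ← integral_conj]
  congr 2; ext s
  rw [map_mul, ← hk (t - s) ξ]; rfl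

lemma pp_cr (j : Fin d) (f : Fn d) : (fun t ξ => pp j ξ * cr f t ξ) = cr (fun t ξ => pp j ξ * f t ξ) := by
  funext t ξ
  simp [cr, pp]

lemma Bl_cr {k : Fn d} (hk : ∀ t ξ, cr k t ξ = k t ξ) (v z : Vn d) :
    Bl k pp (fun i => cr (v i)) (fun i => cr (z i)) = fun i => cr (Bl k pp v z i) := by
  funext i t ξ
  simp only [Bl, TT, pp_cr, Q_cr, Dk_cr hk]
  simp [cr, Bl, TT]

lemma NN_zero {v : Vn d} (hv : ∀ i, RD (v i)) (i t) : NN v v i t 0 = 0 := by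
  choose A hA using fun i => (hv i).WB (d+1)
  choose B hB using fun j i => ((pp_Cl 0 j).base.mulRD (hv i)).WB 0
  have hi : ∀ j k l n, Integrable fun η => mm j k η * (v k t η * (pp l (0 - η) * v n t (0 - η))) :=
    fun j k l n => Q_int (mm_MB j k) (hA k) (hB l n) t 0
  have hs : ∀ j k, Integrable fun η => (mm j k η * (v k t η * (pp j (0 - η) * v i t (0 - η))) -
      mm j k η * (v k t η * (pp i (0 - η) * v j t (0 - η)))) := fun j k => (hi j k j i).sub (hi j k i j)
  have e1 : NN v v i t 0 = ∫ η, ∑ j, ∑ k, (mm j k η * (v k t η * (pp j (0 - η) * v i t (0 - η))) -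
      mm j k η * (v k t η * (pp i (0 - η) * v j t (0 - η)))) := by
    rw [integral_finsetSum _ fun j _ => integrable_finsetSum _ fun k _ => hs j k]
    simp only [NN, Q]
    refine Finset.sum_congr rfl fun j _ => ?_
    rw [integral_finsetSum _ fun k _ => hs j k]
    refine Finset.sum_congr rfl fun k _ => ?_
    rw [integral_sub (hi j k j i) (hi j k i j)]
  set g : E d → ℂ := fun η => ∑ j, ∑ k, (mm j k η * (v k t η * (pp j (0 - η) * v i t (0 - η))) -
      mm j k η * (v k t η * (pp i (0 - η) * v j t (0 - η)))) with hg
  have hodd : ∀ η, g (-η) = - g η := by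
    intro η
    have hz : ∀ η : E d, ∀ k, ∑ j, (η j : ℂ) * mm j k η = 0 := by
      intro η k
      have : ∑ j, (η j) * ((if j = k then 1 else 0) - η j * η k / sq η) = 0 := by
        simp only [mul_sub, Finset.sum_sub_distrib, mul_ite, mul_one, mul_zero, Finset.sum_ite_eq', Finset.mem_univ, if_true]
        have : ∑ j, η j * (η j * η k / sq η) = sq η * η k / sq η := by
          conv_rhs => rw [sq, Finset.sum_mul, Finset.sum_div]
          refine Finset.sum_congr rfl fun j _ => by unfold sq; ring
        rw [this]
        by_cases h0 : sq η = 0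
        · have h1 := sq_ge η
          rw [h0] at h1
          have h2 : η = 0 := by
            rw [← norm_eq_zero]; nlinarith [norm_nonneg η]
          simp [h2]
        · rw [mul_div_cancel_left₀ _ h0, sub_self]
      have h := congrArg (fun x : ℝ => (x : ℂ)) this
      simpa [mm] using h
    have e2 : ∀ η, g η = - ∑ j, ∑ k, mm j k η * (v k t η * (pp i (0 - η) * v j t (0 - η))) := by
      intro η
      simp only [hg, Finset.sum_sub_distrib]
      rw [sub_eq_neg_self.2]
      rw [Finset.sum_comm]
      refine Finset.sum_eq_zero fun k _ => ?_
      have := hz η k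
      calc _ = (Complex.I * (v k t η * v i t (0 - η))) * ∑ j, (η j : ℂ) * mm j k η := by
            rw [Finset.mul_sum]; refine Finset.sum_congr rfl fun j _ => ?_
            simp [pp]; ring
        _ = 0 := by rw [this, mul_zero]
    rw [e2, e2, Finset.sum_comm]
    simp only [← Finset.sum_neg_distrib]
    refine Finset.sum_congr rfl fun k _ => Finset.sum_congr rfl fun j _ => ?_
    have : mm j k η = mm k j η := by unfold mm; simp [eq_comm, mul_comm]
    simp [mm_neg, pp, this]; ring_nf; simp
  rw [e1]
  have h2 : ∫ η, g η = - ∫ η, g η := by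
    conv_lhs => rw [← integral_neg_eq_self]
    rw [← integral_neg]; congr 1; ext η; exact hodd η
  exact self_eq_neg.1 h2

lemma kern_cr (ν : ℝ) (ψ e : ℝ → ℝ) (t ξ) : cr (kern ν ψ e : Fn d) t ξ = kern ν ψ e t ξ := by
  simp [cr, kern, sq]

lemma e0_deriv {y : ℝ} (hy : 0 ≤ y) : deriv e0 y = - e0 y := by
  have : e0 =ᶠ[nhds y] fun y => Real.exp (-y) := by
    filter_upwards [lt_mem_nhds (show (-1:ℝ) < y by linarith)] with s hs using e0_eq hs.le
  rw [this.deriv_eq, e0_eq (by linarith)]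
  have := ((Real.hasDerivAt_exp (-y)).comp y (hasDerivAt_neg y)).deriv
  simpa [Function.comp_def] using this

theorem exSol (ν : ℝ) (hν : 0 < ν) {V0 : Fin d → E d → ℂ} (hV : ∀ r i, Cl RD r (fun _ ξ => V0 i ξ : Fn d))
    (hre : ∀ i ξ, (starRingEnd ℂ) (V0 i (-ξ)) = V0 i ξ) (hz : ∀ i, V0 i 0 = 0) :
    ∃ T > 0, ∃ v : Vn d, (∀ r i, Cl RD r (v i)) ∧ (∀ i t ξ, (starRingEnd ℂ) (v i t (-ξ)) = v i t ξ) ∧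
      (∀ i t, v i t 0 = 0) ∧ (∀ i ξ, v i 0 ξ = V0 i ξ) ∧
      ∀ i ξ, ∀ t ∈ Set.Icc 0 T, HasDerivAt (fun s => v i s ξ)
        (-(ν * sq ξ : ℂ) * v i t ξ + NN v v i t ξ) t := by
  obtain ⟨A0, hA00, hA0⟩ := RDv_WBv (v := fun i _ ξ => V0 i ξ) (hV 0) (d+2)
  obtain ⟨C, hC0, hC⟩ := e0_Edec.b
  obtain ⟨K, hK0, hK⟩ := kern_KI (d := d) ν hν e0_Edec
  have hcB := cB_nonneg (d := d) (d+1)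
  set A := C * A0 with hA
  have hAnn : 0 ≤ A := by positivity
  set s := (16 * K * cB d (d+1) * A + 1)⁻¹ with hs
  have hD : 0 < 16 * K * cB d (d+1) * A + 1 := by positivity
  have hs0 : 0 < s := by positivity
  have hs1 : s ≤ 1 := inv_le_one_of_one_le₀ (by linarith [show 0 ≤ 16 * K * cB d (d+1) * A by positivity])
  have hs2 : (16 * K * cB d (d+1) * A + 1) * s = 1 := mul_inv_cancel₀ hD.ne'
  set T := s^2 with hT
  have hTp : 0 < T := by positivity
  have hTs : T + Real.sqrt T ≤ 2 * s := by rw [hT, Real.sqrt_sq hs0.le]; nlinarith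
  obtain ⟨ψ, hψ, p1, p3, p2⟩ := exists_psi T hTp
  obtain ⟨hk, -⟩ := hK T hTp ψ hψ p1 p3
  have KKh := kern_KK (d := d) ν hν hTp hψ p1 p3
  set h : Fn d := kern ν ψ e0 with hh
  set c := K * (T + Real.sqrt T) with hc
  have hc0 : 0 ≤ c := hk.nonneg
  set κ := c * cB d (d+1) with hκ
  have h8 : 8 * κ * A ≤ 1 := by
    have : κ ≤ K * (2 * s) * cB d (d+1) := by rw [hκ, hc]; gcongr
    calc 8 * κ * A ≤ 8 * (K * (2 * s) * cB d (d+1)) * A := by gcongr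
      _ = (16 * K * cB d (d+1) * A + 1) * s - s := by ring
      _ ≤ 1 := by rw [hs2]; linarith
  let f : Vn d := fun i t ξ => h t ξ * V0 i ξ
  have hf : ∀ r i, Cl RD r (f i) := fun r i => ClPB_mulRD (ClKB_PB (KKh.cl r)) (hV r i)
  have hfA : WBv (d+2) A f := by
    refine fun i => ⟨(hf 0 i).1, fun t ξ => ?_⟩
    have h1 : ‖h t ξ‖ ≤ C := by
      rw [hh, kern, Complex.norm_real, Real.norm_eq_abs, abs_mul]
      calc _ ≤ 1 * (C * Real.exp (-|ν * sq ξ * t|)) := by gcongr; exacts [p1 t, hC _]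
        _ ≤ 1 * (C * 1) := by gcongr; exact Real.exp_le_one_iff.2 (neg_nonpos.2 (abs_nonneg _))
        _ = C := by ring
    calc _ = ‖h t ξ‖ * (‖V0 i ξ‖ * (1 + ‖ξ‖)^(d+2)) := by rw [norm_mul]; ring
      _ ≤ C * A0 := by gcongr; exact (hA0 i).2 t ξ
  obtain ⟨y, hy1, hy2⟩ := abs_fix (mul_nonneg hc0 hcB) hAnn h8 (BY_norm hk pp_PL) (BY_sl hk pp_PL) (BY_sr hk pp_PL)
    (ofV_norm hAnn hfA)
  set v := toV y with hv
  have hvA : WBv (d+2) (2 * A) v := fun i => ⟨(toV_WB y i).1, fun t ξ => ((toV_WB y i).2 t ξ).trans hy1⟩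
  have ev : ∀ i t ξ, v i t ξ = f i t ξ + Bl h pp v v i t ξ := by
    intro i t ξ
    conv_lhs => rw [hv, hy2]
    rw [toV_add, BY_toV hk pp_PL, toV_ofV hfA]
  have vR : ∀ i, RD (v i) := boot KKh.k2 (hf 0) hvA (fun M h => h) ev
  have vC : ∀ r i, Cl RD r (v i) := by
    intro r
    induction r using Nat.strong_induction_on with
    | _ r ih => exact claimR KKh hk vR (by positivity) hvA (by linarith) r ih vR (hf r) ev
  have vcr : ∀ i, cr (v i) = v i := by
    have w1 : WBv (d+2) (2 * A) (fun i => cr (v i)) := fun i => cr_WB (hvA i)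
    have e1 : ofV (fun i => cr (v i)) = ofV f + BY h pp (ofV (fun i => cr (v i))) (ofV (fun i => cr (v i))) := by
      apply toV_inj
      rw [toV_add, BY_toV hk pp_PL, toV_ofV hfA, toV_ofV w1, Bl_cr (kern_cr ν ψ e0)]
      funext i t ξ
      have h1 := congrArg (starRingEnd ℂ) (ev i t (-ξ))
      have h2 := kern_cr (d := d) ν ψ e0 t ξ
      simp only [cr, map_add, f, map_mul, hre] at h1 h2 ⊢
      rw [h1, h2]
    have := abs_uniq (mul_nonneg hc0 hcB) h8 (BY_norm hk pp_PL) (BY_sl hk pp_PL) (BY_sr hk pp_PL)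
      hy1 (ofV_norm (by positivity) w1)
    have e2 : y - ofV (fun i => cr (v i)) = BY h pp y y - BY h pp (ofV (fun i => cr (v i))) (ofV (fun i => cr (v i))) := by
      conv_lhs => rw [hy2, e1]
      abel
    rw [← e2] at this
    have e3 : y = ofV (fun i => cr (v i)) := by
      rw [← sub_eq_zero, ← norm_le_zero_iff]; linarith
    intro i
    have e4 := congrFun (congrArg toV e3) i
    rw [toV_ofV w1] at e4
    exact e4.symm
  refine ⟨T, hTp, v, vC, fun i t ξ => congrFun (congrFun (vcr i) t) ξ, fun i t => ?_, fun i ξ => ?_, fun i ξ t ht => ?_⟩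
  · choose B hB using fun i => (vR i).WB (d+1)
    choose B' hB' using fun j i => ((pp_Cl 0 j).base.mulRD (vR i)).WB 0
    have hJ : ∀ j k l n, JC (Q (mm j k) (v k) (fun t ξ => pp l ξ * v n t ξ)) := fun j k l n =>
      Q_JC (mm_MB j k) (hB k) (hB' l n)
    have hii : ∀ j k l n, IntervalIntegrable (fun s => h (t - s) 0 * Q (mm j k) (v k) (fun t ξ => pp l ξ * v n t ξ) s 0) volume 0 t :=
      fun j k l n => Dk_ii (KKh.cl 0).1 (hJ j k l n) t 0 0 t
    rw [ev]
    have : Bl h pp v v i t 0 = ∫ s in (0:ℝ)..t, h (t - s) 0 * NN v v i s 0 := by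
      simp only [Bl, TT, Dk, NN, Finset.mul_sum, mul_sub]
      rw [intervalIntegral.integral_finsetSum]
      · refine Finset.sum_congr rfl fun j _ => ?_
        rw [intervalIntegral.integral_finsetSum]
        · refine Finset.sum_congr rfl fun k _ => ?_
          rw [intervalIntegral.integral_sub (hii j k j i) (hii j k i j)]
        · exact fun k _ => (hii j k j i).sub (hii j k i j)
      · intro j _
        have := IntervalIntegrable.sum Finset.univ fun k _ => (hii j k j i).sub (hii j k i j)
        refine (congrArg (fun F => IntervalIntegrable F volume 0 t) ?_).mp this
        funext s; simp
    rw [this]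
    simp [NN_zero vR, f, hz]
  · rw [ev]
    have : Bl h pp v v i 0 ξ = 0 := by simp [Bl, TT, Dk]
    rw [this]
    have : h 0 ξ = 1 := by simp [hh, kern, p2 0 (by simp; positivity), e0_eq]
    simp [f, this]
  · have kt : ∀ s ∈ Set.Icc 0 T, kern ν (deriv ψ) e0 s ξ + (ν : ℂ) * ((sq ξ : ℂ) * kern ν ψ (deriv e0) s ξ) =
        -(ν * sq ξ : ℂ) * h s ξ := by
      intro s hs
      have h1 : deriv ψ s = 0 := by
        have : ψ =ᶠ[nhds s] fun _ => 1 := by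
          filter_upwards [(continuous_abs.tendsto s).eventually (gt_mem_nhds (show |s| < 2 * T by
            rw [abs_of_nonneg hs.1]; linarith [hs.2]))] with r hr using p2 r hr.le
        rw [this.deriv_eq]; simp
      have h2 := e0_deriv (y := ν * sq ξ * s) (mul_nonneg (mul_nonneg hν.le (sq_nn ξ)) hs.1)
      simp only [hh, kern, h1, h2]; push_cast; ring
    have h1 := (KKh.dt t ξ).mul_const (V0 i ξ)
    have h2 := Bl_HT (KKh.cl 0) (KKh.tcl 0) KKh.dt vR vR i t ξ
    refine ((h1.add h2).congr_of_eventuallyEq (.of_forall fun s => ev i s ξ)).congr_deriv ?_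
    have h3 : Bl (fun t ξ => kern ν (deriv ψ) e0 t ξ + (ν : ℂ) * ((sq ξ : ℂ) * kern ν ψ (deriv e0) t ξ)) pp v v i t ξ =
        -(ν * sq ξ : ℂ) * Bl h pp v v i t ξ := by
      have : ∀ F : Fn d, Dk (fun t ξ => kern ν (deriv ψ) e0 t ξ + (ν : ℂ) * ((sq ξ : ℂ) * kern ν ψ (deriv e0) t ξ)) F t ξ =
          -(ν * sq ξ : ℂ) * Dk h F t ξ := by
        intro F
        rw [Dk, Dk, ← intervalIntegral.integral_const_mul]
        refine intervalIntegral.integral_congr fun s hs => ?_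
        rw [Set.uIcc_of_le ht.1] at hs
        beta_reduce
        rw [kt (t - s) ⟨by linarith [hs.2], by linarith [hs.1, ht.2]⟩]; ring
      simp only [Bl, TT, this, Finset.mul_sum, mul_sub]
    have h4 : h 0 ξ = 1 := by simp [hh, kern, p2 0 (by simp; positivity), e0_eq]
    beta_reduce
    rw [h3, kt t ht, h4, ev i t ξ]
    simp only [f]; ring

def PM (m : E d → ℂ) : Prop := Measurable m ∧ ∃ (a : ℕ) (C : ℝ), ∀ ξ, ‖m ξ‖ ≤ C * (1 + ‖ξ‖) ^ a
lemma MB.PM {m : E d → ℂ} (h : MB m) : PM m := ⟨h.1, 0, 2, fun ξ => by simpa using h.2 ξ⟩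
lemma PM_one : PM (fun _ => 1 : E d → ℂ) := ⟨measurable_const, 0, 1, fun ξ => by simp⟩

noncomputable def dt (x ξ : E d) : ℝ := ∑ k, x k * ξ k
noncomputable def ex (x ξ : E d) : ℂ := Complex.exp (((dt x ξ : ℝ) : ℂ) * Complex.I)
noncomputable def U (m : E d → ℂ) (f : Fn d) : Fn d := fun t x => ∫ ξ, ex x ξ * (m ξ * f t ξ)

lemma ex_norm (x ξ : E d) : ‖ex x ξ‖ = 1 := by rw [ex, Complex.norm_exp_ofReal_mul_I]
lemma ex_cont : Continuous (fun z : E d × E d => ex z.1 z.2) := by unfold ex dt; fun_prop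
lemma ex_cont' (x : E d) : Continuous (ex x) := by unfold ex dt; fun_prop

lemma U_bd {m : E d → ℂ} (hm : PM m) {f : Fn d} (hf : RD f) :
    ∃ K, ∀ t ξ x, ‖ex x ξ * (m ξ * f t ξ)‖ ≤ K * ((1 + ‖ξ‖) ^ (d+1))⁻¹ := by
  obtain ⟨a, C, hC⟩ := hm.2
  obtain ⟨A, hA⟩ := hf.WB (a + (d+1))
  have hC0 : 0 ≤ C := by have := (norm_nonneg _).trans (hC 0); simpa using this
  refine ⟨C * A, fun t ξ x => ?_⟩
  have := jb_pos ξ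
  rw [norm_mul, norm_mul, ex_norm, one_mul]
  calc _ ≤ (C * (1 + ‖ξ‖) ^ a) * (A * ((1 + ‖ξ‖) ^ (a + (d+1)))⁻¹) := by
        gcongr; exacts [hC ξ, hA.le t ξ]
    _ = _ := by rw [pow_add]; field_simp

lemma U_meas {m : E d → ℂ} (hm : PM m) {f : Fn d} (hf : JC f) (t x) :
    AEStronglyMeasurable (fun ξ => ex x ξ * (m ξ * f t ξ)) volume :=
  (ex_cont' x).aestronglyMeasurable.mul (hm.1.aestronglyMeasurable.mul (hf.t t).aestronglyMeasurable)

lemma U_int {m : E d → ℂ} (hm : PM m) {f : Fn d} (hf : RD f) (t x) :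
    Integrable (fun ξ => ex x ξ * (m ξ * f t ξ)) := by
  obtain ⟨K, hK⟩ := U_bd hm hf
  exact Integrable.mono' ((intJ le_rfl).const_mul K) (U_meas hm hf.1 t x)
    (.of_forall fun ξ => hK t ξ x)

lemma U_le {m : E d → ℂ} (hm : PM m) {f : Fn d} (hf : RD f) : ∃ K, ∀ t x, ‖U m f t x‖ ≤ K := by
  obtain ⟨K, hK⟩ := U_bd hm hf
  exact ⟨_, fun t x => (norm_integral_le_of_norm_le ((intJ le_rfl).const_mul K)
    (.of_forall fun ξ => hK t ξ x))⟩

lemma U_JC {m : E d → ℂ} (hm : PM m) {f : Fn d} (hf : RD f) : JC (U m f) := by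
  obtain ⟨K, hK⟩ := U_bd hm hf
  refine continuous_of_dominated (F := fun (z : ℝ × E d) ξ => ex z.2 ξ * (m ξ * f z.1 ξ))
    (fun z => U_meas hm hf.1 z.1 z.2) (fun z => Filter.Eventually.of_forall fun ξ => hK z.1 ξ z.2)
    ((intJ le_rfl).const_mul K) (.of_forall fun ξ => ?_)
  have h1 : Continuous fun z : ℝ × E d => ex z.2 ξ :=
    ex_cont.comp (continuous_snd.prodMk continuous_const)
  have h2 : Continuous fun z : ℝ × E d => f z.1 ξ :=
    hf.1.comp (continuous_fst.prodMk continuous_const)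
  exact h1.mul (continuous_const.mul h2)

lemma U_HT {m : E d → ℂ} (hm : PM m) {f ft : Fn d} (hf : RD f) (hft : RD ft) (h : HT f ft) :
    HT (U m f) (U m ft) := by
  intro t x
  obtain ⟨K, hK⟩ := U_bd hm hft
  exact (hasDerivAt_integral_of_dominated_loc_of_deriv_le (μ := volume)
    (F := fun s ξ => ex x ξ * (m ξ * f s ξ)) (F' := fun s ξ => ex x ξ * (m ξ * ft s ξ))
    (x₀ := t) (s := Set.univ) (bound := fun ξ => K * ((1 + ‖ξ‖) ^ (d+1))⁻¹) Filter.univ_mem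
    (.of_forall fun s => U_meas hm hf.1 s x)
    (U_int hm hf t x) (U_int hm hft t x).1
    (.of_forall fun ξ s _ => hK s ξ x)
    ((intJ le_rfl).const_mul _)
    (.of_forall fun ξ s _ => ((h s ξ).const_mul (m ξ)).const_mul _)).2

noncomputable def ix (k : Fin d) (f : Fn d) : Fn d := fun t ξ => Complex.I * ((ξ k : ℂ) * f t ξ)
lemma ix_Cl {r} (k : Fin d) {f : Fn d} (hf : Cl RD r f) : Cl RD r (ix k f) := ClRD_cmul _ (ClRD_coord k hf)
lemma ix_RD (k : Fin d) {f : Fn d} (hf : RD f) : RD (ix k f) := ix_Cl (r := 0) k hf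

lemma dt_comm (x ξ : E d) : dt x ξ = dt ξ x := by simp [dt, mul_comm]

lemma ex_hfd (x ξ : E d) : HasFDerivAt (fun x => ex x ξ) (gr fun k => Complex.I * ((ξ k : ℂ) * ex x ξ)) x := by
  have h : HasFDerivAt (fun x => dt x ξ) (∑ k, (ξ k) • (pj k)) x := by
    unfold dt
    exact HasFDerivAt.fun_sum fun k _ => ((pj k).hasFDerivAt).mul_const (ξ k)
  have h2 := ((Complex.ofRealCLM.hasFDerivAt.comp x h).mul_const Complex.I).cexp
  refine h2.congr_fderiv ?_
  ext w
  rw [gr_apply]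
  simp [ex, Finset.mul_sum, Finset.sum_mul]
  refine Finset.sum_congr rfl fun k _ => ?_
  ring
lemma ex_hfd' (x ξ : E d) : HasFDerivAt (fun ξ => ex x ξ) (gr fun k => Complex.I * ((x k : ℂ) * ex x ξ)) ξ := by
  have := ex_hfd ξ x
  simp only [ex, dt_comm _ x] at this ⊢
  exact this

lemma U_HX {m : E d → ℂ} (hm : PM m) {f : Fn d} (hf : RD f) : HX (U m f) (fun k => U m (ix k f)) := by
  intro t x
  choose K hK using fun k => U_bd hm (ix_RD k hf)
  have ii := fun k => U_int hm (ix_RD k hf) t x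
  have := hasFDerivAt_integral_of_dominated_of_fderiv_le (μ := volume) (𝕜 := ℝ)
    (F := fun x ξ => ex x ξ * (m ξ * f t ξ))
    (F' := fun x ξ => gr (fun k => ex x ξ * (m ξ * ix k f t ξ)))
    (x₀ := x) (s := Set.univ) (bound := fun η => ∑ k, K k * ((1 + ‖η‖) ^ (d+1))⁻¹)
    Filter.univ_mem
    (.of_forall fun x => U_meas hm hf.1 t x)
    (U_int hm hf t x) (gr_meas fun k => (ii k).1)
    (.of_forall fun ξ s _ => (norm_gr_le _).trans
      (Finset.sum_le_sum fun k _ => hK k t ξ s))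
    (integrable_finsetSum _ fun k _ => (intJ le_rfl).const_mul _)
    (.of_forall fun ξ s _ => by
      refine ((ex_hfd s ξ).mul_const (m ξ * f t ξ)).congr_fderiv ?_
      ext w
      simp only [gr_apply, ContinuousLinearMap.smul_apply, MulOpposite.smul_eq_mul_unop,
        Finset.sum_mul, Finset.mul_sum, ix, smul_eq_mul]
      refine Finset.sum_congr rfl fun k _ => ?_
      ring)
  rw [gr_integral ii] at this
  exact this

lemma U_Cl {m : E d → ℂ} (hm : PM m) : ∀ {r} {f : Fn d}, Cl RD r f → Cl JC r (U m f)
  | 0, _, hf => U_JC hm hf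
  | r+1, _, ⟨h0, ⟨ft, h1, h2⟩, fx, h3, h4⟩ =>
    ⟨U_JC hm h0, ⟨_, U_HT hm h0 h2.base h1, U_Cl hm h2⟩, _, U_HX hm h0, fun k =>
      U_Cl hm (ix_Cl k (Cl.pred ⟨h0, ⟨ft, h1, h2⟩, fx, h3, h4⟩))⟩

lemma ClJC_contDiff : ∀ {r : ℕ} {F : Fn d}, Cl JC r F → ContDiff ℝ r (fun z : ℝ × E d => F z.1 z.2)
  | 0, F, h => contDiff_zero.2 h
  | r+1, F, ⟨h0, ⟨Ft, h1, h2⟩, Fx, h3, h4⟩ => by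
    push_cast
    rw [contDiff_succ_iff_hasFDerivAt]
    have c2 := ClJC_contDiff h2
    have c4 := fun k => ClJC_contDiff (h4 k)
    have cg : ContDiff ℝ r (fun z : ℝ × E d => gr (fun k => Fx k z.1 z.2)) := by
      unfold gr
      refine ContDiff.sum fun k _ => ?_
      exact (ContinuousLinearMap.smulRightL ℝ (E d) ℂ
        (pj k)).contDiff.comp (c4 k)
    have ct : ContDiff ℝ r (fun z : ℝ × E d => (ContinuousLinearMap.toSpanSingleton ℝ (Ft z.1 z.2) : ℝ →L[ℝ] ℂ)) :=
      (ContinuousLinearMap.smulRightL ℝ ℝ ℂ (1 : ℝ →L[ℝ] ℝ)).contDiff.comp c2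
    refine ⟨fun z => ((ContinuousLinearMap.toSpanSingleton ℝ (Ft z.1 z.2) : ℝ →L[ℝ] ℂ)).coprod (gr (fun k => Fx k z.1 z.2)), ?_, fun z => ?_⟩
    · have e : ∀ z : ℝ × E d, ((ContinuousLinearMap.toSpanSingleton ℝ (Ft z.1 z.2) : ℝ →L[ℝ] ℂ)).coprod (gr (fun k => Fx k z.1 z.2)) =
        ((ContinuousLinearMap.toSpanSingleton ℝ (Ft z.1 z.2) : ℝ →L[ℝ] ℂ)).comp (ContinuousLinearMap.fst ℝ ℝ (E d)) +
        (gr (fun k => Fx k z.1 z.2)).comp (ContinuousLinearMap.snd ℝ ℝ (E d)) := fun z => by ext <;> simp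
      simp only [e]
      exact (ct.clm_comp contDiff_const).add (cg.clm_comp contDiff_const)
    · exact (hasStrictFDerivAt_uncurry_coprod (𝕜 := ℝ) (u := z) (f := F)
        (f₁ := fun t x => (ContinuousLinearMap.toSpanSingleton ℝ (Ft t x) : ℝ →L[ℝ] ℂ)) (f₂ := fun t x => gr (fun k => Fx k t x))
        (.of_forall fun w => (h1 w.1 w.2).hasFDerivAt)
        (.of_forall fun w => h3 w.1 w.2) ct.continuous.continuousAt cg.continuous.continuousAt).hasFDerivAt

lemma U_lin {ι : Type*} (s : Finset ι) (c : ι → ℂ) {m : ι → E d → ℂ} (hm : ∀ i, PM (m i)) {f : ι → Fn d}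
    (hf : ∀ i, RD (f i)) (t x) : ∑ i ∈ s, c i * U (m i) (f i) t x =
      ∫ ξ, ex x ξ * ∑ i ∈ s, c i * (m i ξ * f i t ξ) := by
  have : ∀ ξ, ex x ξ * ∑ i ∈ s, c i * (m i ξ * f i t ξ) = ∑ i ∈ s, c i * (ex x ξ * (m i ξ * f i t ξ)) := by
    intro ξ; rw [Finset.mul_sum]; exact Finset.sum_congr rfl fun i _ => by ring
  simp only [this]
  rw [integral_finsetSum _ fun i _ => (U_int (hm i) (hf i) t x).const_mul (c i)]
  simp only [integral_const_mul]; rfl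

lemma ex_add (x ξ η : E d) : ex x (ξ + η) = ex x ξ * ex x η := by
  rw [ex, ex, ex, ← Complex.exp_add]; congr 1; simp [dt, mul_add, Finset.sum_add_distrib, add_mul]

lemma U_Q {m : E d → ℂ} (hm : MB m) {f g : Fn d} (hf : RD f) (hg : RD g) (t x) :
    U (fun _ => 1) (Q m f g) t x = U m f t x * U (fun _ => 1) g t x := by
  have := integral_convolution (ContinuousLinearMap.mul ℝ ℂ) (U_int hm.PM hf t x) (U_int PM_one hg t x)
  simp only [ContinuousLinearMap.mul_apply'] at this
  unfold U
  rw [← this]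
  refine integral_congr_ae (.of_forall fun ξ => ?_)
  simp only [convolution, Q, ContinuousLinearMap.mul_apply', one_mul]
  rw [← integral_const_mul]
  refine integral_congr_ae (.of_forall fun η => ?_)
  beta_reduce
  conv_lhs => rw [show ξ = η + (ξ - η) by abel, ex_add]
  simp only [add_sub_cancel_left]
  ring

lemma RD_intg {f : Fn d} (hf : RD f) (t) : Integrable (f t) := by
  have := U_int (d := d) PM_one hf t 0
  simpa [ex, dt] using this

lemma U_ibp {f : Fn d} {fx : Fin d → Fn d} (hf : RD f) (h : HX f fx) (hx : ∀ k, RD (fx k)) (j : Fin d) (t x) :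
    (x j : ℂ) * U (fun _ => 1) f t x = Complex.I * U (fun _ => 1) (fx j) t x := by
  have i1 : Integrable fun ξ => ex x ξ * f t ξ := by simpa using U_int PM_one hf t x
  have i2 : Integrable fun ξ => ex x ξ * fx j t ξ := by simpa using U_int PM_one (hx j) t x
  have e1 : ∀ ξ, fderiv ℝ (ex x) ξ (Pi.single j 1) = Complex.I * ((x j : ℂ) * ex x ξ) := fun ξ => by
    rw [(ex_hfd' x ξ).fderiv, gr_single]
  have e2 : ∀ ξ, fderiv ℝ (f t) ξ (Pi.single j 1) = fx j t ξ := fun ξ => by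
    rw [(h t ξ).fderiv, gr_single]
  have := integral_mul_fderiv_eq_neg_fderiv_mul_of_integrable (μ := volume) (f := ex x) (g := f t) (v := Pi.single j 1)
    (by
      refine (i1.const_mul (Complex.I * x j)).congr (.of_forall fun ξ => ?_)
      beta_reduce; rw [e1]; ring)
    (by simpa only [e2] using i2) i1 (fun ξ _ => (ex_hfd' x ξ).differentiableAt) (fun ξ _ => (h t ξ).differentiableAt)
  simp only [e1, e2] at this
  simp only [U, one_mul]
  rw [this]
  have : ∫ ξ, Complex.I * ((x j : ℂ) * ex x ξ) * f t ξ = Complex.I * x j * ∫ ξ, ex x ξ * f t ξ := by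
    rw [← integral_const_mul]; congr 1; ext ξ; ring
  rw [this]
  linear_combination ((x j : ℂ) * ∫ ξ, ex x ξ * f t ξ) * Complex.I_sq

lemma Cl_all {B : Fn d → Prop} {f : Fn d} (h : ∀ r, Cl B r f) :
    ∃ (ft : Fn d) (fx : Fin d → Fn d), HT f ft ∧ HX f fx ∧ (∀ r, Cl B r ft) ∧ ∀ k r, Cl B r (fx k) := by
  obtain ⟨_, ⟨ft, h1, _⟩, fx, h3, _⟩ := h 1
  refine ⟨ft, fx, h1, h3, fun r => ?_, fun k r => ?_⟩
  · obtain ⟨_, ⟨gt, k1, k2⟩, _⟩ := h (r+1)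
    have : ft = gt := by funext t ξ; exact (h1 t ξ).unique (k1 t ξ)
    rwa [this]
  · obtain ⟨_, _, gx, k3, k4⟩ := h (r+1)
    have : fx k = gx k := by
      funext t ξ
      have := (h3 t ξ).unique (k3 t ξ)
      rw [← gr_single (fun k => fx k t ξ) k, this, gr_single]
    rw [this]; exact k4 k

noncomputable def IH (n : ℕ) (g : Fn d) : Fn d := fun t ξ => ∫ τ in Set.Icc (0:ℝ) 1, (τ : ℂ) ^ n * g t (τ • ξ)

lemma IH_c {g : Fn d} (n : ℕ) (hg : JC g) : Continuous (fun z : (ℝ × E d) × ℝ => (z.2 : ℂ) ^ n * g z.1.1 (z.2 • z.1.2)) :=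
  (by fun_prop : Continuous fun z : (ℝ × E d) × ℝ => (z.2 : ℂ) ^ n).mul
    (hg.comp (by fun_prop : Continuous fun z : (ℝ × E d) × ℝ => (z.1.1, z.2 • z.1.2)))

lemma IH_c' {g : Fn d} (n : ℕ) (hg : JC g) (t ξ) : Continuous (fun τ : ℝ => (τ : ℂ) ^ n * g t (τ • ξ)) :=
  (IH_c n hg).comp (by fun_prop : Continuous fun τ : ℝ => ((t, ξ), τ))

lemma IH_pt {g : Fn d} {a : ℕ} {C : ℝ} (h : ∀ t ξ, ‖g t ξ‖ ≤ C * (1 + ‖ξ‖) ^ a) (n : ℕ) (t : ℝ) (ξ : E d) (τ : ℝ)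
    (hτ : τ ∈ Set.Icc (0:ℝ) 1) : ‖(τ : ℂ) ^ n * g t (τ • ξ)‖ ≤ C * (1 + ‖ξ‖) ^ a := by
  have hC : 0 ≤ C := by have := (norm_nonneg _).trans (h 0 0); simpa using this
  have h1 : ‖(τ : ℂ) ^ n‖ ≤ 1 := by
    rw [norm_pow, Complex.norm_real, Real.norm_eq_abs, abs_of_nonneg hτ.1]; exact pow_le_one₀ hτ.1 hτ.2
  have h2 : ‖τ • ξ‖ ≤ ‖ξ‖ := by
    rw [norm_smul, Real.norm_eq_abs, abs_of_nonneg hτ.1]; exact mul_le_of_le_one_left (norm_nonneg _) hτ.2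
  rw [norm_mul]
  calc _ ≤ 1 * (C * (1 + ‖τ • ξ‖) ^ a) := by gcongr; exact h _ _
    _ ≤ _ := by rw [one_mul]; gcongr

lemma IH_PB {g : Fn d} (n : ℕ) (hg : PB g) : PB (IH n g) := by
  obtain ⟨hJ, a, C, hC⟩ := hg
  refine ⟨continuous_parametric_integral_of_continuous (f := fun (z : ℝ × E d) (τ : ℝ) => (τ : ℂ) ^ n * g z.1 (τ • z.2)) (IH_c n hJ) isCompact_Icc, a, C, fun t ξ => ?_⟩
  refine (norm_setIntegral_le_of_norm_le_const (by simp) (fun τ hτ => IH_pt hC n t ξ τ hτ)).trans ?_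
  simp

lemma IH_HT {g gt : Fn d} (n : ℕ) (hg : PB g) (hgt : PB gt) (h : HT g gt) : HT (IH n g) (IH n gt) := by
  intro t ξ
  obtain ⟨hJ, a, C, hC⟩ := hgt
  exact (hasDerivAt_integral_of_dominated_loc_of_deriv_le (μ := volume.restrict (Set.Icc (0:ℝ) 1))
    (F := fun s τ => (τ : ℂ) ^ n * g s (τ • ξ)) (F' := fun s τ => (τ : ℂ) ^ n * gt s (τ • ξ))
    (x₀ := t) (s := Set.univ) (bound := fun _ => C * (1 + ‖ξ‖) ^ a) Filter.univ_mem
    (.of_forall fun s => (IH_c' n hg.1 s ξ).aestronglyMeasurable)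
    ((IH_c' n hg.1 t ξ).integrableOn_Icc) (IH_c' n hJ t ξ).aestronglyMeasurable
    (ae_restrict_of_forall_mem measurableSet_Icc fun τ hτ s _ => IH_pt hC n s ξ τ hτ)
    (integrable_const _)
    (.of_forall fun τ s _ => (h s (τ • ξ)).const_mul _)).2

lemma IH_HX {g : Fn d} {gx : Fin d → Fn d} (n : ℕ) (hg : PB g) (hgx : ∀ k, PB (gx k)) (h : HX g gx) :
    HX (IH n g) (fun k => IH (n+1) (gx k)) := by
  intro t ξ
  choose hJ a C hC using hgx
  have ii := fun k => (IH_c' (n+1) (hJ k) t ξ).integrableOn_Icc (μ := volume) (a := 0) (b := 1)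
  have := hasFDerivAt_integral_of_dominated_of_fderiv_le (μ := volume.restrict (Set.Icc (0:ℝ) 1)) (𝕜 := ℝ)
    (F := fun ξ τ => (τ : ℂ) ^ n * g t (τ • ξ))
    (F' := fun ξ τ => gr (fun k => (τ : ℂ) ^ (n+1) * gx k t (τ • ξ)))
    (x₀ := ξ) (s := Metric.ball ξ 1) (bound := fun _ => ∑ k, C k * (1 + (‖ξ‖ + 1)) ^ a k)
    (Metric.ball_mem_nhds ξ one_pos)
    (.of_forall fun ξ => (IH_c' n hg.1 t ξ).aestronglyMeasurable)
    ((IH_c' n hg.1 t ξ).integrableOn_Icc)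
    (Continuous.aestronglyMeasurable (by
      unfold gr
      refine continuous_finset_sum _ fun k _ => ?_
      exact (ContinuousLinearMap.smulRightL ℝ (E d) ℂ
        (pj k)).continuous.comp (IH_c' (n+1) (hJ k) t ξ)))
    (ae_restrict_of_forall_mem measurableSet_Icc fun τ hτ s hs => (norm_gr_le _).trans
      (Finset.sum_le_sum fun k _ => (IH_pt (hC k) (n+1) t s τ hτ).trans (by
        have h0 : 0 ≤ C k := by have := (norm_nonneg _).trans (hC k 0 0); simpa using this
        have : ‖s‖ ≤ ‖ξ‖ + 1 := by
          have := norm_le_norm_add_norm_sub' s ξ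
          rw [mem_ball_iff_norm] at hs; linarith
        gcongr)))
    (integrable_const _)
    (.of_forall fun τ s _ => by
      have h1 := (h t (τ • s)).comp s ((hasFDerivAt_id s).const_smul τ)
      refine (h1.const_mul ((τ : ℂ) ^ n)).congr_fderiv ?_
      ext w
      simp [gr_apply, Finset.mul_sum]
      exact Finset.sum_congr rfl fun k _ => by ring)
  rw [gr_integral ii] at this
  exact this

lemma IH_Cl : ∀ {r : ℕ} (n : ℕ) {g : Fn d}, Cl PB r g → Cl PB r (IH n g)
  | 0, n, _, h => IH_PB n h
  | _+1, n, _, ⟨h0, ⟨_, h1, h2⟩, _, h3, h4⟩ =>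
    ⟨IH_PB n h0, ⟨_, IH_HT n h0 h2.base h1, IH_Cl n h2⟩, _, IH_HX n h0 (fun k => (h4 k).base) h3,
      fun k => IH_Cl (n+1) (h4 k)⟩

lemma IH_eq {f : Fn d} {fx : Fin d → Fn d} (h : HX f fx) (hJ : ∀ k, JC (fx k)) (t ξ) :
    f t ξ - f t 0 = ∑ k, (ξ k : ℂ) * IH 0 (fx k) t ξ := by
  have hd : ∀ τ ∈ Set.uIcc (0:ℝ) 1, HasDerivAt (fun τ : ℝ => f t (τ • ξ)) (∑ k, (ξ k : ℂ) * fx k t (τ • ξ)) τ := by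
    intro τ _
    have h1 := (h t (τ • ξ)).comp_hasDerivAt τ ((hasDerivAt_id τ).smul_const ξ)
    refine h1.congr_deriv ?_
    simp [gr_apply]
  have hc : ∀ k, Continuous fun τ : ℝ => (ξ k : ℂ) * fx k t (τ • ξ) := fun k =>
    continuous_const.mul (by simpa using IH_c' 0 (hJ k) t ξ)
  have := intervalIntegral.integral_eq_sub_of_hasDerivAt hd
    ((continuous_finset_sum _ fun k _ => hc k).intervalIntegrable 0 1)
  rw [one_smul, zero_smul, intervalIntegral.integral_finsetSum fun k _ => (hc k).intervalIntegrable 0 1] at this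
  rw [← this]
  refine Finset.sum_congr rfl fun k _ => ?_
  rw [intervalIntegral.integral_const_mul, intervalIntegral.integral_of_le zero_le_one, ← integral_Icc_eq_integral_Ioc]
  simp [IH]

noncomputable def ga (s : ℝ) : Fn d := fun _ ξ => ((Real.exp (-s * sq ξ) : ℝ) : ℂ)

lemma ga_RD {s : ℝ} (hs : 0 < s) : RD (ga s : Fn d) := by
  constructor
  · unfold JC ga; have := sq_cont (d := d); fun_prop
  · intro M
    refine ⟨Real.exp (M ^ 2 / (4 * s)), fun t ξ => ?_⟩
    rw [ga, Complex.norm_real, Real.norm_eq_abs, abs_of_pos (Real.exp_pos _)]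
    have h1 : (1 + ‖ξ‖) ^ M ≤ Real.exp (M * ‖ξ‖) := by
      rw [Real.exp_nat_mul]; have := Real.add_one_le_exp ‖ξ‖; gcongr; linarith
    calc _ ≤ Real.exp (-s * sq ξ) * Real.exp (M * ‖ξ‖) := by gcongr
      _ = Real.exp (-s * sq ξ + M * ‖ξ‖) := (Real.exp_add _ _).symm
      _ ≤ _ := by
        apply Real.exp_le_exp.2
        have h2 : s * ‖ξ‖ ^ 2 ≤ s * sq ξ := by gcongr; exact sq_ge ξ
        rw [le_div_iff₀ (by positivity)]
        nlinarith [_root_.sq_nonneg (2 * s * ‖ξ‖ - M)]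

lemma ga_HX (s : ℝ) : HX (ga s : Fn d) (fun k t ξ => ((-2 * s : ℝ) : ℂ) * ((ξ k : ℂ) * ga s t ξ)) := by
  intro t ξ
  have h3 := ((sq_hfd ξ).const_mul (-s)).exp
  have h4 := Complex.ofRealCLM.hasFDerivAt.comp ξ h3
  refine h4.congr_fderiv ?_
  ext w
  simp only [gr_apply, ga]
  simp [Finset.mul_sum]
  refine Finset.sum_congr rfl fun i _ => ?_
  ring

lemma ga_Cl {s : ℝ} (hs : 0 < s) : ∀ r, Cl RD r (ga s : Fn d)
  | 0 => ga_RD hs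
  | r+1 => ⟨ga_RD hs, ⟨fun _ _ => 0, fun _ _ => hasDerivAt_const _ _, ClRD_zero r⟩, _, ga_HX s,
      fun k => ClRD_cmul _ (ClRD_coord k (ga_Cl hs r))⟩

lemma ClPB_at : ∀ {r} {f : Fn d}, Cl RD r f → Cl PB r (fun t _ => f t 0 : Fn d)
  | 0, f, h => by
    obtain ⟨C, hC⟩ := h.2 0
    exact ⟨h.1.comp (by fun_prop : Continuous fun z : ℝ × E d => (z.1, (0 : E d))), 0, C, fun t ξ => by simpa using hC t 0⟩
  | r+1, f, ⟨h0, ⟨ft, h1, h2⟩, _, _, _⟩ => ⟨ClPB_at (r := 0) h0, ⟨_, fun t ξ => h1 t 0, ClPB_at h2⟩,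
      fun _ _ _ => 0, fun t ξ => by
        have : gr (fun _ : Fin d => (0:ℂ)) = 0 := by ext w; simp [gr_apply]
        rw [this]; exact hasFDerivAt_const _ _, fun k => ClPB_const r 0⟩

theorem hadamard {f : Fn d} (hf : ∀ r, Cl RD r f) : ∃ R : Fin d → Fn d, (∀ k r, Cl RD r (R k)) ∧
    ∀ t ξ, f t ξ = f t 0 * ga 1 t ξ + ∑ k, (ξ k : ℂ) * R k t ξ := by
  let F : Fn d := fun t ξ => f t ξ - f t 0 * ga 1 t ξ
  have hF : ∀ r, Cl RD r F := fun r => ClRD_sub (hf r) (ClPB_mulRD (ClPB_at (hf r)) (ga_Cl one_pos r))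
  obtain ⟨Ft, Fx, h1, h2, h3, h4⟩ := Cl_all hF
  let gx : Fin d → Fn d := fun k t ξ => ((-2 * 1 : ℝ) : ℂ) * ((ξ k : ℂ) * ga 1 t ξ)
  have hg : ∀ k r, Cl RD r (gx k) := fun k r => ClRD_cmul _ (ClRD_coord k (ga_Cl one_pos r))
  refine ⟨fun k t ξ => IH 0 (Fx k) t ξ * ga 1 t ξ - IH 0 (gx k) t ξ * F t ξ, fun k r => ClRD_sub
    (ClPB_mulRD (IH_Cl 0 (ClRD_PB (h4 k r))) (ga_Cl one_pos r)) (ClPB_mulRD (IH_Cl 0 (ClRD_PB (hg k r))) (hF r)), fun t ξ => ?_⟩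
  have e1 := IH_eq h2 (fun k => (h4 k 0).1) t ξ
  have e2 := IH_eq (ga_HX 1) (fun k => (hg k 0).1) t ξ
  have e3 : ga 1 t (0 : E d) = 1 := by simp [ga, sq]
  have e4 : F t 0 = 0 := by simp [F, e3]
  rw [e3] at e2
  rw [e4] at e1
  simp only [mul_sub, Finset.sum_sub_distrib, ← mul_assoc, ← Finset.sum_mul]
  rw [← e1, ← e2]
  simp only [F]; ring

noncomputable def rg (c : Fin d → ℝ) : E d →L[ℝ] ℝ :=
  ∑ k, c k • (pj k)

lemma rg_apply (c : Fin d → ℝ) (w : E d) : rg c w = ∑ k, c k * w k := by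
  simp [rg, ContinuousLinearMap.sum_apply]

lemma rg_single (c : Fin d → ℝ) (j : Fin d) : rg c (Pi.single j 1) = c j := by
  rw [rg_apply, Finset.sum_eq_single j] <;> simp +contextual [Pi.single_apply]

lemma hfd_ofReal {f : E d → ℝ} {c : Fin d → ℝ} {x : E d} (h : HasFDerivAt f (rg c) x) :
    HasFDerivAt (fun x => (f x : ℂ)) (gr fun k => (c k : ℂ)) x := by
  refine (Complex.ofRealCLM.hasFDerivAt.comp x h).congr_fderiv ?_
  ext w
  simp [rg_apply, gr_apply, mul_comm]

open MvPolynomial in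
lemma pfd (p : MvPolynomial (Fin d) ℝ) (x : E d) :
    HasFDerivAt (fun x : E d => eval x p) (rg fun k => eval x (pderiv k p)) x := by
  induction p using MvPolynomial.induction_on with
  | C a =>
    simp only [eval_C, pderiv_C, map_zero]
    refine (hasFDerivAt_const a x).congr_fderiv ?_
    ext w; simp [rg_apply]
  | add p q hp hq =>
    simp only [map_add]
    refine (hp.add hq).congr_fderiv ?_
    ext w; simp [rg_apply, add_mul, Finset.sum_add_distrib]
  | mul_X p i hp =>
    have h2 : HasFDerivAt (fun x : E d => x i) (pj i) x := hasFDerivAt_apply i x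
    simp only [map_mul, eval_X]
    refine (hp.mul h2).congr_fderiv ?_
    ext w
    simp only [Derivation.leibniz, pderiv_X, rg_apply, ContinuousLinearMap.add_apply, ContinuousLinearMap.smul_apply,
      smul_eq_mul, map_add, map_mul, eval_X, add_mul, Finset.sum_add_distrib, ContinuousLinearMap.proj_apply, Finset.mul_sum]
    congr 1
    · rw [Finset.sum_eq_single i]
      · simp
      · intro b _ hb; simp [Pi.single_apply, hb.symm]
      · simp
    · refine Finset.sum_congr rfl fun k _ => by ring

open MvPolynomial in
lemma hom_bd {p : MvPolynomial (Fin d) ℝ} {m : ℕ} (hp : p.IsHomogeneous m) :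
    ∃ C, 0 ≤ C ∧ ∀ ξ : E d, |eval ξ p| ≤ C * ‖ξ‖ ^ m := by
  refine ⟨∑ e ∈ p.support, |p.coeff e|, Finset.sum_nonneg fun _ _ => abs_nonneg _, fun ξ => ?_⟩
  rw [eval_eq', Finset.sum_mul]
  refine (Finset.abs_sum_le_sum_abs _ _).trans (Finset.sum_le_sum fun e he => ?_)
  rw [abs_mul, Finset.abs_prod]
  gcongr
  have : ∑ i, e i = m := by
    have := hp (mem_support_iff.1 he)
    rw [← this, Finsupp.weight_apply, Finsupp.sum_fintype _ _ (by simp)]; simp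
  rw [← this, ← Finset.prod_pow_eq_pow_sum]
  refine Finset.prod_le_prod (fun _ _ => abs_nonneg _) fun i _ => ?_
  rw [abs_pow]
  gcongr
  exact norm_le_pi_norm ξ i

lemma sq_pos {ξ : E d} (h : ξ ≠ 0) : 0 < sq ξ :=
  lt_of_lt_of_le (by have := norm_pos_iff.2 h; positivity) (sq_ge ξ)

lemma sq_hfd' (ξ : E d) : HasFDerivAt (sq : E d → ℝ) (rg fun k => 2 * ξ k) ξ := by
  refine (sq_hfd ξ).congr_fderiv ?_
  ext w; simp [rg_apply]

open MvPolynomial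

noncomputable def hq (p : MvPolynomial (Fin d) ℝ) (a : ℕ) (ξ : E d) : ℝ := eval ξ p / sq ξ ^ a

lemma hq_bd {p : MvPolynomial (Fin d) ℝ} {m a n : ℕ} (hp : p.IsHomogeneous m) (hm : 2 * a + n = m) :
    ∃ C, 0 ≤ C ∧ ∀ ξ : E d, |hq p a ξ| ≤ C * ‖ξ‖ ^ n := by
  obtain ⟨C, hC, h⟩ := hom_bd hp
  refine ⟨C + |hq p a 0|, by positivity, fun ξ => ?_⟩
  by_cases h0 : ξ = 0
  · subst h0
    rcases Nat.eq_zero_or_pos n with rfl | hn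
    · simp [hC]
    · have : eval (0 : E d) p = 0 := by
        have := h 0
        rw [norm_zero, zero_pow (by omega), mul_zero] at this
        exact abs_nonpos_iff.1 this
      have hz : hq p a (0 : E d) = 0 := by rw [hq, this, zero_div]
      rw [hz]; simp [hn.ne']
  · have h1 := sq_pos h0
    have h2 := sq_ge ξ
    rw [hq, abs_div, abs_of_pos (pow_pos h1 a), div_le_iff₀ (pow_pos h1 a)]
    calc _ ≤ C * ‖ξ‖ ^ m := h ξ
      _ = C * ‖ξ‖ ^ n * (‖ξ‖ ^ 2) ^ a := by rw [← hm]; ring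
      _ ≤ (C + |hq p a 0|) * ‖ξ‖ ^ n * sq ξ ^ a := by
        gcongr; linarith [abs_nonneg (hq p a 0)]

lemma hfd_mul {f g : E d → ℝ} {c e : Fin d → ℝ} {x : E d} (h : HasFDerivAt f (rg c) x) (h' : HasFDerivAt g (rg e) x) :
    HasFDerivAt (fun x => f x * g x) (rg fun k => c k * g x + f x * e k) x := by
  refine (h.mul h').congr_fderiv ?_
  ext w
  simp only [rg_apply, ContinuousLinearMap.add_apply, ContinuousLinearMap.smul_apply, smul_eq_mul,
    Finset.mul_sum, ← Finset.sum_add_distrib]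
  exact Finset.sum_congr rfl fun k _ => by ring

lemma hfd_comp {φ : ℝ → ℝ} {φ' : ℝ} {f : E d → ℝ} {c : Fin d → ℝ} {x : E d} (h' : HasDerivAt φ φ' (f x)) (h : HasFDerivAt f (rg c) x) :
    HasFDerivAt (fun x => φ (f x)) (rg fun k => φ' * c k) x := by
  refine (h'.comp_hasFDerivAt x h).congr_fderiv ?_
  ext w
  simp only [rg_apply, ContinuousLinearMap.smul_apply, smul_eq_mul, Finset.mul_sum]
  exact Finset.sum_congr rfl fun k _ => by ring

lemma hd_inv (a : ℕ) {y : ℝ} (hy : y ≠ 0) : HasDerivAt (fun y : ℝ => (y ^ a)⁻¹) (-a / y ^ (a+1)) y := by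
  have := hasDerivAt_zpow (-a : ℤ) y (Or.inl hy)
  simp only [zpow_neg, zpow_natCast] at this
  refine this.congr_deriv ?_
  rw [show (-a - 1 : ℤ) = -((a+1 : ℕ) : ℤ) by push_cast; ring, zpow_neg, zpow_natCast]
  push_cast; ring

lemma hq_hfd {p : MvPolynomial (Fin d) ℝ} {a : ℕ} {ξ : E d} (h0 : ξ ≠ 0) :
    HasFDerivAt (hq p a) (rg fun k => hq (pderiv k p) a ξ - 2 * a * hq (X k * p) (a+1) ξ) ξ := by
  have h1 := (sq_pos h0).ne'
  have := hfd_mul (pfd p ξ) (hfd_comp (hd_inv a h1) (sq_hfd' ξ))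
  unfold hq
  simp only [div_eq_mul_inv]
  refine this.congr_fderiv ?_
  congr 1; funext k
  simp only [map_mul, eval_X]
  ring

lemma hq_hfd0 {p : MvPolynomial (Fin d) ℝ} {m a : ℕ} (hp : p.IsHomogeneous m) (hm : 2 * a + 2 ≤ m) :
    HasFDerivAt (hq p a) (0 : E d →L[ℝ] ℝ) 0 := by
  obtain ⟨n, rfl⟩ : ∃ n, m = 2 * a + n := ⟨m - 2 * a, by omega⟩
  obtain ⟨C, hC, h⟩ := hq_bd hp rfl
  refine Asymptotics.IsBigO.hasFDerivAt (n := n) ?_ (by omega)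
  refine Asymptotics.IsBigO.of_bound C (.of_forall fun ξ => ?_)
  simpa using h ξ

lemma hq_zero {p : MvPolynomial (Fin d) ℝ} {m a : ℕ} (hp : p.IsHomogeneous m) (hm : 2 * a + 1 ≤ m) : hq p a (0 : E d) = 0 := by
  obtain ⟨n, rfl⟩ : ∃ n, m = 2 * a + n := ⟨m - 2 * a, by omega⟩
  obtain ⟨C, hC, h⟩ := hq_bd hp rfl
  have := h 0
  rw [norm_zero, zero_pow (by omega), mul_zero] at this
  exact abs_nonpos_iff.1 this

lemma hq_PB {p : MvPolynomial (Fin d) ℝ} {m a : ℕ} (hp : p.IsHomogeneous m) (hm : 2 * a + 1 ≤ m) :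
    PB (fun _ ξ => (hq p a ξ : ℂ) : Fn d) := by
  obtain ⟨n, rfl⟩ : ∃ n, m = 2 * a + n := ⟨m - 2 * a, by omega⟩
  obtain ⟨C, hC, h⟩ := hq_bd hp rfl
  refine ⟨?_, n, C, fun t ξ => ?_⟩
  · have : Continuous (hq p a : E d → ℝ) := by
      rw [continuous_iff_continuousAt]
      intro ξ
      by_cases h0 : ξ = 0
      · subst h0
        rw [ContinuousAt, hq_zero hp hm]
        refine squeeze_zero_norm h ?_
        have : Continuous fun ξ : E d => C * ‖ξ‖ ^ n := by fun_prop
        have := this.tendsto 0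
        rwa [norm_zero, zero_pow (by omega), mul_zero] at this
      · exact (hq_hfd h0).continuousAt
    unfold JC; fun_prop
  · rw [Complex.norm_real]
    refine (h ξ).trans ?_
    gcongr; linarith

lemma hq_Cl : ∀ (n : ℕ) {p : MvPolynomial (Fin d) ℝ} {m a : ℕ} (_ : p.IsHomogeneous m) (_ : 2 * a + n + 1 ≤ m),
    Cl PB n (fun _ ξ => (hq p a ξ : ℂ) : Fn d)
  | 0, p, m, a, hp, hm => hq_PB hp hm
  | n+1, p, m, a, hp, hm => by
    refine ⟨hq_PB hp (by omega), ⟨fun _ _ => 0, fun _ _ => hasDerivAt_const _ _, ClPB_const n 0⟩,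
      fun k _ ξ => ((hq (pderiv k p) a ξ - 2 * a * hq (X k * p) (a+1) ξ : ℝ) : ℂ), fun t ξ => ?_, fun k => ?_⟩
    · apply hfd_ofReal
      by_cases h0 : ξ = 0
      · subst h0
        refine (hq_hfd0 hp (by omega)).congr_fderiv ?_
        ext w
        rw [rg_apply, Finset.sum_eq_zero]
        · simp
        · intro k _
          rw [hq_zero (hp.pderiv) (by omega), hq_zero ((isHomogeneous_X ℝ k).mul hp) (by omega)]; simp
      · exact hq_hfd h0
    · have h1 := hq_Cl n (hp.pderiv (i := k)) (a := a) (by omega)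
      have h2 := ClPB_mul (ClPB_const n (-(2 * a : ℂ))) (hq_Cl n ((isHomogeneous_X ℝ k).mul hp) (a := a + 1) (by omega))
      have := ClPB_add h1 h2
      convert this using 3
      push_cast; ring

lemma U_one_mul {m : E d → ℂ} {f : Fn d} : U m f = U (fun _ => 1) (fun t ξ => m ξ * f t ξ) := by
  funext t x; simp [U]

lemma eucNorm_sq (x : E d) : eucNorm x ^ 2 = sq x := by
  rw [eucNorm, Real.sq_sqrt (Finset.sum_nonneg fun _ _ => sq_nonneg _)]; rfl
lemma eucNorm_nn (x : E d) : 0 ≤ eucNorm x := Real.sqrt_nonneg _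
lemma eucNorm_le (x : E d) : eucNorm x ≤ ∑ j, |x j| := by
  rw [eucNorm, Real.sqrt_le_left (Finset.sum_nonneg fun _ _ => abs_nonneg _)]
  calc ∑ i, x i ^ 2 = ∑ i, |x i| ^ 2 := by simp
    _ ≤ _ := Finset.sum_sq_le_sq_sum_of_nonneg fun i _ => abs_nonneg _
lemma abs_le_eucNorm (x : E d) (j : Fin d) : |x j| ≤ eucNorm x := by
  rw [eucNorm]
  apply Real.abs_le_sqrt
  exact Finset.single_le_sum (f := fun i => x i ^ 2) (fun _ _ => sq_nonneg _) (Finset.mem_univ j)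

lemma U_decay : ∀ (n : ℕ) {g : Fn d}, Cl RD n g → ∃ C, ∀ t x, eucNorm x ^ n * ‖U (fun _ => 1) g t x‖ ≤ C
  | 0, g, h => by
    obtain ⟨K, hK⟩ := U_le PM_one h
    exact ⟨K, fun t x => by simpa using hK t x⟩
  | n+1, g, ⟨h0, _, gx, h3, h4⟩ => by
    choose C hC using fun k => U_decay n (h4 k)
    refine ⟨∑ k, C k, fun t x => ?_⟩
    calc _ ≤ eucNorm x ^ n * ((∑ j, |x j|) * ‖U (fun _ => 1) g t x‖) := by
          rw [pow_succ, mul_assoc]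
          have := eucNorm_nn x
          gcongr
          exact eucNorm_le x
      _ = ∑ j, eucNorm x ^ n * ‖(x j : ℂ) * U (fun _ => 1) g t x‖ := by
          rw [Finset.sum_mul, Finset.mul_sum]; simp
      _ = ∑ j, eucNorm x ^ n * ‖U (fun _ => 1) (gx j) t x‖ := by
          refine Finset.sum_congr rfl fun j _ => ?_
          rw [U_ibp h0 h3 (fun k => (h4 k).base)]; simp
      _ ≤ _ := Finset.sum_le_sum fun k _ => hC k t x

def DB (n : ℤ) (F : Fn d) : Prop := ∃ C, ∀ t x, 1 < eucNorm x → ‖F t x‖ ≤ C * eucNorm x ^ n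
def HE (F : Fn d) (Fx : Fin d → Fn d) : Prop :=
  ∀ t x, 1 < eucNorm x → HasFDerivAt (F t) (gr fun k => Fx k t x) x
def Dc : ℕ → ℤ → Fn d → Prop
  | 0, n, F => DB n F
  | r+1, n, F => DB n F ∧ ∃ Fx, HE F Fx ∧ ∀ k, Dc r (n-1) (Fx k)

lemma eucNorm_cont : Continuous (eucNorm : E d → ℝ) := by unfold eucNorm; fun_prop
lemma reg_open : IsOpen {x : E d | 1 < eucNorm x} := isOpen_lt continuous_const eucNorm_cont

lemma Dc.pred : ∀ {r n} {F : Fn d}, Dc (r+1) n F → Dc r n F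
  | 0, _, _, h => h.1
  | r+1, _, _, ⟨h0, fx, h3, h4⟩ => ⟨h0, fx, h3, fun k => Dc.pred (h4 k)⟩

lemma DB.mono {n n' : ℤ} (h : n ≤ n') {F : Fn d} (hF : DB n F) : DB n' F := by
  obtain ⟨C, hC⟩ := hF
  refine ⟨|C|, fun t x hx => (hC t x hx).trans ?_⟩
  have := eucNorm_nn x
  calc _ ≤ |C| * eucNorm x ^ n := by gcongr; exact le_abs_self _
    _ ≤ _ := by gcongr; exact hx.le

lemma Dc.mono : ∀ {r} {n n' : ℤ} (_ : n ≤ n') {F : Fn d}, Dc r n F → Dc r n' F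
  | 0, _, _, h, _, hF => DB.mono h hF
  | r+1, _, _, h, _, ⟨h0, fx, h3, h4⟩ => ⟨h0.mono h, fx, h3, fun k => Dc.mono (by omega) (h4 k)⟩

lemma Dc.congr : ∀ {r} {n : ℤ} {F G : Fn d}, Dc r n F → (∀ t x, 1 < eucNorm x → F t x = G t x) → Dc r n G
  | 0, _, F, G, ⟨C, hC⟩, h => ⟨C, fun t x hx => by rw [← h t x hx]; exact hC t x hx⟩
  | r+1, _, F, G, ⟨⟨C, hC⟩, fx, h3, h4⟩, h => ⟨⟨C, fun t x hx => by rw [← h t x hx]; exact hC t x hx⟩, fx,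
      fun t x hx => (h3 t x hx).congr_of_eventuallyEq
        (Filter.eventuallyEq_of_mem (reg_open.mem_nhds hx) fun y hy => (h t y hy).symm), h4⟩

lemma DB.add {n : ℤ} {F G : Fn d} (hF : DB n F) (hG : DB n G) : DB n (fun t x => F t x + G t x) := by
  obtain ⟨C, hC⟩ := hF
  obtain ⟨D, hD⟩ := hG
  exact ⟨C + D, fun t x hx => (norm_add_le _ _).trans (by rw [add_mul]; exact add_le_add (hC t x hx) (hD t x hx))⟩

lemma Dc.add : ∀ {r} {n : ℤ} {F G : Fn d}, Dc r n F → Dc r n G → Dc r n (fun t x => F t x + G t x)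
  | 0, _, _, _, hF, hG => DB.add hF hG
  | r+1, _, _, _, ⟨h0, fx, h3, h4⟩, ⟨k0, gx, k3, k4⟩ =>
    ⟨h0.add k0, fun k t x => fx k t x + gx k t x, fun t x hx => by
      have := (h3 t x hx).add (k3 t x hx)
      rw [← gr_add] at this; exact this, fun k => Dc.add (h4 k) (k4 k)⟩

lemma DB.mul {n m : ℤ} {F G : Fn d} (hF : DB n F) (hG : DB m G) : DB (n+m) (fun t x => F t x * G t x) := by
  obtain ⟨C, hC⟩ := hF
  obtain ⟨D, hD⟩ := hG
  refine ⟨C * D, fun t x hx => ?_⟩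
  rw [norm_mul, zpow_add₀ (by linarith : eucNorm x ≠ 0)]
  calc _ ≤ (C * eucNorm x ^ n) * (D * eucNorm x ^ m) :=
        mul_le_mul (hC t x hx) (hD t x hx) (norm_nonneg _) ((norm_nonneg _).trans (hC t x hx))
    _ = _ := by ring

lemma Dc.mul : ∀ {r} {n m : ℤ} {F G : Fn d}, Dc r n F → Dc r m G → Dc r (n+m) (fun t x => F t x * G t x)
  | 0, _, _, _, _, hF, hG => DB.mul hF hG
  | r+1, n, m, f, g, ⟨h0, fx, h3, h4⟩, ⟨k0, gx, k3, k4⟩ => by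
    have cf : Dc r n f := Dc.pred ⟨h0, fx, h3, h4⟩
    have cg : Dc r m g := Dc.pred ⟨k0, gx, k3, k4⟩
    refine ⟨h0.mul k0, fun k t x => fx k t x * g t x + f t x * gx k t x, fun t x hx => ?_, fun k => ?_⟩
    · refine ((h3 t x hx).mul (k3 t x hx)).congr_fderiv ?_
      ext w
      simp only [ContinuousLinearMap.add_apply, ContinuousLinearMap.smul_apply, gr_apply,
        smul_eq_mul, Finset.mul_sum,
        Finset.sum_mul, ← Finset.sum_add_distrib]
      refine Finset.sum_congr rfl fun k _ => ?_
      ring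
    · have h1 := Dc.mul (h4 k) cg
      have h2 := Dc.mul cf (k4 k)
      rw [show n - 1 + m = n + m - 1 by ring] at h1
      rw [show n + (m - 1) = n + m - 1 by ring] at h2
      exact h1.add h2

lemma DB_zero (n : ℤ) : DB n (fun _ _ => 0 : Fn d) := ⟨0, fun t x _ => by simp⟩
lemma gr_zero : gr (fun _ : Fin d => (0:ℂ)) = 0 := by ext w; simp [gr_apply]

lemma Dc_time (c : ℝ → ℂ) {K : ℝ} (hc : ∀ t, ‖c t‖ ≤ K) : ∀ (r : ℕ), Dc r 0 (fun t _ => c t : Fn d)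
  | 0 => ⟨K, fun t x _ => by simpa using hc t⟩
  | r+1 => ⟨⟨K, fun t x _ => by simpa using hc t⟩, fun _ _ _ => 0, fun t x _ => by
      rw [gr_zero]; exact hasFDerivAt_const _ _, fun k => Dc.mono (n := 0 - 1) (by simp) (Dc_zero r _)⟩
where
  Dc_zero : ∀ (r : ℕ) (n : ℤ), Dc r n (fun _ _ => 0 : Fn d)
  | 0, n => DB_zero n
  | r+1, n => ⟨DB_zero n, fun _ _ _ => 0, fun t x _ => by
      rw [gr_zero]; exact hasFDerivAt_const _ _, fun _ => Dc_zero r _⟩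

lemma Dc_zero (r : ℕ) (n : ℤ) : Dc r n (fun _ _ => 0 : Fn d) := Dc_time.Dc_zero r n
lemma Dc_const (c : ℂ) (r : ℕ) : Dc r 0 (fun _ _ => c : Fn d) := Dc_time (fun _ => c) (fun _ => le_rfl) r

lemma Dc.cmul (c : ℂ) {r} {n : ℤ} {F : Fn d} (h : Dc r n F) : Dc r n (fun t x => c * F t x) := by
  have := (Dc_const c r).mul h
  rwa [zero_add] at this

lemma Dc_sum {r} {n : ℤ} {ι : Type*} (s : Finset ι) {F : ι → Fn d} (h : ∀ i ∈ s, Dc r n (F i)) :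
    Dc r n (fun t x => ∑ i ∈ s, F i t x) := by
  classical
  induction s using Finset.induction_on with
  | empty => simpa using Dc_zero r n
  | insert a s ha ih =>
    simp only [Finset.sum_insert ha]
    exact (h a (by simp)).add (ih fun i hi => h i (by simp [hi]))

lemma Dc_coord (j : Fin d) : ∀ (r : ℕ), Dc r 1 (fun _ x => (x j : ℂ) : Fn d)
  | 0 => hb
  | r+1 => ⟨hb, fun k _ _ => if k = j then 1 else 0, fun t x _ => by
      refine ((Complex.ofRealCLM.comp (pj j)).hasFDerivAt).congr_fderiv ?_
      ext w; simp [gr_apply], fun k => by simpa using Dc_const (if k = j then 1 else 0) r⟩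
where hb : DB 1 (fun _ x => (x j : ℂ) : Fn d) := ⟨1, fun t x _ => by
  simpa using abs_le_eucNorm x j⟩

lemma eucNorm_hfd {x : E d} (hx : 0 < eucNorm x) (n : ℤ) :
    HasFDerivAt (fun x : E d => eucNorm x ^ n) (rg fun k => n * (x k * eucNorm x ^ (n - 2))) x := by
  have h1 : 0 < sq x := by rw [← eucNorm_sq]; positivity
  have h2 := hfd_comp (Real.hasDerivAt_sqrt h1.ne') (sq_hfd' x)
  have h3 := hfd_comp (f := fun x : E d => Real.sqrt (sq x)) (hasDerivAt_zpow n (eucNorm x) (Or.inl hx.ne')) h2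
  refine h3.congr_fderiv ?_
  congr 1; funext k
  change _ * (1 / (2 * eucNorm x) * _) = _
  rw [show n - 2 = n - 1 - 1 by ring, zpow_sub_one₀ hx.ne' (n-1)]
  field_simp

lemma Dc_zpow : ∀ (r : ℕ) (n : ℤ), Dc r n (fun _ x => ((eucNorm x ^ n : ℝ) : ℂ) : Fn d)
  | 0, n => hb n
  | r+1, n => ⟨hb n, fun k _ x => (n : ℂ) * ((x k : ℂ) * ((eucNorm x ^ (n-2) : ℝ) : ℂ)), fun t x hx => by
      have := hfd_ofReal (eucNorm_hfd (by linarith : 0 < eucNorm x) n)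
      simpa using this, fun k => by
      have := ((Dc_coord k r).mul (Dc_zpow r (n-2))).cmul (n : ℂ)
      rwa [show 1 + (n - 2) = n - 1 by ring] at this⟩
where hb (n : ℤ) : DB n (fun _ x => ((eucNorm x ^ n : ℝ) : ℂ) : Fn d) := ⟨1, fun t x hx => by
  have : 0 ≤ eucNorm x := eucNorm_nn x
  rw [Complex.norm_real, Real.norm_eq_abs, abs_of_nonneg (by positivity), one_mul]⟩

lemma Dc_poly : ∀ (r : ℕ) {p : MvPolynomial (Fin d) ℝ} {m : ℕ} (_ : p.IsHomogeneous m),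
    Dc r m (fun _ x => (eval x p : ℂ) : Fn d)
  | 0, p, m, hp => hb hp
  | r+1, p, m, hp => ⟨hb hp, fun k _ x => (eval x (pderiv k p) : ℂ), fun t x _ => hfd_ofReal (pfd p x), fun k => by
      have := Dc_poly r (hp.pderiv (i := k))
      rcases m with _ | m
      · rw [← totalDegree_zero_iff_isHomogeneous, totalDegree_eq_zero_iff_eq_C] at hp
        rw [hp]; simpa using Dc_zero r _
      · simpa using this⟩
where
  hb {p : MvPolynomial (Fin d) ℝ} {m : ℕ} (hp : p.IsHomogeneous m) : DB m (fun _ x => (eval x p : ℂ) : Fn d) := by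
    obtain ⟨C, h0, hC⟩ := hom_bd hp
    refine ⟨C, fun t x _ => ?_⟩
    rw [Complex.norm_real, zpow_natCast]
    refine (hC x).trans ?_
    gcongr
    exact (pi_norm_le_iff_of_nonneg (eucNorm_nn x)).2 fun j => abs_le_eucNorm x j

lemma Dc_of_HX {F : Fn d} {Fx : Fin d → Fn d} {r} {n : ℤ} (h0 : DB n F) (h : HX F Fx) (h' : ∀ k, Dc r (n-1) (Fx k)) : Dc (r+1) n F :=
  ⟨h0, Fx, fun t x _ => h t x, h'⟩

lemma Dc.deriv {r} {n : ℤ} {F : Fn d} {Fx : Fin d → Fn d} (h : Dc (r+1) n F) (hF : HE F Fx) (k : Fin d) : Dc r (n-1) (Fx k) := by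
  obtain ⟨_, Gx, h1, h2⟩ := h
  refine (h2 k).congr fun t x hx => ?_
  have := (h1 t x hx).unique (hF t x hx)
  rw [← gr_single (fun k => Gx k t x) k, this, gr_single]

noncomputable def ml (l : List (Fin d)) (ξ : E d) : ℂ := (hq ((l.map X).prod) 1 ξ : ℂ)

lemma ml_hom (l : List (Fin d)) : ((l.map X).prod : MvPolynomial (Fin d) ℝ).IsHomogeneous l.length := by
  induction l with
  | nil => simpa using isHomogeneous_one (Fin d) ℝ
  | cons k l ih => simp only [List.map_cons, List.prod_cons, List.length_cons]; rw [add_comm]; exact (isHomogeneous_X ℝ k).mul ih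

lemma ml_cons (k : Fin d) (l : List (Fin d)) (ξ : E d) : ml (k :: l) ξ = (ξ k : ℂ) * ml l ξ := by
  simp [ml, hq, mul_div_assoc]

lemma ml_PM {l : List (Fin d)} (h : 2 ≤ l.length) : PM (ml l) := by
  obtain ⟨C, hC, hb⟩ := hq_bd (ml_hom l) (n := l.length - 2) (a := 1) (by omega)
  refine ⟨?_, l.length - 2, C, fun ξ => ?_⟩
  · refine Complex.measurable_ofReal.comp ?_
    unfold hq
    have h2 := sq_cont (d := d)
    have h3 : Continuous fun ξ : E d => eval ξ (l.map X).prod := MvPolynomial.continuous_eval _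
    exact h3.measurable.div (by fun_prop)
  · unfold ml; rw [Complex.norm_real]
    refine (hb ξ).trans ?_
    gcongr; linarith

lemma U_ml_ix (k : Fin d) (l : List (Fin d)) (f : Fn d) (t x) : U (ml l) (ix k f) t x = Complex.I * U (ml (k :: l)) f t x := by
  unfold U
  rw [← integral_const_mul]
  congr 1; funext ξ
  rw [ml_cons, ix]; ring

lemma U_ml_Dc {f : Fn d} (hf : ∀ r, Cl RD r f) : ∀ (r : ℕ) {l : List (Fin d)} {n : ℕ} (_ : l.length = n + 3),
    Dc r (-n) (U (ml l) f)
  | 0, l, n, h => hb h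
  | r+1, l, n, h => Dc_of_HX (hb h) (U_HX (ml_PM (by omega)) (hf 0)) fun k => by
      have := (U_ml_Dc hf r (l := k :: l) (n := n + 1) (by simp; omega)).cmul Complex.I
      rw [show -(n:ℤ) - 1 = -((n+1 : ℕ) : ℤ) by push_cast; ring]
      refine this.congr fun t x _ => ?_
      rw [U_ml_ix]
where
  hb {l : List (Fin d)} {n : ℕ} (h : l.length = n + 3) : DB (-n) (U (ml l) f) := by
    have h1 : Cl RD n (fun t ξ => ml l ξ * f t ξ) := ClPB_mulRD (hq_Cl n (ml_hom l) (a := 1) (by omega)) (hf n)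
    obtain ⟨C, hC⟩ := U_decay n h1
    refine ⟨C, fun t x hx => ?_⟩
    have h0 : 0 < eucNorm x := by linarith
    rw [U_one_mul, zpow_neg, zpow_natCast, ← div_eq_mul_inv, le_div_iff₀ (by positivity), mul_comm]
    exact hC t x

lemma U_one_Dc : ∀ (r : ℕ) (n : ℕ) {f : Fn d} (_ : ∀ r, Cl RD r f), Dc r (-n) (U (fun _ => 1) f)
  | 0, n, f, h => hb n h
  | r+1, n, f, h => Dc_of_HX (hb n h) (U_HX PM_one (h 0)) fun k => by
      have := U_one_Dc r (n+1) (f := ix k f) (fun r => ix_Cl k (h r))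
      rwa [show -(n:ℤ) - 1 = -((n+1 : ℕ) : ℤ) by push_cast; ring]
where
  hb (n : ℕ) {f : Fn d} (h : ∀ r, Cl RD r f) : DB (-n) (U (fun _ => 1) f) := by
    obtain ⟨C, hC⟩ := U_decay n (h n)
    refine ⟨C, fun t x hx => ?_⟩
    have h0 : 0 < eucNorm x := by linarith
    rw [zpow_neg, zpow_natCast, ← div_eq_mul_inv, le_div_iff₀ (by positivity), mul_comm]
    exact hC t x

noncomputable def tau (a r : ℝ) : ℝ := ∫ σ in Set.Ioi (1:ℝ), σ ^ a * Real.exp (-r * σ)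

lemma tau_int0 {a r : ℝ} (ha : 0 ≤ a) (hr : 0 < r) : IntegrableOn (fun σ : ℝ => σ ^ a * Real.exp (-r * σ)) (Set.Ioi 0) := by
  simpa using integrableOn_rpow_mul_exp_neg_mul_rpow (p := 1) (s := a) (b := r) (by linarith) one_pos hr

lemma tau_int {a r : ℝ} (ha : 0 ≤ a) (hr : 0 < r) : IntegrableOn (fun σ : ℝ => σ ^ a * Real.exp (-r * σ)) (Set.Ioi 1) :=
  (tau_int0 ha hr).mono_set (Set.Ioi_subset_Ioi zero_le_one)

lemma tau_hd {a r : ℝ} (ha : 0 ≤ a) (hr : 0 < r) : HasDerivAt (tau a) (-tau (a+1) r) r := by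
  have key := (hasDerivAt_integral_of_dominated_loc_of_deriv_le (μ := volume.restrict (Set.Ioi (1:ℝ)))
    (F := fun r σ => σ ^ a * Real.exp (-r * σ)) (F' := fun r σ => -(σ ^ (a+1) * Real.exp (-r * σ)))
    (x₀ := r) (s := Set.Ioi (r/2)) (bound := fun σ => σ ^ (a+1) * Real.exp (-(r/2) * σ)) (Ioi_mem_nhds (by linarith))
    ?_ (tau_int ha hr) (tau_int (by linarith) hr).neg.aestronglyMeasurable
    ?_ (tau_int (by linarith) (by linarith)) ?_).2
  · rw [integral_neg] at key; exact key
  · filter_upwards [Ioi_mem_nhds hr] with s hs using (tau_int ha hs).aestronglyMeasurable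
  · refine ae_restrict_of_forall_mem measurableSet_Ioi fun σ hσ s hs => ?_
    have h0 : (0:ℝ) < σ := lt_trans one_pos hσ
    have h1 := Real.rpow_pos_of_pos h0 (a+1)
    rw [norm_neg, Real.norm_eq_abs, abs_of_nonneg (by positivity)]
    have : r / 2 < s := hs
    gcongr
  · refine ae_restrict_of_forall_mem measurableSet_Ioi fun σ hσ s hs => ?_
    have h0 : (0:ℝ) < σ := lt_trans one_pos hσ
    have h1 : HasDerivAt (fun s : ℝ => Real.exp (-s * σ)) (Real.exp (-s * σ) * (-1 * σ)) s :=
      (((hasDerivAt_id s).neg).mul_const σ).exp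
    refine (h1.const_mul (σ ^ a)).congr_deriv ?_
    rw [Real.rpow_add_one h0.ne']; ring

lemma tau_le {a : ℝ} (ha : 0 ≤ a) {r : ℝ} (hr : 1/4 ≤ r) : |tau a r| ≤ tau a (1/8) * Real.exp (-(r/2)) := by
  have h0 : 0 ≤ tau a r := setIntegral_nonneg measurableSet_Ioi fun σ hσ => by
    have h0 : (0:ℝ) < σ := lt_trans one_pos hσ
    positivity
  rw [abs_of_nonneg h0, tau, tau, ← integral_mul_const]
  refine setIntegral_mono_on (tau_int ha (by linarith)) ((tau_int ha (by norm_num)).mul_const _) measurableSet_Ioi fun σ hσ => ?_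
  have h0 : (1:ℝ) < σ := hσ
  have h1 := Real.rpow_pos_of_pos (by linarith : 0 < σ) a
  rw [mul_assoc, ← Real.exp_add]
  gcongr
  nlinarith

lemma exp_zpow (n : ℕ) {y : ℝ} (hy : 1 < y) : Real.exp (-(y ^ 2 / 4 / 2)) ≤ (n.factorial * 8 ^ n) * y ^ (-(n:ℤ)) := by
  have h0 : 0 < y := by linarith
  have h1 := Real.pow_div_factorial_le_exp (x := y ^ 2 / 4 / 2) (by positivity) n
  rw [Real.exp_neg, zpow_neg, zpow_natCast, ← div_eq_mul_inv, inv_eq_one_div, div_le_div_iff₀ (Real.exp_pos _) (by positivity)]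
  have h2 : 0 < (n.factorial : ℝ) := by positivity
  rw [div_le_iff₀ h2] at h1
  calc 1 * y ^ n ≤ (y ^ 2) ^ n := by rw [one_mul]; gcongr; nlinarith
    _ = 8 ^ n * (y ^ 2 / 4 / 2) ^ n := by rw [← mul_pow]; ring
    _ ≤ 8 ^ n * (Real.exp (y ^ 2 / 4 / 2) * n.factorial) := by gcongr
    _ = _ := by ring

lemma Dc_tau : ∀ (r : ℕ) {a : ℝ} (_ : 0 ≤ a) (n : ℕ), Dc r (-n) (fun _ x => (tau a (sq x / 4) : ℂ) : Fn d)
  | 0, a, ha, n => hb ha n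
  | r+1, a, ha, n => ⟨hb ha n, fun k _ x => (-(1/2) : ℂ) * ((x k : ℂ) * (tau (a+1) (sq x / 4) : ℂ)), fun t x hx => by
      have h1 : 0 < sq x := by rw [← eucNorm_sq]; positivity
      have h2 : HasFDerivAt (fun x : E d => sq x / 4) (rg fun k => 1/4 * (2 * x k)) x :=
        hfd_comp (φ := fun y => y / 4) ((hasDerivAt_id _).div_const 4) (sq_hfd' x)
      have := hfd_ofReal (hfd_comp (f := fun x : E d => sq x / 4) (tau_hd ha (by positivity)) h2)
      refine this.congr_fderiv ?_
      congr 1; funext k; push_cast; ring, fun k => by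
      have := ((Dc_coord k r).mul (Dc_tau r (a := a+1) (by linarith) (n+2))).cmul (-(1/2))
      rwa [show 1 + -((n+2 : ℕ) : ℤ) = -n - 1 by push_cast; ring] at this⟩
where
  hb {a : ℝ} (ha : 0 ≤ a) (n : ℕ) : DB (-n) (fun _ x => (tau a (sq x / 4) : ℂ) : Fn d) := by
    refine ⟨tau a (1/8) * (n.factorial * 8 ^ n), fun t x hx => ?_⟩
    have h1 : 1 < eucNorm x ^ 2 := one_lt_pow₀ hx (by norm_num)
    have h2 := exp_zpow n hx
    have h3 : 0 ≤ tau a (1/8) := setIntegral_nonneg measurableSet_Ioi fun σ hσ => by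
      have h0 : (0:ℝ) < σ := lt_trans one_pos hσ
      positivity
    rw [Complex.norm_real, ← eucNorm_sq]
    refine (tau_le ha (by linarith)).trans ?_
    rw [mul_assoc]
    gcongr

lemma U_ga {s : ℝ} (hs : 0 < s) (t) (x : E d) :
    U (fun _ => 1) (ga s) t x = (((Real.pi / s) ^ ((d:ℝ)/2) * Real.exp (-(sq x / (4 * s))) : ℝ) : ℂ) := by
  have := GaussianFourier.integral_cexp_neg_mul_sum_add (b := (s:ℂ)) (by simpa using hs) (fun i : Fin d => Complex.I * (x i : ℂ))
  unfold U ex dt ga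
  rw [Fintype.card_fin] at this
  rw [Complex.ofReal_mul, Complex.ofReal_cpow (by positivity)]
  have e2 : ((Real.exp (-(sq x / (4 * s))) : ℝ) : ℂ) = Complex.exp ((∑ i, (Complex.I * (x i : ℂ)) ^ 2) / (4 * s)) := by
    rw [Complex.ofReal_exp]
    congr 1
    simp only [mul_pow, Complex.I_sq, ← Finset.mul_sum, sq]
    push_cast; ring
  rw [e2]
  push_cast
  rw [← this]
  congr 1; funext ξ
  rw [one_mul, ← Complex.exp_add]
  congr 1
  simp only [sq]; push_cast
  rw [add_comm, Finset.sum_mul]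
  congr 1
  exact Finset.sum_congr rfl fun i _ => by ring

lemma U_cmul (m : E d → ℂ) (c : ℂ) (f : Fn d) (t x) : U m (fun t ξ => c * f t ξ) t x = c * U m f t x := by
  unfold U; rw [← integral_const_mul]; congr 1; funext ξ; ring

lemma U_add {m : E d → ℂ} (hm : PM m) {f g : Fn d} (hf : RD f) (hg : RD g) (t x) :
    U m (fun t ξ => f t ξ + g t ξ) t x = U m f t x + U m g t x := by
  unfold U; rw [← integral_add (U_int hm hf t x) (U_int hm hg t x)]; congr 1; funext ξ; ring

lemma U_ga1 {s : ℝ} (hs : 0 < s) (q : Fin d) (t) (x : E d) :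
    U (fun _ => 1) (fun t ξ => (ξ q : ℂ) * ga s t ξ) t x = Complex.I * ((x q / (2 * s) : ℝ) : ℂ) * U (fun _ => 1) (ga s) t x := by
  have h := U_ibp (ga_RD hs) (ga_HX s) (fun k => (ClRD_cmul _ (ClRD_coord k (ga_Cl hs 0)))) q t x
  rw [U_cmul] at h
  have hs' : (s : ℂ) ≠ 0 := by exact_mod_cast hs.ne'
  push_cast at h ⊢
  field_simp
  linear_combination (-Complex.I) * h + (2 * s * U (fun _ => 1) (fun t ξ => (ξ q : ℂ) * ga s t ξ) t x) * Complex.I_sq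

lemma U_ga2 {s : ℝ} (hs : 0 < s) (q j : Fin d) (t) (x : E d) :
    U (fun _ => 1) (fun t ξ => (ξ q : ℂ) * ((ξ j : ℂ) * ga s t ξ)) t x =
      (((if q = j then 1 else 0) - x q * x j / (2 * s)) / (2 * s) : ℝ) * U (fun _ => 1) (ga s) t x := by
  have hx : HX (fun t ξ => (ξ j : ℂ) * ga s t ξ : Fn d) (fun k t ξ => (if k = j then 1 else 0 : ℂ) * ga s t ξ + ((-2 * s : ℝ) : ℂ) * ((ξ k : ℂ) * ((ξ j : ℂ) * ga s t ξ))) := by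
    intro t ξ
    have h1 : HasFDerivAt (fun x : E d => (x j : ℂ)) (gr fun k => (if k = j then 1 else 0 : ℂ)) ξ := by
      refine ((Complex.ofRealCLM.comp (pj j)).hasFDerivAt).congr_fderiv ?_
      ext w; simp [gr_apply]
    refine (h1.mul (ga_HX s t ξ)).congr_fderiv ?_
    rw [gr_eq (gr fun k => _)]
    conv_lhs => rw [gr_eq (_ + _)]
    congr 1; funext k
    simp only [ContinuousLinearMap.add_apply, ContinuousLinearMap.smul_apply, gr_single, smul_eq_mul, MulOpposite.unop_op]
    ring
  have r1 := ClRD_coord j (ga_Cl (d := d) hs 0)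
  have r2 : ∀ k, Cl RD 0 (fun t ξ => ((-2 * s : ℝ) : ℂ) * ((ξ k : ℂ) * ((ξ j : ℂ) * ga s t ξ)) : Fn d) := fun k => ClRD_cmul _ (ClRD_coord k r1)
  have r3 : ∀ k, Cl RD 0 (fun t ξ => (if k = j then 1 else 0 : ℂ) * ga s t ξ : Fn d) := fun k => ClRD_cmul _ (ga_Cl hs 0)
  have h := U_ibp r1 hx (fun k => ClRD_add (r3 k) (r2 k)) q t x
  rw [U_add PM_one (r3 q) (r2 q), U_cmul, U_cmul, U_ga1 hs] at h
  have hs' : (s : ℂ) ≠ 0 := by exact_mod_cast hs.ne'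
  push_cast at h ⊢
  field_simp at h ⊢
  split_ifs at h ⊢
  · rw [Complex.ofReal_one]; linear_combination h
  · rw [Complex.ofReal_zero]; linear_combination h

lemma ml2 (q j : Fin d) (ξ : E d) : ml [q, j] ξ = ((ξ q * ξ j / sq ξ : ℝ) : ℂ) := by
  simp [ml, hq]

lemma ml2_PM (q j : Fin d) : PM (ml [q, j]) := ml_PM (by simp)

lemma ml2_hd (q j : Fin d) {s : ℝ} (hs : 0 < s) (x : E d) :
    HasDerivAt (fun s => U (ml [q, j]) (ga s) 0 x) (-U (fun _ => 1) (fun t ξ => (ξ q : ℂ) * ((ξ j : ℂ) * ga s t ξ)) 0 x) s := by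
  have hint : ∀ {s : ℝ}, 0 < s → Integrable (fun ξ : E d => ex x ξ * (1 * ((ξ q : ℂ) * ((ξ j : ℂ) * ga s 0 ξ)))) := fun hs =>
    U_int PM_one (ClRD_coord q (ClRD_coord j (ga_Cl hs 0))) 0 x
  have key := (hasDerivAt_integral_of_dominated_loc_of_deriv_le (μ := (volume : Measure (E d)))
    (F := fun s ξ => ex x ξ * (ml [q, j] ξ * ga s 0 ξ)) (F' := fun s ξ => -(ex x ξ * (1 * ((ξ q : ℂ) * ((ξ j : ℂ) * ga s 0 ξ)))))
    (x₀ := s) (s := Set.Ioi (s/2)) (bound := fun ξ => ‖ex x ξ * (1 * ((ξ q : ℂ) * ((ξ j : ℂ) * ga (s/2) 0 ξ)))‖) (Ioi_mem_nhds (by linarith))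
    ?_ (U_int (ml2_PM q j) (ga_RD hs) 0 x) (hint hs).neg.aestronglyMeasurable
    ?_ (hint (by linarith)).norm ?_).2
  · rw [integral_neg] at key; exact key
  · filter_upwards [Ioi_mem_nhds hs] with s hs using (U_int (ml2_PM q j) (ga_RD hs) 0 x).aestronglyMeasurable
  · refine Filter.Eventually.of_forall fun ξ s' hs' => ?_
    have : s / 2 < s' := hs'
    have h2 := sq_nn ξ
    rw [norm_neg]
    simp only [norm_mul, ex_norm, ga, Complex.norm_real, Real.norm_eq_abs, Real.abs_exp]
    gcongr
  · refine Filter.Eventually.of_forall fun ξ s' hs' => ?_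
    have h1 : HasDerivAt (fun s : ℝ => Real.exp (-s * sq ξ)) (Real.exp (-s' * sq ξ) * (-1 * sq ξ)) s' :=
      (((hasDerivAt_id s').neg).mul_const (sq ξ)).exp
    refine ((h1.ofReal_comp.const_mul (ml [q, j] ξ)).const_mul (ex x ξ)).congr_deriv ?_
    rw [ml2, ga]
    by_cases h0 : ξ = 0
    · subst h0; simp
    · have := sq_pos h0
      have h3 : (sq ξ : ℂ) ≠ 0 := by exact_mod_cast this.ne'
      push_cast
      field_simp

lemma ml2_lim (hd : 2 ≤ d) (q j : Fin d) (x : E d) :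
    Filter.Tendsto (fun σ : ℝ => U (ml [q, j]) (ga σ⁻¹) 0 x) (nhdsWithin 0 (Set.Ioi 0)) (nhds 0) := by
  haveI : Nonempty (Fin d) := ⟨⟨0, by omega⟩⟩
  have key := tendsto_integral_filter_of_dominated_convergence (μ := (volume : Measure (E d)))
    (l := nhdsWithin (0:ℝ) (Set.Ioi 0)) (F := fun σ ξ => ex x ξ * (ml [q, j] ξ * ga σ⁻¹ 0 ξ)) (f := fun _ => 0)
    (fun ξ => ‖ex x ξ * (ml [q, j] ξ * ga 1 0 ξ)‖) ?_ ?_ (U_int (ml2_PM q j) (ga_RD one_pos) 0 x).norm ?_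
  · simpa [U] using key
  · filter_upwards [self_mem_nhdsWithin] with s hs using (U_int (ml2_PM q j) (ga_RD (inv_pos.2 hs)) 0 x).aestronglyMeasurable
  · filter_upwards [Ioo_mem_nhdsGT (zero_lt_one' ℝ)] with s hs
    refine Filter.Eventually.of_forall fun ξ => ?_
    have h2 := sq_nn ξ
    have h3 : 1 ≤ s⁻¹ := (one_le_inv₀ hs.1).2 hs.2.le
    simp only [norm_mul, ex_norm, ga, Complex.norm_real, Real.norm_eq_abs, Real.abs_exp]
    gcongr
  · have h0 : ∀ᵐ ξ : E d, ξ ≠ 0 := by simp [ae_iff, measure_singleton]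
    filter_upwards [h0] with ξ hξ
    have h1 := sq_pos hξ
    have h2 : Filter.Tendsto (fun σ : ℝ => Real.exp (-σ⁻¹ * sq ξ)) (nhdsWithin 0 (Set.Ioi 0)) (nhds 0) := by
      refine Real.tendsto_exp_atBot.comp ?_
      simp only [neg_mul]
      exact Filter.tendsto_neg_atTop_atBot.comp (tendsto_inv_nhdsGT_zero.atTop_mul_const h1)
    have h3 := ((Complex.continuous_ofReal.tendsto 0).comp h2).const_mul (ml [q, j] ξ) |>.const_mul (ex x ξ)
    simpa [ga] using h3

noncomputable def kf (q j : Fin d) (x : E d) (σ : ℝ) : ℝ :=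
  Real.pi ^ ((d:ℝ)/2) / 2 * ((if q = j then 1 else 0) * (σ ^ ((d:ℝ)/2 - 1) * Real.exp (-(sq x / 4) * σ))
    - x q * x j / 2 * (σ ^ ((d:ℝ)/2) * Real.exp (-(sq x / 4) * σ)))

lemma half_nn (hd : 2 ≤ d) : (0:ℝ) ≤ (d:ℝ)/2 - 1 := by
  have : (2:ℝ) ≤ d := by exact_mod_cast hd
  linarith

lemma kf_int (hd : 2 ≤ d) (q j : Fin d) {x : E d} (hx : 0 < sq x) : IntegrableOn (kf q j x) (Set.Ioi 0) := by
  have := half_nn hd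
  have h1 := (tau_int0 this (by positivity : 0 < sq x / 4)).const_mul (if q = j then 1 else 0 : ℝ)
  have h2 := (tau_int0 (a := (d:ℝ)/2) (by positivity) (by positivity : 0 < sq x / 4)).const_mul (x q * x j / 2)
  exact (h1.sub h2).const_mul _

lemma base1 (hd : 2 ≤ d) (q j : Fin d) {x : E d} (hx : 0 < sq x) :
    U (ml [q, j]) (ga 1) 0 x = ((∫ σ in Set.Ioc (0:ℝ) 1, kf q j x σ : ℝ) : ℂ) := by
  have h2 : ∀ σ : ℝ, 0 < σ → HasDerivAt (fun σ : ℝ => U (ml [q, j]) (ga σ⁻¹) 0 x) ((kf q j x σ : ℝ) : ℂ) σ := fun σ hσ => by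
    have := HasDerivAt.scomp σ (ml2_hd q j (inv_pos.2 hσ) x) (hasDerivAt_inv hσ.ne')
    refine this.congr_deriv ?_
    rw [U_ga2 (inv_pos.2 hσ), U_ga (inv_pos.2 hσ), kf, div_inv_eq_mul, Real.mul_rpow Real.pi_pos.le hσ.le, Real.rpow_sub_one hσ.ne']
    rw [show sq x / (4 * σ⁻¹) = sq x / 4 * σ by field_simp, neg_mul, Complex.real_smul, ← Complex.ofReal_mul, ← Complex.ofReal_neg, ← Complex.ofReal_mul]
    congr 1
    field_simp
  have key := intervalIntegral.integral_eq_sub_of_hasDerivAt_of_tendsto (a := 0) (b := 1) one_pos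
    (fun σ hσ => h2 σ hσ.1) ?_ (ml2_lim hd q j x) ((h2 1 one_pos).continuousAt.tendsto.mono_left nhdsWithin_le_nhds)
  · rw [sub_zero, inv_one] at key
    rw [← key, intervalIntegral.integral_of_le zero_le_one, integral_complex_ofReal]
  · rw [intervalIntegrable_iff_integrableOn_Ioc_of_le zero_le_one]
    exact ((kf_int hd q j hx).mono_set Set.Ioc_subset_Ioi_self).ofReal

noncomputable def c0 (d : ℕ) : ℝ := Real.pi ^ ((d:ℝ)/2) / 2 * Real.Gamma ((d:ℝ)/2) * 2 ^ d

lemma rp (x : E d) (hx : 1 < eucNorm x) (n : ℕ) : (1 / (sq x / 4)) ^ ((n:ℝ)/2) = 2 ^ n * eucNorm x ^ (-(n:ℤ)) := by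
  have h0 : 0 < eucNorm x := by linarith
  have : 1 / (sq x / 4) = (2 / eucNorm x) ^ (2:ℝ) := by
    rw [← eucNorm_sq, Real.rpow_two]; field_simp; norm_num
  rw [this, ← Real.rpow_mul (by positivity), mul_div_cancel₀ _ (two_ne_zero), Real.rpow_natCast, div_pow, zpow_neg, zpow_natCast]
  rfl

lemma base2 (hd : 2 ≤ d) (q j : Fin d) {x : E d} (hx : 1 < eucNorm x) :
    ∫ σ in Set.Ioi (0:ℝ), kf q j x σ = c0 d * ((if q = j then 1 else 0) * eucNorm x ^ 2 - d * (x q * x j)) * eucNorm x ^ (-(d:ℤ) - 2) := by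
  have h0 : 0 < eucNorm x := by linarith
  have hs : 0 < sq x := by rw [← eucNorm_sq]; positivity
  have hn := half_nn hd
  have h1 := (tau_int0 hn (by positivity : 0 < sq x / 4)).const_mul (if q = j then 1 else 0 : ℝ)
  have h2 := (tau_int0 (a := (d:ℝ)/2) (by positivity) (by positivity : 0 < sq x / 4)).const_mul (x q * x j / 2)
  unfold kf
  rw [integral_const_mul, integral_sub h1 h2, integral_const_mul, integral_const_mul]
  have g1 := Real.integral_rpow_mul_exp_neg_mul_Ioi (a := (d:ℝ)/2) (r := sq x / 4) (by linarith) (by positivity)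
  have g2 := Real.integral_rpow_mul_exp_neg_mul_Ioi (a := (d:ℝ)/2 + 1) (r := sq x / 4) (by linarith) (by positivity)
  rw [add_sub_cancel_right] at g2
  simp only [neg_mul]
  rw [g1, g2, Real.Gamma_add_one (by linarith), rp x hx, show (d:ℝ)/2 + 1 = ((d + 2 : ℕ) : ℝ) / 2 by push_cast; ring, rp x hx, c0,
    show -((d + 2 : ℕ) : ℤ) = -(d:ℤ) - 2 by push_cast; ring, show -(d:ℤ) = (-(d:ℤ) - 2) + (2:ℕ) by push_cast; ring, zpow_add₀ h0.ne', zpow_natCast]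
  rw [show -(d:ℤ) - 2 + (2:ℕ) - 2 = -(d:ℤ) - 2 by push_cast; ring]
  ring

lemma base3 (hd : 2 ≤ d) (q j : Fin d) {x : E d} (hx : 1 < eucNorm x) :
    ∫ σ in Set.Ioi (1:ℝ), kf q j x σ = Real.pi ^ ((d:ℝ)/2) / 2 * ((if q = j then 1 else 0) * tau ((d:ℝ)/2 - 1) (sq x / 4)
       - x q * x j / 2 * tau ((d:ℝ)/2) (sq x / 4)) := by
  have h0 : 0 < eucNorm x := by linarith
  have hs : 0 < sq x := by rw [← eucNorm_sq]; positivity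
  have hn := half_nn hd
  have h1 := (tau_int hn (by positivity : 0 < sq x / 4)).const_mul (if q = j then 1 else 0 : ℝ)
  have h2 := (tau_int (a := (d:ℝ)/2) (by positivity) (by positivity : 0 < sq x / 4)).const_mul (x q * x j / 2)
  unfold kf tau
  rw [integral_const_mul, integral_sub h1 h2, integral_const_mul, integral_const_mul]

lemma base4 (hd : 2 ≤ d) (q j : Fin d) (r n : ℕ) :
    Dc r (-n) (fun t x => U (ml [q, j]) (ga 1) t x
      - ((c0 d * ((if q = j then 1 else 0) * eucNorm x ^ 2 - d * (x q * x j)) * eucNorm x ^ (-(d:ℤ) - 2) : ℝ) : ℂ) : Fn d) := by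
  have h1 := (Dc_tau (d := d) r (half_nn hd) n).cmul ((-(Real.pi ^ ((d:ℝ)/2) / 2 * (if q = j then 1 else 0)) : ℝ) : ℂ)
  have h2 := ((Dc_coord q r).mul ((Dc_coord j r).mul (Dc_tau (d := d) r (a := (d:ℝ)/2) (by positivity) (n+2)))).cmul ((Real.pi ^ ((d:ℝ)/2) / 2 / 2 : ℝ) : ℂ)
  rw [show 1 + (1 + -((n + 2 : ℕ) : ℤ)) = -n by push_cast; ring] at h2
  refine (h1.add h2).congr fun t x hx => ?_
  have h0 : 0 < eucNorm x := by linarith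
  have hs : 0 < sq x := by rw [← eucNorm_sq]; positivity
  rw [show U (ml [q, j]) (ga 1) t x = U (ml [q, j]) (ga 1) 0 x from rfl, base1 hd q j hs, ← base2 hd q j hx,
    ← Set.Ioc_union_Ioi_eq_Ioi (zero_le_one' ℝ), setIntegral_union (Set.Ioc_disjoint_Ioi le_rfl) measurableSet_Ioi
      ((kf_int hd q j hs).mono_set Set.Ioc_subset_Ioi_self) ((kf_int hd q j hs).mono_set (Set.Ioi_subset_Ioi zero_le_one)), base3 hd q j hx]
  push_cast
  ring

abbrev Po (d : ℕ) := MvPolynomial (Fin d) ℝ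
noncomputable def SQ : Po d := ∑ i, X i ^ 2
noncomputable def lap (p : Po d) : Po d := ∑ j, pderiv j (pderiv j p)

lemma pd_comm (j k : Fin d) (p : Po d) : pderiv j (pderiv k p) = pderiv k (pderiv j p) := by
  have h : ⁅(pderiv j : Derivation ℝ (Po d) (Po d)), (pderiv k : Derivation ℝ (Po d) (Po d))⁆ = 0 := by
    apply MvPolynomial.derivation_ext
    intro i
    rw [Derivation.commutator_apply, pderiv_X, pderiv_X]
    by_cases h1 : i = j <;> by_cases h2 : i = k <;> simp [Pi.single_apply, h1, h2] <;> (split_ifs <;> simp)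
  have := DFunLike.congr_fun h p
  rw [Derivation.commutator_apply] at this
  exact sub_eq_zero.1 this

lemma C2 : (C 2 : Po d) = 2 := map_ofNat C 2
lemma C4 : (C 4 : Po d) = 4 := map_ofNat C 4

lemma pd_SQ (j : Fin d) : pderiv j (SQ : Po d) = 2 * X j := by
  unfold SQ
  rw [map_sum, Finset.sum_eq_single j]
  · rw [Derivation.leibniz_pow]; simp
  · intro b _ hb
    rw [Derivation.leibniz_pow, pderiv_X_of_ne hb]; simp
  · simp

lemma lap_SQ {G : Po d} {n : ℕ} (hG : G.IsHomogeneous n) : lap (SQ * G) = SQ * lap G + (4 * n + 2 * d : ℝ) • G := by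
  have e := hG.sum_X_mul_pderiv
  unfold lap
  have : ∀ j, pderiv j (pderiv j (SQ * G)) = SQ * pderiv j (pderiv j G) + (4 * (X j * pderiv j G) + 2 * G) := fun j => by
    simp only [Derivation.leibniz, pd_SQ, smul_eq_mul, map_add]
    have h2 : pderiv j (2 : Po d) = 0 := by
      rw [← C2, pderiv_C]
    rw [h2, pderiv_X_self]; ring
  rw [Finset.sum_congr rfl fun j _ => this j, Finset.sum_add_distrib, Finset.sum_add_distrib, ← Finset.mul_sum, ← Finset.mul_sum, e]
  simp only [Finset.sum_const, Finset.card_univ, Fintype.card_fin, nsmul_eq_mul, smul_eq_C_mul]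
  simp [C2, C4]; ring

lemma lap_X (k : Fin d) (p : Po d) : lap (X k * p) = X k * lap p + 2 * pderiv k p := by
  unfold lap
  have : ∀ j, pderiv j (pderiv j (X k * p)) = X k * pderiv j (pderiv j p) + (if j = k then 2 * pderiv k p else 0) := fun j => by
    simp only [Derivation.leibniz, smul_eq_mul, map_add]
    by_cases h : j = k
    · subst h; simp only [pderiv_X_self, if_true]
      have h2 : pderiv j (1 : Po d) = 0 := by simp
      rw [h2]; ring
    · rw [pderiv_X_of_ne (Ne.symm h)]; simp [h]
  rw [Finset.sum_congr rfl fun j _ => this j, Finset.sum_add_distrib, ← Finset.mul_sum]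
  simp

lemma lap_pd (k : Fin d) (p : Po d) : lap (pderiv k p) = pderiv k (lap p) := by
  unfold lap
  rw [map_sum]
  refine Finset.sum_congr rfl fun j _ => ?_
  rw [pd_comm j k, pd_comm j k]

lemma lap_lin (a : ℝ) (p q : Po d) : lap (p - a • q) = lap p - a • lap q := by
  simp [lap, Finset.sum_sub_distrib, Finset.smul_sum]

def HH (m : ℕ) (p : Po d) : Prop := p.IsHomogeneous m ∧ lap p = 0

noncomputable def stp (m : ℕ) (k : Fin d) (p : Po d) : Po d := SQ * pderiv k p - ((d:ℝ) - 2 + 2 * m) • (X k * p)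

lemma SQ_hom : (SQ : Po d).IsHomogeneous 2 := IsHomogeneous.sum _ _ _ fun i _ => by
  simpa using (isHomogeneous_X ℝ i).pow 2

lemma HH_stp {m : ℕ} (hm : 1 ≤ m) (k : Fin d) {p : Po d} (hp : HH m p) : HH (m+1) (stp m k p) := by
  constructor
  · have h1 := SQ_hom.mul (hp.1.pderiv (i := k))
    rw [show 2 + (m - 1) = m + 1 by omega] at h1
    have h2 := (isHomogeneous_X ℝ k).mul hp.1
    rw [add_comm] at h2
    refine h1.sub ?_
    rw [smul_eq_C_mul]
    simpa using (isHomogeneous_C (Fin d) ((d:ℝ) - 2 + 2 * m)).mul h2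
  · rw [stp, lap_lin, lap_SQ hp.1.pderiv, lap_X, lap_pd, hp.2, map_zero, mul_zero, mul_zero, zero_add, zero_add,
      show (2 : Po d) * pderiv k p = (2:ℝ) • pderiv k p by rw [smul_eq_C_mul, C2], smul_smul, ← sub_smul]
    rw [Nat.cast_sub hm]
    convert zero_smul ℝ _ using 2
    push_cast; ring

noncomputable def Hl : List (Fin d) → Po d
  | [] => 0
  | [q] => X q
  | k :: l => stp l.length k (Hl l)

lemma HH_X (q : Fin d) : HH 1 (X q : Po d) := ⟨isHomogeneous_X ℝ q, by
  unfold lap; refine Finset.sum_eq_zero fun j _ => ?_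
  rw [pderiv_X]; by_cases h : q = j <;> simp [Pi.single_apply, h]⟩

lemma Hl_cons (k : Fin d) {l : List (Fin d)} (h : 1 ≤ l.length) : Hl (k :: l) = stp l.length k (Hl l) := by
  cases l with
  | nil => simp at h
  | cons a l => rfl

lemma HH_Hl : ∀ (l : List (Fin d)), 1 ≤ l.length → HH l.length (Hl l)
  | [], h => by simp at h
  | [q], _ => HH_X q
  | k :: a :: l, _ => HH_stp (by simp) k (HH_Hl (a :: l) (by simp))

lemma eval_SQ (x : E d) : eval x (SQ : Po d) = eucNorm x ^ 2 := by
  rw [eucNorm_sq]; simp [SQ, sq]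

noncomputable def ord (d m : ℕ) : ℤ := -((d:ℤ) - 2 + 2 * m)

noncomputable def mainl (l : List (Fin d)) : Fn d := fun _ x => ((eval x (Hl l) * eucNorm x ^ (ord d l.length) : ℝ) : ℂ)

lemma mainl_HE {l : List (Fin d)} (h : 1 ≤ l.length) : HE (mainl l) (fun k => mainl (k :: l)) := by
  intro t x hx
  have h0 : 0 < eucNorm x := by linarith
  have := hfd_ofReal (hfd_mul (pfd (Hl l) x) (eucNorm_hfd h0 (ord d l.length)))
  unfold mainl
  refine HasFDerivAt.congr_fderiv this ?_
  congr 1; funext k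
  beta_reduce
  rw [Hl_cons k h, stp]
  congr 1
  rw [map_sub, map_mul, smul_eval, eval_SQ, map_mul, eval_X, show ord d (k :: l).length = ord d l.length - 2 by simp [ord]; ring]
  rw [show eucNorm x ^ ord d l.length = eucNorm x ^ (ord d l.length - 2) * eucNorm x ^ 2 by
    rw [← zpow_natCast, ← zpow_add₀ h0.ne']; congr 1; push_cast; ring]
  rw [show ((ord d l.length : ℤ) : ℝ) = -((d:ℝ) - 2 + 2 * l.length) by simp [ord]]
  ring

lemma base5 (hd : 2 ≤ d) : ∀ (l : List (Fin d)), 2 ≤ l.length → ∃ c : ℂ, ∀ (r n : ℕ),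
    Dc r (-n) (fun t x => U (ml l) (ga 1) t x - c * mainl l t x : Fn d)
  | [], h => by simp at h
  | [q], h => by simp at h
  | [q, j], _ => ⟨c0 d, fun r n => (base4 hd q j r n).congr fun t x hx => by
      have h0 : 0 < eucNorm x := by linarith
      congr 1
      rw [mainl, Hl_cons q (by simp), stp, Hl, ← Complex.ofReal_mul]
      congr 1
      rw [map_sub, map_mul, smul_eval, eval_SQ, map_mul, eval_X, eval_X, pderiv_X, show ord d [q, j].length = -d - 2 by simp [ord]; ring]
      by_cases h : q = j
      · subst h; simp; ring
      · simp [h, Pi.single_apply, Ne.symm h]; ring⟩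
  | k :: a :: b :: l, _ => by
    obtain ⟨c, hc⟩ := base5 hd (a :: b :: l) (by simp)
    refine ⟨-Complex.I * c, fun r n => ?_⟩
    have hE : HE (fun t x => U (ml (a :: b :: l)) (ga 1) t x - c * mainl (a :: b :: l) t x : Fn d)
        (fun k t x => Complex.I * U (ml (k :: a :: b :: l)) (ga 1) t x - c * mainl (k :: a :: b :: l) t x) := by
      intro t x hx
      have h1 := (U_HX (ml_PM (l := a :: b :: l) (by simp)) (ga_RD one_pos) t x).sub ((mainl_HE (l := a :: b :: l) (by simp) t x hx).const_mul c)
      rw [← gr_mul, ← gr_sub] at h1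
      simp only [U_ml_ix] at h1
      exact h1
    have h2 := (((hc (r+1) n).deriv hE k).cmul (-Complex.I)).mono (n' := -n) (by omega)
    refine h2.congr fun t x _ => ?_
    linear_combination (-U (ml (k :: a :: b :: l)) (ga 1) t x) * Complex.I_sq

def Har (m : ℕ) (G : Fn d) : Prop :=
  JC G ∧ (∀ x, ContDiff ℝ 1 (fun t => G t x)) ∧ (∀ t, ∃ H : Po d, HH m H ∧ ∀ x, (G t x).re = eval x H) ∧ ∀ r, Dc r m G

lemma HH.add {m : ℕ} {p q : Po d} (hp : HH m p) (hq : HH m q) : HH m (p + q) :=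
  ⟨hp.1.add hq.1, by have : lap (p + q) = lap p + lap q := by simp [lap, Finset.sum_add_distrib]
                     rw [this, hp.2, hq.2, add_zero]⟩
lemma HH.smul {m : ℕ} {p : Po d} (hp : HH m p) (c : ℝ) : HH m (c • p) :=
  ⟨by rw [smul_eq_C_mul]; simpa using (isHomogeneous_C (Fin d) c).mul hp.1, by
    have : lap (c • p) = c • lap p := by simp [lap, Finset.smul_sum]
    rw [this, hp.2, smul_zero]⟩
lemma HH_zero (m : ℕ) : HH m (0 : Po d) := ⟨isHomogeneous_zero _ _ _, by simp [lap]⟩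

lemma Har_zero (m : ℕ) : Har m (fun _ _ => 0 : Fn d) :=
  ⟨continuous_const, fun _ => contDiff_const, fun _ => ⟨0, HH_zero m, by simp⟩, fun r => Dc_zero r m⟩

lemma Har.add {m : ℕ} {F G : Fn d} (hF : Har m F) (hG : Har m G) : Har m (fun t x => F t x + G t x) :=
  ⟨Continuous.add hF.1 hG.1, fun x => (hF.2.1 x).add (hG.2.1 x), fun t => by
    obtain ⟨H, h1, h2⟩ := hF.2.2.1 t
    obtain ⟨K, k1, k2⟩ := hG.2.2.1 t
    exact ⟨H + K, h1.add k1, fun x => by simp [h2, k2]⟩, fun r => (hF.2.2.2 r).add (hG.2.2.2 r)⟩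

lemma Har.neg {m : ℕ} {F : Fn d} (hF : Har m F) : Har m (fun t x => - F t x) :=
  ⟨Continuous.neg hF.1, fun x => (hF.2.1 x).neg, fun t => by
    obtain ⟨H, h1, h2⟩ := hF.2.2.1 t
    exact ⟨(-1:ℝ) • H, h1.smul _, fun x => by simp [h2]⟩, fun r => by simpa using (hF.2.2.2 r).cmul (-1)⟩

lemma Har_sum {m : ℕ} {ι : Type*} (s : Finset ι) {F : ι → Fn d} (h : ∀ i ∈ s, Har m (F i)) :
    Har m (fun t x => ∑ i ∈ s, F i t x) := by
  classical
  induction s using Finset.induction_on with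
  | empty => simpa using Har_zero m
  | insert a s ha ih =>
    simp only [Finset.sum_insert ha]
    exact (h a (by simp)).add (ih fun i hi => h i (by simp [hi]))

lemma at_bd {f : Fn d} (hf : RD f) : ∃ K, ∀ t, ‖f t 0‖ ≤ K := by
  obtain ⟨C, hC⟩ := hf.2 0
  exact ⟨C, fun t => by simpa using hC t 0⟩

lemma Har_base {f : Fn d} (hf : ∀ r, Cl RD r f) (c : ℂ) {m : ℕ} {H : Po d} (hH : HH m H) :
    Har m (fun t x => f t 0 * c * (eval x H : ℂ)) := by
  obtain ⟨ft, _, h1, _, h2, _⟩ := Cl_all hf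
  obtain ⟨K, hK⟩ := at_bd (hf 0)
  have cf : Continuous fun t => f t 0 := (hf 0).1.comp (by fun_prop : Continuous fun t : ℝ => (t, (0 : E d)))
  have cft : Continuous fun t => ft t 0 := (h2 0).1.comp (by fun_prop : Continuous fun t : ℝ => (t, (0 : E d)))
  have hcd : ContDiff ℝ 1 fun t => f t 0 := by
    rw [contDiff_one_iff_deriv]
    refine ⟨fun t => (h1 t 0).differentiableAt, ?_⟩
    have : deriv (fun t => f t 0) = fun t => ft t 0 := funext fun t => (h1 t 0).deriv
    rwa [this]
  refine ⟨?_, fun x => (hcd.mul contDiff_const).mul contDiff_const, fun t => ⟨(f t 0 * c).re • H, hH.smul _, fun x => ?_⟩, fun r => ?_⟩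
  · have h3 : Continuous fun x : E d => eval x H := MvPolynomial.continuous_eval _
    have := cf.comp (continuous_fst (X := ℝ) (Y := E d))
    unfold JC
    exact ((cf.comp continuous_fst).mul continuous_const).mul (Complex.continuous_ofReal.comp (h3.comp continuous_snd))
  · rw [Complex.re_mul_ofReal, smul_eval]
  · have h4 := (Dc_time (d := d) _ hK r).mul ((Dc_poly r hH.1).cmul c)
    rw [zero_add] at h4
    refine h4.congr fun t x _ => by ring

noncomputable def pw (d m : ℕ) (x : E d) : ℂ := ((eucNorm x ^ (ord d m) : ℝ) : ℂ)

lemma Dc_Har {m : ℕ} {G : Fn d} (h : Har m G) (r : ℕ) : Dc r (-((d:ℤ) - 2 + m)) (fun t x => G t x * pw d m x) := by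
  have := (h.2.2.2 r).mul (Dc_zpow r (ord d m))
  rwa [show (m:ℤ) + ord d m = -((d:ℤ) - 2 + m) by simp [ord]; ring] at this

lemma U_had {l : List (Fin d)} (hl : 2 ≤ l.length) {f : Fn d} (hf : ∀ r, Cl RD r f) {R : Fin d → Fn d} (hR : ∀ k r, Cl RD r (R k))
    (h : ∀ t ξ, f t ξ = f t 0 * ga 1 t ξ + ∑ k, (ξ k:ℂ) * R k t ξ) (t x) :
    U (ml l) f t x = f t 0 * U (ml l) (ga 1) t x + ∑ k, U (ml (k :: l)) (R k) t x := by
  have i1 : Integrable fun ξ => f t 0 * (ex x ξ * (ml l ξ * ga 1 t ξ)) := (U_int (ml_PM hl) (ga_RD one_pos) t x).const_mul _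
  have i2 : ∀ k, Integrable fun ξ => ex x ξ * (ml (k :: l) ξ * R k t ξ) := fun k => U_int (ml_PM (by simp; omega)) (hR k 0) t x
  unfold U
  rw [← integral_const_mul, ← integral_finsetSum _ (fun k _ => i2 k), ← integral_add i1 (integrable_finsetSum _ fun k _ => i2 k)]
  congr 1; funext ξ
  rw [h t ξ, mul_add, mul_add, Finset.mul_sum, Finset.mul_sum]
  congr 1
  · ring
  · refine Finset.sum_congr rfl fun k _ => ?_
    rw [ml_cons]; ring

theorem expand (hd : 2 ≤ d) : ∀ (n : ℕ) {l : List (Fin d)} (_ : 3 ≤ l.length) {f : Fn d} (_ : ∀ r, Cl RD r f),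
    ∃ G : ℕ → Fn d, (∀ i, Har (l.length + i) (G i)) ∧ ∀ r, Dc r (-((l.length:ℤ) + n - 3))
      (fun t x => U (ml l) f t x - ∑ i ∈ Finset.range n, G i t x * pw d (l.length + i) x)
  | 0, l, hl, f, hf => ⟨fun _ _ _ => 0, fun i => Har_zero _, fun r => by
      have := U_ml_Dc hf r (l := l) (n := l.length - 3) (by omega)
      simp only [Finset.range_zero, Finset.sum_empty, sub_zero]
      rwa [show -((l.length:ℤ) + (0:ℕ) - 3) = -((l.length - 3 : ℕ) : ℤ) by omega]⟩
  | n+1, l, hl, f, hf => by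
    obtain ⟨R, hR, hfR⟩ := hadamard hf
    choose G hG hD using fun k => expand hd n (l := k :: l) (by simp; omega) (hR k)
    obtain ⟨c, hc⟩ := base5 hd l (by omega)
    obtain ⟨K, hK⟩ := at_bd (hf 0)
    refine ⟨fun i => match i with
      | 0 => fun t x => f t 0 * c * (eval x (Hl l) : ℂ)
      | i+1 => fun t x => ∑ k, G k i t x, fun i => ?_, fun r => ?_⟩
    · match i with
      | 0 => exact Har_base hf c (HH_Hl l (by omega))
      | i+1 =>
        refine Har_sum _ fun k _ => ?_
        have := hG k i
        rwa [show (k :: l).length + i = l.length + (i+1) by simp; omega] at this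
    · have h1 := ((Dc_time (d := d) _ hK r).mul (hc r (l.length + n))).mono (n' := -((l.length:ℤ) + (n+1 : ℕ) - 3)) (by push_cast; omega)
      have h2 := Dc_sum (n := -((l.length:ℤ) + (n+1 : ℕ) - 3)) (F := fun k t x => U (ml (k :: l)) (R k) t x - ∑ i ∈ Finset.range n, G k i t x * pw d ((k :: l).length + i) x) Finset.univ
        (fun k _ => (hD k r).mono (by simp; omega))
      refine (h1.add h2).congr fun t x hx => ?_
      rw [U_had (by omega) hf hR hfR, Finset.sum_range_succ', Finset.sum_sub_distrib]
      simp only [add_zero]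
      rw [Finset.sum_comm]
      simp only [Finset.sum_mul, mainl, pw, List.length_cons]
      simp only [show ∀ i, l.length + 1 + i = l.length + (i + 1) by intro i; omega]
      push_cast
      ring

def Ex3 (F : Fn d) : Prop := ∀ n : ℕ, ∃ G : ℕ → Fn d, (∀ i, Har (3 + i) (G i)) ∧ ∀ r, Dc r (-n)
      (fun t x => F t x - ∑ i ∈ Finset.range n, G i t x * pw d (3 + i) x)

lemma Ex3.add {F F' : Fn d} (h : Ex3 F) (h' : Ex3 F') : Ex3 (fun t x => F t x + F' t x) := fun n => by
  obtain ⟨G, g1, g2⟩ := h n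
  obtain ⟨G', g1', g2'⟩ := h' n
  refine ⟨fun i t x => G i t x + G' i t x, fun i => (g1 i).add (g1' i), fun r => ((g2 r).add (g2' r)).congr fun t x _ => ?_⟩
  simp only [add_mul, Finset.sum_add_distrib]; ring

lemma Ex3.neg {F : Fn d} (h : Ex3 F) : Ex3 (fun t x => - F t x) := fun n => by
  obtain ⟨G, g1, g2⟩ := h n
  refine ⟨fun i t x => - G i t x, fun i => (g1 i).neg, fun r => ((g2 r).cmul (-1)).congr fun t x _ => ?_⟩
  simp only [neg_mul, Finset.sum_neg_distrib]; ring

lemma Ex3_zero : Ex3 (fun _ _ => 0 : Fn d) := fun n =>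
  ⟨fun _ _ _ => 0, fun i => Har_zero _, fun r => by simpa using Dc_zero r _⟩

lemma Ex3_sum {ι : Type*} (s : Finset ι) {F : ι → Fn d} (h : ∀ i ∈ s, Ex3 (F i)) :
    Ex3 (fun t x => ∑ i ∈ s, F i t x) := by
  classical
  induction s using Finset.induction_on with
  | empty => simpa using Ex3_zero
  | insert a s ha ih =>
    simp only [Finset.sum_insert ha]
    exact (h a (by simp)).add (ih fun i hi => h i (by simp [hi]))

lemma Ex3_one {f : Fn d} (hf : ∀ r, Cl RD r f) : Ex3 (U (fun _ => 1) f) := fun n =>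
  ⟨fun _ _ _ => 0, fun i => Har_zero _, fun r => by simpa using U_one_Dc r n hf⟩

lemma Ex3_ml (hd : 2 ≤ d) (k q j : Fin d) {f : Fn d} (hf : ∀ r, Cl RD r f) : Ex3 (U (ml [k, q, j]) f) := fun n => by
  obtain ⟨G, g1, g2⟩ := expand hd n (l := [k, q, j]) (by simp) hf
  refine ⟨G, g1, fun r => ?_⟩
  have := g2 r
  rwa [show -((([k, q, j] : List (Fin d)).length : ℤ) + n - 3) = -n by simp] at this

lemma Ex3.trim {F : Fn d} (h : Ex3 F) (n : ℕ) : ∃ G : ℕ → Fn d, (∀ i, Har (3 + i) (G i)) ∧ ∀ r, Dc r (-((d:ℤ) + 1 + n))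
      (fun t x => F t x - ∑ i ∈ Finset.range n, G i t x * pw d (3 + i) x) := by
  obtain ⟨G, g1, g2⟩ := h (d + 1 + n)
  refine ⟨G, g1, fun r => ?_⟩
  have h2 : Dc r (-((d:ℤ) + 1 + n)) (fun t x => ∑ i ∈ Finset.range (d+1), G (n + i) t x * pw d (3 + (n + i)) x) :=
    Dc_sum _ fun i _ => (Dc_Har (g1 (n + i)) r).mono (by push_cast; omega)
  refine (((g2 r).mono (by push_cast; omega)).add h2).congr fun t x _ => ?_
  rw [show d + 1 + n = n + (d + 1) by omega, Finset.sum_range_add _ n (d+1)]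
  ring

def RP (n : ℤ) (g : ℝ → E d → ℝ) : Prop :=
  ∃ F : Fn d, (∀ r, Dc r n F) ∧ ∀ t x, 1 < eucNorm x → g t x = (F t x).re

lemma re_hfd {f : E d → ℂ} {c : Fin d → ℂ} {x : E d} (h : HasFDerivAt f (gr c) x) (j : Fin d) :
    HasFDerivAt (fun y => (f y).re) (rg fun k => (c k).re) x := by
  refine (Complex.reCLM.hasFDerivAt.comp x h).congr_fderiv ?_
  ext w
  simp [rg_apply, gr_apply, mul_comm]

lemma re_pd {f : E d → ℂ} {c : Fin d → ℂ} {x : E d} (h : HasFDerivAt f (gr c) x) (j : Fin d) :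
    pd j (fun y => (f y).re) x = (c j).re := by
  rw [pd, (re_hfd h j).fderiv, rg_single]

lemma RP.pd {n : ℤ} {g : ℝ → E d → ℝ} (h : RP n g) (j : Fin d) : RP (n-1) (fun t => pd j (g t)) := by
  obtain ⟨F, h1, h2⟩ := h
  obtain ⟨_, Fx, h3, _⟩ := h1 1
  refine ⟨Fx j, fun r => (h1 (r+1)).deriv h3 j, fun t x hx => ?_⟩
  rw [← re_pd (h3 t x hx) j]
  have : g t =ᶠ[nhds x] fun y => (F t y).re :=
    Filter.eventuallyEq_of_mem (reg_open.mem_nhds hx) fun y hy => h2 t y hy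
  exact congrArg (fun L : E d →L[ℝ] ℝ => L (Pi.single j 1)) this.fderiv_eq

lemma RP.it {n : ℤ} {g : ℝ → E d → ℝ} (h : RP n g) (j : Fin d) (m : ℕ) : RP (n-m) (fun t => (_root_.pd j)^[m] (g t)) := by
  induction m with
  | zero => simpa using h
  | succ m ih =>
    simp only [Function.iterate_succ_apply']
    have := ih.pd j
    rwa [show n - (m:ℤ) - 1 = n - ((m+1 : ℕ):ℤ) by push_cast; ring] at this

lemma RP.pdm {n : ℤ} {g : ℝ → E d → ℝ} (h : RP n g) (α : Fin d → ℕ) : RP (n-(∑ j, α j : ℕ)) (fun t => pdm α (g t)) := by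
  have key : ∀ l : List (Fin d), RP (n - ((l.map α).sum : ℕ)) (fun t => l.foldr (fun j g => (_root_.pd j)^[α j] g) (g t)) := by
    intro l
    induction l with
    | nil => simpa using h
    | cons a l ih =>
      have := ih.it a (α a)
      simp only [List.foldr_cons, List.map_cons, List.sum_cons]
      rwa [show n - ((l.map α).sum : ℕ) - (α a : ℤ) = n - ((α a + (l.map α).sum : ℕ) : ℤ) by push_cast; ring] at this
  have := key (List.finRange d)
  rwa [← List.ofFn_eq_map, List.sum_ofFn] at this

lemma RP_bound {n : ℤ} {g : ℝ → E d → ℝ} (h : RP n g) (α : Fin d → ℕ) :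
    ∃ C > (0:ℝ), ∀ t x, 2 ≤ eucNorm x → |_root_.pdm α (g t) x| ≤ C * eucNorm x ^ ((n:ℝ) - ((∑ j, α j : ℕ) : ℝ)) := by
  obtain ⟨F, h1, h2⟩ := h.pdm α
  obtain ⟨C, hC⟩ := (h1 0)
  refine ⟨max C 1, by positivity, fun t x hx => ?_⟩
  have h0 : 0 < eucNorm x := by linarith
  have h3 := h2 t x (by linarith)
  beta_reduce at h3
  rw [h3]
  refine (Complex.abs_re_le_norm _).trans ((hC t x (by linarith)).trans ?_)
  rw [show (n:ℝ) - ((∑ j, α j : ℕ) : ℝ) = ((n - (∑ j, α j : ℕ) : ℤ) : ℝ) by push_cast; ring, Real.rpow_intCast]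
  gcongr
  exact le_max_left _ _

lemma HH_pd {m : ℕ} {H : Po d} (h : HH m H) (x : E d) : ∑ j : Fin d, pd j (pd j (fun y => eval y H)) x = 0 := by
  have h1 : ∀ (j : Fin d) (p : Po d), pd j (fun y => eval y p) = fun y => eval y (pderiv j p) := fun j p => by
    funext y; rw [pd, (pfd p y).fderiv, rg_single]
  simp only [h1]
  rw [← map_sum]
  have := h.2
  unfold lap at this
  rw [this, map_zero]

lemma eucNorm_smul_inv {y : E d} (h : 0 < eucNorm y) {m : ℕ} {H : Po d} (hH : H.IsHomogeneous m) :
    eval ((eucNorm y)⁻¹ • y) H = (eucNorm y)⁻¹ ^ m * eval y H := by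
  rw [eval_eq', eval_eq', Finset.mul_sum]
  refine Finset.sum_congr rfl fun e he => ?_
  have : ∑ i, e i = m := by
    have := hH (mem_support_iff.1 he)
    rw [← this, Finsupp.weight_apply, Finsupp.sum_fintype _ _ (by simp)]; simp
  simp only [Pi.smul_apply, smul_eq_mul, mul_pow, Finset.prod_mul_distrib]
  rw [Finset.prod_pow_eq_pow_sum, this]; ring

theorem asym {F : Fn d} (hF : Ex3 F) (N : ℕ) (hN : d + 1 ≤ N) :
    ∃ a : ℕ → ℝ → E d → ℝ,
      (∀ k, d + 1 ≤ k → k ≤ N → Continuous (fun z : ℝ × E d => a k z.1 z.2)) ∧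
      (∀ k, d + 1 ≤ k → k ≤ N → ∀ θ : E d, ContDiff ℝ 1 (fun t => a k t θ)) ∧
      (∀ k, d + 1 ≤ k → k ≤ N → ∀ t,
            ∃ H : MvPolynomial (Fin d) ℝ, H.IsHomogeneous (k - d + 2) ∧
              (∀ x, ∑ j : Fin d, pd j (pd j (fun y => MvPolynomial.eval y H)) x = 0) ∧
              (∀ θ : Fin d → ℝ, eucNorm θ = 1 → a k t θ = MvPolynomial.eval θ H)) ∧
      (∀ α : Fin d → ℕ, ∃ C > (0 : ℝ), ∀ t, ∀ x : Fin d → ℝ,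
            2 ≤ eucNorm x → 
              |pdm α (fun y => (F t y).re -
                  ∑ k ∈ Finset.Icc (d + 1) N,
                    a k t ((eucNorm y)⁻¹ • y) * eucNorm y ^ (-(k : ℝ))) x| ≤
                C * eucNorm x ^ (-((N : ℝ) + 1) - ((∑ j, α j : ℕ) : ℝ))) := by
  obtain ⟨G, g1, g2⟩ := hF.trim (N - d)
  refine ⟨fun k t x => (G (k - (d+1)) t x).re, fun k _ _ => Complex.continuous_re.comp (g1 _).1,
    fun k _ _ θ => Complex.reCLM.contDiff.comp ((g1 _).2.1 θ), fun k h1 _ t => ?_, fun α => ?_⟩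
  · obtain ⟨H, h2, h3⟩ := (g1 (k - (d+1))).2.2.1 t
    refine ⟨H, ?_, HH_pd h2, fun θ _ => h3 θ⟩
    have := h2.1
    rwa [show 3 + (k - (d+1)) = k - d + 2 by omega] at this
  · have : RP (-((N:ℤ) + 1)) (fun t y => (F t y).re -
                  ∑ k ∈ Finset.Icc (d + 1) N,
                    (G (k - (d+1)) t ((eucNorm y)⁻¹ • y)).re * eucNorm y ^ (-(k : ℝ))) := by
      refine ⟨_, fun r => by simpa [show (d:ℤ) + 1 + ((N - d : ℕ) : ℤ) = N + 1 by omega] using g2 r, fun t y hy => ?_⟩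
      have hy0 : 0 < eucNorm y := by linarith
      rw [Complex.sub_re, Complex.re_sum]
      beta_reduce
      congr 1
      rw [show Finset.Icc (d+1) N = Finset.Ico (d+1) (N+1) by ext; simp, Finset.sum_Ico_eq_sum_range,
        show N + 1 - (d + 1) = N - d by omega]
      refine Finset.sum_congr rfl fun i _ => ?_
      obtain ⟨H, h2, h3⟩ := (g1 i).2.2.1 t
      rw [show d + 1 + i - (d + 1) = i by omega, pw, Complex.re_mul_ofReal, h3, h3, eucNorm_smul_inv hy0 h2.1,
        show (-((d + 1 + i : ℕ):ℝ)) = ((-((d + 1 + i : ℕ):ℤ) : ℤ) : ℝ) by push_cast; ring, Real.rpow_intCast, mul_comm _ (eval y H), mul_assoc]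
      congr 1
      rw [← zpow_natCast, inv_zpow', ← zpow_add₀ hy0.ne']
      congr 1
      simp [ord]; ring
    obtain ⟨C, hC, h⟩ := RP_bound this α
    refine ⟨C, hC, fun t x hx => ?_⟩
    have := h t x hx
    push_cast at this ⊢
    exact this

theorem asym0 {F : Fn d} (hF : Ex3 F) (α : Fin d → ℕ) : ∃ C > (0 : ℝ), ∀ t, ∀ x : Fin d → ℝ,
        2 ≤ eucNorm x → |pdm α (fun y => (F t y).re) x| ≤
            C * eucNorm x ^ (-((d : ℝ) + 1) - ((∑ j, α j : ℕ) : ℝ)) := by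
  obtain ⟨G, g1, g2⟩ := hF.trim 0
  have : RP (-((d:ℤ) + 1)) (fun t y => (F t y).re) := ⟨F, fun r => by simpa using g2 r, fun _ _ _ => rfl⟩
  obtain ⟨C, hC, h⟩ := RP_bound this α
  refine ⟨C, hC, fun t x hx => ?_⟩
  have := h t x hx
  push_cast at this ⊢
  exact this

lemma U_lin2 {c : Fin d → Fin d → ℂ} {m : Fin d → Fin d → E d → ℂ} (hm : ∀ i j, PM (m i j)) {f : Fin d → Fin d → Fn d}
    (hf : ∀ i j, RD (f i j)) (t x) : ∑ i, ∑ j, c i j * U (m i j) (f i j) t x =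
      ∫ ξ, ex x ξ * ∑ i, ∑ j, c i j * (m i j ξ * f i j t ξ) := by
  have := U_lin (Finset.univ : Finset (Fin d × Fin d)) (fun p => c p.1 p.2) (m := fun p => m p.1 p.2) (fun p => hm _ _)
    (f := fun p => f p.1 p.2) (fun p => hf _ _) t x
  simpa only [Fintype.sum_prod_type] using this

lemma U_linS {m : Fin d → E d → ℂ} (hm : ∀ i, PM (m i)) {f : Fin d → Fn d}
    (hf : ∀ i, RD (f i)) (t x) : ∑ i, U (m i) (f i) t x = ∫ ξ, ex x ξ * ∑ i, m i ξ * f i t ξ := by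
  simpa using U_lin Finset.univ (fun _ => 1) hm hf t x

lemma sq_zero' {ξ : E d} (h : sq ξ = 0) : ξ = 0 := by
  by_contra h'
  exact (sq_pos h').ne' h

lemma mm_ml (j k : Fin d) (ξ : E d) : mm j k ξ = (if j = k then 1 else 0) - ml [j, k] ξ := by
  rw [ml2, mm]; split_ifs <;> simp

lemma mm_w (q : Fin d) (ξ : E d) (w : Fin d → ℂ) : ∑ k, mm q k ξ * w k = w q - ∑ k, ml [q, k] ξ * w k := by
  simp [mm_ml, sub_mul, Finset.sum_sub_distrib]

lemma mm_div (k : Fin d) (ξ : E d) : ∑ j, (ξ j : ℂ) * mm j k ξ = 0 := by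
  have : ∑ j, ξ j * ((if j = k then 1 else 0) - ξ j * ξ k / sq ξ) = 0 := by
    by_cases h : sq ξ = 0
    · simp [sq_zero' h]
    · simp only [mul_sub, Finset.sum_sub_distrib]
      have : ∀ j, ξ j * (ξ j * ξ k / sq ξ) = ξ j ^ 2 * (ξ k / sq ξ) := fun j => by ring
      simp only [this, ← Finset.sum_mul]
      rw [show ∑ i, ξ i ^ 2 = sq ξ from rfl]
      field_simp
      simp
  have := congrArg (fun r : ℝ => (r : ℂ)) this
  push_cast at this
  simpa [mm] using this

lemma mm_curl (i j : Fin d) (ξ : E d) (w : Fin d → ℂ) :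
    (ξ j : ℂ) * ∑ k, mm i k ξ * w k - (ξ i : ℂ) * ∑ k, mm j k ξ * w k = ξ j * w i - ξ i * w j := by
  rw [mm_w, mm_w, mul_sub, mul_sub, Finset.mul_sum, Finset.mul_sum]
  have : ∀ k, (ξ j : ℂ) * (ml [i, k] ξ * w k) = (ξ i : ℂ) * (ml [j, k] ξ * w k) := fun k => by
    rw [ml2, ml2]; push_cast; ring
  simp only [this]; ring

noncomputable def uC (v : Vn d) (q : Fin d) : Fn d := fun t x => ∑ k, U (mm q k) (v k) t x

lemma Cl.sumJC {r} {ι : Type*} (s : Finset ι) {f : ι → Fn d} (hf : ∀ i ∈ s, Cl JC r (f i)) :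
    Cl JC r (fun t ξ => ∑ i ∈ s, f i t ξ) := by
  classical
  have hz : ∀ r, Cl JC r (fun _ _ => 0 : Fn d) := fun r => (ClRD_zero r).mono fun _ h => h.1
  induction s using Finset.induction_on with
  | empty => simpa using hz r
  | insert a s ha ih =>
    simp only [Finset.sum_insert ha]
    exact Cl.add (fun _ _ h1 h2 => Continuous.add h1 h2) (hf a (by simp)) (ih fun i hi => hf i (by simp [hi]))

lemma uC_Cl {r} {v : Vn d} (hv : ∀ i, Cl RD r (v i)) (q) : Cl JC r (uC v q) :=
  Cl.sumJC _ fun k _ => U_Cl (mm_MB q k).PM (hv k)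

lemma uC_HX {v : Vn d} (hv : ∀ i, RD (v i)) (q) : HX (uC v q) (fun j => uC (fun k => ix j (v k)) q) :=
  HX_sum _ fun k _ => U_HX (mm_MB q k).PM (hv k)

lemma uC_HT {v vt : Vn d} (hv : ∀ i, RD (v i)) (hvt : ∀ i, RD (vt i)) (h : ∀ i, HT (v i) (vt i)) (q) : HT (uC v q) (uC vt q) :=
  fun t x => HasDerivAt.fun_sum fun k _ => U_HT (mm_MB q k).PM (hv k) (hvt k) (h k) t x

lemma uC_eq {v : Vn d} (hv : ∀ i, RD (v i)) (q t x) : uC v q t x = ∫ ξ, ex x ξ * ∑ k, mm q k ξ * v k t ξ :=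
  U_linS (fun k => (mm_MB q k).PM) hv t x

lemma uC_div {v : Vn d} (hv : ∀ i, RD (v i)) (t x) : ∑ j, uC (fun k => ix j (v k)) j t x = 0 := by
  have := U_lin2 (c := fun _ _ => 1) (m := fun j k => mm j k) (fun j k => (mm_MB j k).PM) (f := fun j k => ix j (v k)) (fun j k => ix_RD j (hv k)) t x
  simp only [one_mul] at this
  unfold uC
  rw [this]
  refine integral_eq_zero_of_ae (.of_forall fun ξ => ?_)
  simp only [Pi.zero_apply]
  rw [Finset.sum_comm]
  have : ∀ k j, mm j k ξ * ix j (v k) t ξ = (ξ j * mm j k ξ) * (Complex.I * v k t ξ) := fun k j => by simp only [ix]; ring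
  simp [this, ← Finset.sum_mul, mm_div]

lemma uC_curl {v : Vn d} (hv : ∀ i, RD (v i)) (i j t x) :
    uC (fun k => ix j (v k)) i t x - uC (fun k => ix i (v k)) j t x = U (fun _ => 1) (ix j (v i)) t x - U (fun _ => 1) (ix i (v j)) t x := by
  have I1 := fun i j => integrable_finsetSum Finset.univ fun k (_ : k ∈ Finset.univ) => U_int (mm_MB i k).PM (ix_RD j (hv k)) t x
  have I2 := fun i j => U_int (d := d) PM_one (ix_RD i (hv j)) t x
  simp only [← Finset.mul_sum] at I1
  rw [uC_eq (fun k => ix_RD j (hv k)), uC_eq (fun k => ix_RD i (hv k)), U, U, ← integral_sub (I1 i j) (I1 j i), ← integral_sub (I2 j i) (I2 i j)]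
  congr 1; funext ξ
  have := mm_curl i j ξ (fun k => v k t ξ)
  have h2 : ∀ i j, ∑ k, mm i k ξ * ix j (v k) t ξ = Complex.I * (ξ j * ∑ k, mm i k ξ * v k t ξ) := fun i j => by
    simp only [ix, Finset.mul_sum]; exact Finset.sum_congr rfl fun k _ => by ring
  rw [h2, h2, ← mul_sub, ← mul_sub, this]
  simp only [ix]; ring

lemma uC_NN {v : Vn d} (hv : ∀ i, RD (v i)) (q t x) : U (fun _ => 1) (NN v v q) t x =
    - ∑ j, uC v j t x * (uC (fun k => ix j (v k)) q t x - uC (fun k => ix q (v k)) j t x) := by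
  have hp : ∀ j i, RD (fun t ξ => pp j ξ * v i t ξ) := fun j i => (pp_Cl 0 j).base.mulRD (hv i)
  have hQ : ∀ j k i l, RD (Q (mm j k) (v k) (fun t ξ => pp i ξ * v l t ξ)) := fun j k i l => Q_Cl (r := 0) (mm_MB j k) (hv k) (hp i l)
  have h1 : U (fun _ => 1) (NN v v q) t x = ∑ j, ∑ k, (U (fun _ => 1) (Q (mm j k) (v k) (fun t ξ => pp j ξ * v q t ξ)) t x -
      U (fun _ => 1) (Q (mm j k) (v k) (fun t ξ => pp q ξ * v j t ξ)) t x) := by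
    simp only [Finset.sum_sub_distrib]
    have a1 := U_lin2 (c := fun _ _ => 1) (fun _ _ => PM_one (d := d)) (fun j k => hQ j k j q) t x
    have a2 := U_lin2 (c := fun _ _ => 1) (fun _ _ => PM_one (d := d)) (fun j k => hQ j k q j) t x
    simp only [one_mul] at a1 a2
    have I1 := integrable_finsetSum Finset.univ fun j (_ : j ∈ Finset.univ) => integrable_finsetSum Finset.univ fun k (_ : k ∈ Finset.univ) => U_int (d := d) PM_one (hQ j k j q) t x
    have I2 := integrable_finsetSum Finset.univ fun j (_ : j ∈ Finset.univ) => integrable_finsetSum Finset.univ fun k (_ : k ∈ Finset.univ) => U_int (d := d) PM_one (hQ j k q j) t x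
    simp only [one_mul, ← Finset.mul_sum] at I1 I2
    rw [a1, a2, ← integral_sub I1 I2, U]
    congr 1; funext ξ
    simp only [NN, one_mul, Finset.sum_sub_distrib, mul_sub]
  have h2 : ∀ j i, U (fun _ => 1) (fun t ξ => pp j ξ * v i t ξ) t x = - U (fun _ => 1) (ix j (v i)) t x := fun j i => by
    rw [U, U, ← integral_neg]; congr 1; funext ξ; simp only [pp, ix]; ring
  rw [h1, ← Finset.sum_neg_distrib]
  refine Finset.sum_congr rfl fun j _ => ?_
  rw [uC_curl hv, uC, Finset.sum_mul, ← Finset.sum_neg_distrib]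
  refine Finset.sum_congr rfl fun k _ => ?_
  rw [U_Q (mm_MB j k) (hv k) (hp j q), U_Q (mm_MB j k) (hv k) (hp q j), h2, h2]
  ring

lemma uC_split {f : Vn d} (hf : ∀ i, RD (f i)) (q t x) : uC f q t x = U (fun _ => 1) (f q) t x - ∑ k, U (ml [q, k]) (f k) t x := by
  have I1 := integrable_finsetSum Finset.univ fun k (_ : k ∈ Finset.univ) => U_int (ml2_PM q k) (hf k) t x
  simp only [← Finset.mul_sum] at I1
  rw [uC_eq hf, U_linS (fun k => ml2_PM q k) hf, U, ← integral_sub (U_int PM_one (hf q) t x) I1]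
  congr 1; funext ξ
  rw [mm_w]; ring

lemma pres {f : Vn d} (hf : ∀ r i, Cl RD r (f i)) (h0 : ∀ i t, f i t 0 = 0) :
    ∃ p : Fn d, (∀ r, Cl JC r p) ∧ ∃ px : Fin d → Fn d, HX p px ∧ ∀ q t x, px q t x = ∑ k, U (ml [q, k]) (f k) t x := by
  choose R hR hfR using fun i => hadamard (fun r => hf r i)
  have hm : ∀ k l, PM (fun ξ => -Complex.I * ml [k, l] ξ : E d → ℂ) := fun k l => by
    obtain ⟨h1, a, C, hC⟩ := ml2_PM k l
    exact ⟨h1.const_mul _, a, C, fun ξ => by simpa using hC ξ⟩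
  refine ⟨fun t x => ∑ k, ∑ l, U (fun ξ => -Complex.I * ml [k, l] ξ) (R k l) t x,
    fun r => Cl.sumJC _ fun k _ => Cl.sumJC _ fun l _ => U_Cl (hm k l) (hR k l r), _,
    HX_sum _ fun k _ => HX_sum _ fun l _ => U_HX (hm k l) (hR k l 0), fun q t x => ?_⟩
  have := U_lin2 (c := fun _ _ => 1) hm (fun k l => ix_RD q (hR k l 0)) t x
  simp only [one_mul] at this
  rw [this, U_linS (fun k => ml2_PM q k) (hf 0)]
  congr 1; funext ξ
  congr 1
  refine Finset.sum_congr rfl fun k _ => ?_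
  rw [hfR k t ξ, h0, zero_mul, zero_add, Finset.mul_sum]
  refine Finset.sum_congr rfl fun l _ => ?_
  rw [ml2, ml2, ix]; push_cast
  linear_combination (-(ξ k * ξ l / sq ξ * (ξ q * R k l t ξ)) : ℂ) * Complex.I_mul_I

lemma uC_Ex3 (hd : 2 ≤ d) {f : Vn d} (hf : ∀ r i, Cl RD r (f i)) (h0 : ∀ i t, f i t 0 = 0) (q) : Ex3 (uC f q) := by
  choose R hR hfR using fun i => hadamard (fun r => hf r i)
  have h1 : uC f q = fun t x => U (fun _ => 1) (f q) t x + -∑ j, ∑ k, U (ml [k, q, j]) (R j k) t x := by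
    funext t x
    rw [uC_split (hf 0), sub_eq_add_neg]
    congr 2
    refine Finset.sum_congr rfl fun j _ => ?_
    rw [U_had (by simp) (fun r => hf r j) (hR j) (hfR j), h0, zero_mul, zero_add]
  rw [h1]
  exact (Ex3_one fun r => hf r q).add (Ex3_sum _ fun j _ => Ex3_sum _ fun k _ => Ex3_ml hd k q j (hR j k)).neg

lemma ex_conj (x ξ : E d) : (starRingEnd ℂ) (ex x ξ) = ex x (-ξ) := by
  rw [ex, ex, ← Complex.exp_conj]; simp [dt]

lemma uC_im {v : Vn d} (hr : ∀ i t ξ, (starRingEnd ℂ) (v i t (-ξ)) = v i t ξ) (q t x) : (uC v q t x).im = 0 := by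
  rw [← Complex.conj_eq_iff_im, uC, map_sum]
  refine Finset.sum_congr rfl fun k _ => ?_
  rw [U, ← integral_conj, ← integral_neg_eq_self]
  congr 1; funext ξ
  rw [map_mul, map_mul, ex_conj, neg_neg, mm_conj, mm_neg, hr]

lemma uC_add {f g : Vn d} (hf : ∀ i, RD (f i)) (hg : ∀ i, RD (g i)) (c : ℂ) {h : Vn d} (hh : ∀ i, RD (h i)) (t : ℝ)
    (e : ∀ i ξ, h i t ξ = c * f i t ξ + g i t ξ) (q x) : uC h q t x = c * uC f q t x + uC g q t x := by
  simp only [uC, Finset.mul_sum, ← Finset.sum_add_distrib]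
  refine Finset.sum_congr rfl fun k _ => ?_
  rw [U, U, U, ← integral_const_mul, ← integral_add ((U_int (mm_MB q k).PM (hf k) t x).const_mul _) (U_int (mm_MB q k).PM (hg k) t x)]
  congr 1; funext ξ
  rw [e]; ring

lemma ContDiff_re {F : Fn d} (h : ∀ r, Cl JC r F) : ContDiff ℝ (⊤ : ℕ∞) (fun z : ℝ × E d => (F z.1 z.2).re) :=
  Complex.reCLM.contDiff.comp (contDiff_infty.2 fun r => ClJC_contDiff (h r))

lemma uC_sum {ι : Type*} (s : Finset ι) {f : ι → Vn d} (hf : ∀ j i, RD (f j i)) (q t x) :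
    ∑ j ∈ s, uC (f j) q t x = uC (fun i t ξ => ∑ j ∈ s, f j i t ξ) q t x := by
  simp only [uC]
  rw [Finset.sum_comm]
  refine Finset.sum_congr rfl fun k _ => ?_
  have := U_lin s (fun _ => 1) (fun _ => (mm_MB q k).PM) (fun j => hf j k) t x
  simp only [one_mul] at this
  rw [this, U]
  simp only [Finset.mul_sum]

theorem pde (hd : 2 ≤ d) (ν T : ℝ) {v : Vn d} (hv : ∀ r i, Cl RD r (v i))
    (hr : ∀ i t ξ, (starRingEnd ℂ) (v i t (-ξ)) = v i t ξ) (h0 : ∀ i t, v i t 0 = 0)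
    (hde : ∀ i ξ, ∀ t ∈ Set.Icc 0 T, HasDerivAt (fun s => v i s ξ) (-(ν * sq ξ : ℂ) * v i t ξ + NN v v i t ξ) t) :
    ∃ P : ℝ → (Fin d → ℝ) → ℝ, ContDiff ℝ (⊤ : ℕ∞) (fun z : ℝ × (Fin d → ℝ) => P z.1 z.2) ∧
      (∀ t ∈ Set.Icc (0 : ℝ) T, ∀ x, ∀ q : Fin d,
        deriv (fun s => (uC v q s x).re) t + ∑ j : Fin d, (uC v j t x).re * pd j (fun y => (uC v q t y).re) x =
          ν * (∑ j : Fin d, pd j (pd j (fun y => (uC v q t y).re)) x) - pd q (P t) x) := by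
  have hN : ∀ r i, Cl RD r (NN v v i) := fun r i => NN_Cl (hv r) (hv r) i
  obtain ⟨p, p1, px, p2, p3⟩ := pres hN (NN_zero (hv 0))
  choose vt _ hvt _ hvt2 _ using fun i => Cl_all (fun r => hv r i)
  have D1 : ∀ j q t, pd j (fun y => (uC v q t y).re) = fun x => (uC (fun k => ix j (v k)) q t x).re := fun j q t =>
    funext fun x => re_pd (uC_HX (hv 0) q t x) j
  have D2 : ∀ j q t x, pd j (pd j (fun y => (uC v q t y).re)) x = (uC (fun k => ix j (ix j (v k))) q t x).re := fun j q t x => by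
    rw [D1]; exact re_pd (uC_HX (fun i => ix_RD j (hv 0 i)) q t x) j
  refine ⟨fun t x => (p t x).re - (∑ j, (uC v j t x).re ^ 2) / 2,
    (ContDiff_re p1).sub ((ContDiff.sum fun j _ => (ContDiff_re fun r => uC_Cl (hv r) j).pow 2).div_const 2), fun t ht x q => ?_⟩
  have DP : pd q (fun x => (p t x).re - (∑ j, (uC v j t x).re ^ 2) / 2) x = (px q t x).re - ∑ j, (uC v j t x).re * (uC (fun k => ix q (v k)) j t x).re := by
    have a1 := re_hfd (p2 t x) q
    have a2 := fun j => re_hfd (uC_HX (hv 0) j t x) q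
    have a3 := a1.sub ((HasFDerivAt.fun_sum fun j (_ : j ∈ Finset.univ) => (a2 j).pow 2).mul_const (2:ℝ)⁻¹)
    have a4 : fderiv ℝ (fun x => (p t x).re - (∑ j, (uC v j t x).re ^ 2) / 2) x = _ := a3.fderiv
    rw [pd, a4]
    simp only [ContinuousLinearMap.sub_apply, ContinuousLinearMap.smul_apply, ContinuousLinearMap.sum_apply, rg_single, smul_eq_mul, Finset.mul_sum]
    congr 1
    refine Finset.sum_congr rfl fun j _ => ?_
    simp
    try ring
  have DT : deriv (fun s => (uC v q s x).re) t = (uC (fun i => vt i) q t x).re :=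
    (Complex.reCLM.hasFDerivAt.comp_hasDerivAt t (uC_HT (hv 0) (fun i => hvt2 i 0) hvt q t x)).deriv
  have hs : ∀ i, RD (fun t ξ => ∑ j, ix j (ix j (v i)) t ξ) := fun i => ClRD_sum (r := 0) _ fun j _ => ix_RD j (ix_RD j (hv 0 i))
  have e1 := uC_add (f := fun i t ξ => ∑ j, ix j (ix j (v i)) t ξ) hs (fun i => hN 0 i) ν (fun i => hvt2 i 0) t (fun i ξ => by
    rw [(hvt i t ξ).unique (hde i ξ t ht)]
    congr 1
    simp only [ix]
    rw [sq]
    push_cast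
    have : ∀ j, Complex.I * ((ξ j:ℂ) * (Complex.I * ((ξ j:ℂ) * v i t ξ))) = (ξ j:ℂ)^2 * (- v i t ξ) := fun j => by
      linear_combination ((ξ j:ℂ)^2 * v i t ξ) * Complex.I_mul_I
    simp only [this, ← Finset.sum_mul]
    ring) q x
  rw [← uC_sum Finset.univ (fun j i => ix_RD j (ix_RD j (hv 0 i))), uC_split (hN 0), uC_NN (hv 0), ← p3] at e1
  have him := uC_im hr
  have e2 := congrArg Complex.re e1
  simp only [Complex.add_re, Complex.sub_re, Complex.neg_re, Complex.re_sum, Complex.mul_re, Complex.ofReal_re, Complex.ofReal_im, him, zero_mul, sub_zero, mul_sub, Finset.sum_sub_distrib] at e2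
  rw [DP, DT, e2]
  simp only [D2]
  simp only [D1]
  ring

lemma uC_divg {v : Vn d} (hv : ∀ i, RD (v i)) (t x) : ∑ j, pd j (fun y => (uC v j t y).re) x = 0 := by
  have D1 : ∀ j q t, pd j (fun y => (uC v q t y).re) = fun x => (uC (fun k => ix j (v k)) q t x).re := fun j q t =>
    funext fun x => re_pd (uC_HX hv q t x) j
  simp only [D1]
  rw [← Complex.re_sum, uC_div hv, Complex.zero_re]

lemma uC_init {v : Vn d} (hv : ∀ i, RD (v i)) (h : ∀ ξ, ∑ k, (ξ k : ℂ) * v k 0 ξ = 0) (q x) :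
    uC v q 0 x = U (fun _ => 1) (v q) 0 x := by
  rw [uC_eq hv, U]
  congr 1; funext ξ
  have : ∀ k, ml [q, k] ξ * v k 0 ξ = (ξ q / sq ξ : ℂ) * (ξ k * v k 0 ξ) := fun k => by rw [ml2]; push_cast; ring
  rw [mm_w]
  simp only [this, ← Finset.mul_sum, h]
  ring

lemma Sch_RD (f : SchwartzMap (E d) ℝ) : RD (fun _ x => (f x : ℂ) : Fn d) := by
  refine ⟨?_, fun M => ?_⟩
  · unfold JC
    exact Complex.continuous_ofReal.comp (f.continuous.comp continuous_snd)
  · refine ⟨2 ^ M * (Finset.Iic (M, 0)).sup (fun m => SchwartzMap.seminorm ℝ m.1 m.2) f, fun t x => ?_⟩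
    have := SchwartzMap.one_add_le_sup_seminorm_apply (𝕜 := ℝ) (m := (M, 0)) le_rfl le_rfl f x
    rw [norm_iteratedFDeriv_zero, mul_comm] at this
    simpa using this

lemma rg_eq (L : E d →L[ℝ] ℝ) : L = rg (fun k => L (Pi.single k 1)) := by
  ext w
  rw [rg_apply]
  conv_lhs => rw [← Finset.univ_sum_single w]
  rw [map_sum]
  refine Finset.sum_congr rfl fun k _ => ?_
  rw [show (Pi.single k (w k) : E d) = w k • Pi.single k 1 by rw [← Pi.single_smul]; simp, map_smul, smul_eq_mul, mul_comm]

lemma Sch_HX (f : SchwartzMap (E d) ℝ) : HX (fun _ x => (f x : ℂ) : Fn d) (fun k _ x => ((pd k f x : ℝ) : ℂ)) := fun t x => by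
  have h := f.differentiableAt (x := x) |>.hasFDerivAt
  rw [rg_eq (fderiv ℝ (⇑f) x)] at h
  exact hfd_ofReal h

open LineDeriv in
lemma Sch_Cl : ∀ (r : ℕ) (f : SchwartzMap (E d) ℝ), Cl RD r (fun _ x => (f x : ℂ) : Fn d)
  | 0, f => Sch_RD f
  | r+1, f => ⟨Sch_RD f, ⟨_, fun _ _ => hasDerivAt_const _ _, ClRD_zero r⟩, _, Sch_HX f, fun k =>
      Sch_Cl r (∂_{(Pi.single k 1 : E d)} f)⟩

lemma UR {f : Fn d} (hf : ∀ r, Cl RD r f) : RD (U (fun _ => 1) f) := by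
  refine ⟨U_JC PM_one (hf 0), fun M => ?_⟩
  obtain ⟨C, hC⟩ := U_one_Dc 0 M hf
  obtain ⟨K, hK⟩ := U_le PM_one (hf 0)
  have hK0 : 0 ≤ K := (norm_nonneg _).trans (hK 0 0)
  refine ⟨2 ^ M * max C K, fun t x => ?_⟩
  have hxe : ‖x‖ ≤ eucNorm x := (pi_norm_le_iff_of_nonneg (eucNorm_nn x)).2 fun i => abs_le_eucNorm x i
  by_cases hx : 1 < eucNorm x
  · have h0 : 0 < eucNorm x := by linarith
    have h1 := hC t x hx
    calc _ ≤ (C * eucNorm x ^ (-(M:ℤ))) * (2 * eucNorm x) ^ M := by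
          gcongr
          · exact (norm_nonneg _).trans h1
          · linarith
      _ = 2 ^ M * C := by rw [zpow_neg, zpow_natCast, mul_pow]; field_simp
      _ ≤ _ := by gcongr; exact le_max_left _ _
  · calc _ ≤ K * (2:ℝ) ^ M := by
          gcongr
          · exact hK t x
          · linarith
      _ ≤ _ := by rw [mul_comm]; gcongr; exact le_max_right _ _

lemma UR_Cl : ∀ (r : ℕ) {f : Fn d} (_ : ∀ r, Cl RD r f), Cl RD r (U (fun _ => 1) f)
  | 0, f, hf => UR hf
  | r+1, f, hf => by
    obtain ⟨ft, fx, h1, h2, h3, h4⟩ := Cl_all hf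
    exact ⟨UR hf, ⟨_, U_HT PM_one (hf 0) (h3 0) h1, UR_Cl r h3⟩, _, U_HX PM_one (hf 0), fun k => UR_Cl r fun r => ix_Cl k (hf r)⟩

lemma neg_Cl : ∀ {r : ℕ} {f : Fn d}, Cl RD r f → Cl RD r (fun t ξ => f t (-ξ))
  | 0, f, hf => ⟨hf.1.comp (by fun_prop : Continuous fun z : ℝ × E d => (z.1, -z.2)), fun M => by
      obtain ⟨C, hC⟩ := hf.2 M
      exact ⟨C, fun t ξ => by simpa using hC t (-ξ)⟩⟩
  | r+1, f, ⟨h0, ⟨ft, h1, h2⟩, fx, h3, h4⟩ => ⟨neg_Cl (r := 0) h0, ⟨_, fun t ξ => h1 t (-ξ), neg_Cl h2⟩,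
      fun k t ξ => - fx k t (-ξ), fun t ξ => by
        refine ((h3 t (-ξ)).comp ξ (hasFDerivAt_id ξ).neg).congr_fderiv ?_
        ext w
        simp [gr_apply], fun k => ClRD_neg (neg_Cl (h4 k))⟩

lemma trans_int (g : E d → ℂ) : ∫ y : EuclideanSpace ℝ (Fin d), g (WithLp.ofLp y) = ∫ y, g y :=
  (EuclideanSpace.volume_preserving_symm_measurableEquiv_toLp (Fin d)).integral_comp' g

lemma inner_dt (x y : EuclideanSpace ℝ (Fin d)) : inner ℝ x y = dt (WithLp.ofLp y) (WithLp.ofLp x) := by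
  simp [dt, PiLp.inner_apply]

open FourierTransform in
lemma inversion {f : Fn d} (hf : ∀ r, Cl RD r f) (t : ℝ) (x : E d) :
    ((((2 * Real.pi) ^ d)⁻¹ : ℝ) : ℂ) * ∫ ξ, ex x ξ * U (fun _ => 1) f t (-ξ) = f t x := by
  let g : EuclideanSpace ℝ (Fin d) → ℂ := fun y => f t (WithLp.ofLp y)
  have hmp := EuclideanSpace.volume_preserving_symm_measurableEquiv_toLp (Fin d)
  have hofc : Continuous fun y : EuclideanSpace ℝ (Fin d) => WithLp.ofLp y := PiLp.continuous_ofLp 2 _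
  have hc : Continuous g := ((hf 0).1.comp (by fun_prop : Continuous fun y : E d => (t, y))).comp hofc
  have hi : Integrable g := hmp.integrable_comp_of_integrable (RD_intg (hf 0) t)
  have hF : ∀ w, 𝓕 g w = U (fun _ => 1) f t (-((2 * Real.pi) • WithLp.ofLp w)) := fun w => by
    rw [Real.fourier_eq', U, ← trans_int]
    congr 1; funext y
    rw [inner_dt, smul_eq_mul, one_mul]
    congr 1
    rw [ex]
    congr 3
    simp only [dt, Pi.neg_apply, Pi.smul_apply, smul_eq_mul, Finset.mul_sum]
    exact Finset.sum_congr rfl fun k _ => by ring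
  have hpi : (2 * Real.pi) ≠ 0 := by positivity
  have hFi : Integrable (𝓕 g) := by
    have h1 : Integrable (fun y => U (fun _ => 1) f t (-y)) := RD_intg (neg_Cl (UR_Cl 0 hf)) t
    have h2 := h1.comp_smul hpi
    have h3 := hmp.integrable_comp_of_integrable h2
    exact h3.congr (.of_forall fun w => (hF w).symm)
  have key := congrFun (hc.fourierInv_fourier_eq hi hFi) (WithLp.toLp 2 x)
  rw [Real.fourierInv_eq'] at key
  have h5 : ∫ v, Complex.exp (((2 * Real.pi * inner ℝ v (WithLp.toLp 2 x) : ℝ) : ℂ) * Complex.I) • 𝓕 g v =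
      ∫ y : E d, (fun ξ => ex x ξ * U (fun _ => 1) f t (-ξ)) ((2 * Real.pi) • y) := by
    rw [← trans_int]
    congr 1; funext y
    rw [hF, inner_dt, smul_eq_mul]
    congr 1
    rw [ex]
    congr 3
    simp only [dt, Pi.smul_apply, smul_eq_mul, Finset.mul_sum]
    exact Finset.sum_congr rfl fun k _ => by ring
  rw [h5, Measure.integral_comp_smul volume (fun ξ => ex x ξ * U (fun _ => 1) f t (-ξ)) (2 * Real.pi)] at key
  rw [abs_of_pos (by positivity), Module.finrank_fin_fun, Complex.real_smul] at key
  exact key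

open LineDeriv in
lemma Sch_pd_RD (f : SchwartzMap (E d) ℝ) (j : Fin d) : RD (fun _ x => ((pd j f x : ℝ) : ℂ) : Fn d) :=
  Sch_RD (∂_{(Pi.single j 1 : E d)} f)

lemma zero_of_div {V : Fin d → E d → ℂ} (hc : ∀ i, Continuous (V i))
    (h : ∀ ξ : E d, ∑ k, (ξ k : ℂ) * V k ξ = 0) (i : Fin d) : V i 0 = 0 := by
  have hcont : Continuous fun ε : ℝ => V i (Pi.single i ε : E d) := (hc i).comp (continuous_const.update (f := fun _ : ℝ => (0 : Fin d → ℝ)) i continuous_id)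
  have hz : ∀ ε : ℝ, ε ≠ 0 → V i (Pi.single i ε : E d) = 0 := fun ε hε => by
    have := h (Pi.single i ε)
    rw [Finset.sum_eq_single i] at this
    · simpa [hε] using this
    · intro b _ hb; simp [Pi.single_eq_of_ne hb]
    · simp
  have h1 : Filter.Tendsto (fun ε : ℝ => V i (Pi.single i ε : E d)) (nhdsWithin 0 {0}ᶜ) (nhds 0) :=
    tendsto_const_nhds.congr' (Filter.eventuallyEq_of_mem self_mem_nhdsWithin fun ε hε => (hz ε hε).symm)
  have h2 := (hcont.tendsto 0).mono_left (nhdsWithin_le_nhds (s := ({0}ᶜ : Set ℝ)))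
  have := tendsto_nhds_unique h2 h1
  simpa using this

lemma Sch_div (f : Fin d → SchwartzMap (E d) ℝ) (h : ∀ x, ∑ j : Fin d, pd j (f j) x = 0) (ξ : E d) :
    ∑ k, (ξ k : ℂ) * U (fun _ => 1) (fun _ x => (f k x : ℂ)) 0 ξ = 0 := by
  have h1 := fun k => U_ibp (Sch_RD (f k)) (Sch_HX (f k)) (Sch_pd_RD (f k)) k 0 ξ
  simp only [h1]
  rw [← Finset.mul_sum, U_linS (fun _ => PM_one) (fun k => Sch_pd_RD (f k) k)]
  have : ∀ x, ∑ k, (1:ℂ) * ((pd k (f k) x : ℝ) : ℂ) = 0 := fun x => by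
    simp only [one_mul]
    rw [← Complex.ofReal_sum, h x, Complex.ofReal_zero]
  simp only [this, mul_zero, integral_zero]

lemma Sch_conj (f : SchwartzMap (E d) ℝ) (ξ : E d) :
    (starRingEnd ℂ) (U (fun _ => 1) (fun _ x => (f x : ℂ)) 0 ξ) = U (fun _ => 1) (fun _ x => (f x : ℂ)) 0 (-ξ) := by
  unfold U
  rw [← integral_conj]
  congr 1; funext y
  simp only [one_mul, map_mul, Complex.conj_ofReal, ex_conj]
  congr 1
  simp [ex, dt]

theorem initd (u0 : (Fin d → ℝ) → Fin d → ℝ)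
    (hu0 : ∀ q : Fin d, ∃ f : SchwartzMap (Fin d → ℝ) ℝ, ∀ x, u0 x q = f x)
    (hdiv0 : ∀ x, ∑ j : Fin d, pd j (fun y => u0 y j) x = 0) :
    ∃ V0 : Fin d → E d → ℂ, (∀ r i, Cl RD r (fun _ ξ => V0 i ξ : Fn d)) ∧
      (∀ i ξ, (starRingEnd ℂ) (V0 i (-ξ)) = V0 i ξ) ∧ (∀ i, V0 i 0 = 0) ∧ (∀ ξ, ∑ k, (ξ k : ℂ) * V0 k ξ = 0) ∧
      ∀ q x, ∫ ξ, ex x ξ * V0 q ξ = u0 x q := by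
  choose f hf using hu0
  have hdf : ∀ x, ∑ j : Fin d, pd j (f j) x = 0 := fun x => by
    rw [← hdiv0 x]
    refine Finset.sum_congr rfl fun k _ => ?_
    congr 1
    exact funext fun y => (hf k y).symm
  have hd1 := Sch_div f hdf
  have hj := fun k => Sch_conj (f k)
  have hn := fun k x => inversion (fun r => Sch_Cl r (f k)) 0 x
  have hW : ∀ r i, Cl RD r (fun _ ξ => U (fun _ => 1) (fun _ x => (f i x : ℂ)) 0 (-ξ) : Fn d) := fun r i =>
    neg_Cl (UR_Cl r fun r => Sch_Cl r (f i))
  generalize hW0 : (fun k => U (fun _ => 1) (fun _ x => (f k x : ℂ)) 0) = W at *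
  have e : ∀ k ξ, U (fun _ => 1) (fun _ x => (f k x : ℂ)) 0 ξ = W k ξ := fun k ξ => by rw [← hW0]
  simp only [e] at hd1 hj hn hW
  obtain ⟨c, hc⟩ : ∃ c : ℝ, ((2 * Real.pi) ^ d)⁻¹ = c := ⟨_, rfl⟩
  rw [hc] at hn
  have hV : ∀ r i, Cl RD r (fun _ ξ => (c:ℂ) * W i (-ξ) : Fn d) := fun r i => ClRD_cmul c (hW r i)
  have hd2 : ∀ ξ : E d, ∑ k, (ξ k : ℂ) * ((c:ℂ) * W k (-ξ)) = 0 := fun ξ => by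
    have := hd1 (-ξ)
    have e : ∀ k, (ξ k : ℂ) * ((c:ℂ) * W k (-ξ)) = -(c:ℂ) * ((((-ξ) k : ℝ) : ℂ) * W k (-ξ)) := fun k => by
      simp only [Pi.neg_apply]; push_cast; ring
    simp only [e]
    rw [← Finset.mul_sum, this, mul_zero]
  refine ⟨fun q ξ => (c:ℂ) * W q (-ξ), hV, fun i ξ => ?_, fun i => ?_, hd2, fun q x => ?_⟩
  · simp only [map_mul, Complex.conj_ofReal, hj, neg_neg]
  · refine zero_of_div (V := fun q ξ => (c:ℂ) * W q (-ξ)) (fun i => ?_) hd2 i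
    have h := (hV 0 i).1
    unfold JC at h
    exact h.comp (Continuous.prodMk_right (0:ℝ))
  · rw [hf q x, ← hn q x, ← integral_const_mul]
    congr 1; funext ξ; ring

end NS

open NS in
theorem stmt11 (d : ℕ) (hd : 2 ≤ d) (ν : ℝ) (hν : 0 < ν)
    (u0 : (Fin d → ℝ) → Fin d → ℝ)
    (hu0 : ∀ q : Fin d, ∃ f : SchwartzMap (Fin d → ℝ) ℝ, ∀ x, u0 x q = f x)
    (hdiv0 : ∀ x, ∑ j : Fin d, pd j (fun y => u0 y j) x = 0) :
    ∃ T > (0 : ℝ), ∃ u : ℝ → (Fin d → ℝ) → Fin d → ℝ, ∃ P : ℝ → (Fin d → ℝ) → ℝ,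
      (∀ q : Fin d, ContDiff ℝ (⊤ : ℕ∞) (fun z : ℝ × (Fin d → ℝ) => u z.1 z.2 q)) ∧
      ContDiff ℝ (⊤ : ℕ∞) (fun z : ℝ × (Fin d → ℝ) => P z.1 z.2) ∧
      (∀ x, u 0 x = u0 x) ∧
      (∀ t ∈ Set.Icc (0 : ℝ) T, ∀ x, ∑ j : Fin d, pd j (fun y => u t y j) x = 0) ∧
      (∀ t ∈ Set.Icc (0 : ℝ) T, ∀ x, ∀ q : Fin d,
        deriv (fun s => u s x q) t + ∑ j : Fin d, u t x j * pd j (fun y => u t y q) x =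
          ν * (∑ j : Fin d, pd j (pd j (fun y => u t y q)) x) - pd q (P t) x) ∧
      (∀ N : ℕ, d + 1 ≤ N →
        ∃ a : ℕ → ℝ → (Fin d → ℝ) → Fin d → ℝ,
          -- continuity in (t, θ)
          (∀ k, d + 1 ≤ k → k ≤ N → ∀ q : Fin d,
            ContinuousOn (fun z : ℝ × (Fin d → ℝ) => a k z.1 z.2 q)
              (Set.Icc 0 T ×ˢ {θ : Fin d → ℝ | eucNorm θ = 1})) ∧
          -- continuous differentiability in t
          (∀ k, d + 1 ≤ k → k ≤ N → ∀ θ : Fin d → ℝ, eucNorm θ = 1 → ∀ q : Fin d,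
            ContDiffOn ℝ 1 (fun t => a k t θ q) (Set.Icc 0 T)) ∧
          -- (i) each component of a_k(t,·) is the restriction to the unit sphere of a
          -- homogeneous harmonic polynomial of degree k - d + 2
          (∀ k, d + 1 ≤ k → k ≤ N → ∀ t ∈ Set.Icc (0 : ℝ) T, ∀ q : Fin d,
            ∃ H : MvPolynomial (Fin d) ℝ, H.IsHomogeneous (k - d + 2) ∧
              (∀ x, ∑ j : Fin d, pd j (pd j (fun y => MvPolynomial.eval y H)) x = 0) ∧
              (∀ θ : Fin d → ℝ, eucNorm θ = 1 → a k t θ q = MvPolynomial.eval θ H)) ∧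
          -- (ii) the asymptotic expansion with remainder estimate
          (∀ α : Fin d → ℕ, ∃ C > (0 : ℝ), ∀ t ∈ Set.Icc (0 : ℝ) T, ∀ x : Fin d → ℝ,
            2 ≤ eucNorm x → ∀ q : Fin d,
              |pdm α (fun y => u t y q -
                  ∑ k ∈ Finset.Icc (d + 1) N,
                    a k t ((eucNorm y)⁻¹ • y) q * eucNorm y ^ (-(k : ℝ))) x| ≤
                C * eucNorm x ^ (-((N : ℝ) + 1) - ((∑ j, α j : ℕ) : ℝ)))) ∧
      -- in particular, decay of u itself
      (∀ α : Fin d → ℕ, ∃ C > (0 : ℝ), ∀ t ∈ Set.Icc (0 : ℝ) T, ∀ x : Fin d → ℝ,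
        2 ≤ eucNorm x → ∀ q : Fin d,
          |pdm α (fun y => u t y q) x| ≤
            C * eucNorm x ^ (-((d : ℝ) + 1) - ((∑ j, α j : ℕ) : ℝ))) := by
  obtain ⟨V0, hV, hre, hz, hdv, hinv⟩ := initd u0 hu0 hdiv0
  obtain ⟨T, hT, v, hv, hr, h0, hi, hde⟩ := exSol ν hν hV hre hz
  obtain ⟨P, hP, hns⟩ := pde hd ν T hv hr h0 hde
  have hE : ∀ q, Ex3 (uC v q) := uC_Ex3 hd hv h0
  haveI : Nonempty (Fin d) := ⟨⟨0, by omega⟩⟩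
  refine ⟨T, hT, fun t x q => (uC v q t x).re, P, fun q => ContDiff_re fun r => uC_Cl (hv r) q, hP, fun x => ?_,
    fun t _ x => uC_divg (hv 0) t x, hns, fun N hN => ?_, fun α => ?_⟩
  · funext q
    beta_reduce
    rw [uC_init (hv 0) (fun ξ => by simp only [hi]; exact hdv ξ), U]
    simp only [hi, one_mul]
    rw [hinv q x, Complex.ofReal_re]
  · choose a a1 a2 a3 a4 using fun q => asym (hE q) N hN
    refine ⟨fun k t x q => a q k t x, fun k h1 h2 q => (a1 q k h1 h2).continuousOn,
      fun k h1 h2 θ _ q => (a2 q k h1 h2 θ).contDiffOn, fun k h1 h2 t _ q => a3 q k h1 h2 t, fun α => ?_⟩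
    choose C hC hb using fun q => a4 q α
    refine ⟨∑ q, C q, Finset.sum_pos (fun q _ => hC q) Finset.univ_nonempty, fun t _ x hx q => (hb q t x hx).trans ?_⟩
    exact mul_le_mul_of_nonneg_right (Finset.single_le_sum (fun i _ => (hC i).le) (Finset.mem_univ q)) (Real.rpow_nonneg (eucNorm_nn x) _)
  · choose C hC hb using fun q => asym0 (hE q) α
    refine ⟨∑ q, C q, Finset.sum_pos (fun q _ => hC q) Finset.univ_nonempty, fun t _ x hx q => (hb q t x hx).trans ?_⟩
    exact mul_le_mul_of_nonneg_right (Finset.single_le_sum (fun i _ => (hC i).le) (Finset.mem_univ q)) (Real.rpow_nonneg (eucNorm_nn x) _)
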